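/- Let n be a positive integer. For every κ > 0 and every σ < n there exist ε > 0 and δ₀ > 0 (depending on n, κ, σ) such that for all 0 < δ < δ₀ the following holds. Let A ⊆ End(ℝⁿ) and X ⊆ ℝⁿ satisfy: (i) A ⊆ B(0, δ^{-ε}); (ii) for every ρ ≥ δ, N_ρ(A) ≥ δ^ε ρ^{-κ}; (iii) A acts δ^ε-irreducibly on ℝⁿ; (iv) X ⊆ B(0, δ^{-ε}); (v) for every ρ ≥ δ, N_ρ(X) ≥ δ^ε ρ^{-κ}; (vi) N_δ(X) ≤ δ^{-σ-ε}. Then either N_δ(X + X) ≥ (δ^{-ε}/2) N_δ(X), or there exists a ∈ A with N_δ(X + aX) ≥ (δ^{-ε}/2) N_δ(X), where aX = {ax : x ∈ X}. -/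

import Mathlib

open Pointwise

/-- Covering number at scale `δ` of a subset of a (pseudo)metric space: the least number of
closed `δ`-balls needed to cover `S`. -/
noncomputable def covNum {X : Type*} [PseudoMetricSpace X] (δ : ℝ) (S : Set X) : ℕ :=
  sInf {N : ℕ | ∃ F : Finset X, F.card ≤ N ∧ S ⊆ ⋃ x ∈ F, Metric.closedBall x δ}

/-- A set `A` of endomorphisms of Euclidean `ℝⁿ` acts `ρ`-irreducibly: for every nonzero
proper subspace `W` there are `a ∈ A` and `w ∈ W` with `‖w‖ ≤ 1` and `dist(aw, W) ≥ ρ`. -/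
def ActsIrreducibly {n : ℕ} (ρ : ℝ)
    (A : Set (EuclideanSpace ℝ (Fin n) →L[ℝ] EuclideanSpace ℝ (Fin n))) : Prop :=
  ∀ W : Submodule ℝ (EuclideanSpace ℝ (Fin n)), W ≠ ⊥ → W ≠ ⊤ →
    ∃ a ∈ A, ∃ w ∈ W, ‖w‖ ≤ 1 ∧
      ρ ≤ Metric.infDist (a w) (W : Set (EuclideanSpace ℝ (Fin n)))

namespace LinearGrowth

open Finset

section PolySet

variable {R : Type*} [NormedRing R]

/-- Elements obtained from `A ∪ {0, 1}` by at most `l` rounds of ring operations. -/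
def polySet (A : Set R) : ℕ → Set R
  | 0 => A ∪ {0, 1}
  | l + 1 => {r | ∃ x ∈ polySet A l, ∃ y ∈ polySet A l, r = x + y ∨ r = x - y ∨ r = x * y}

theorem add_mem_polySet {A : Set R} {l : ℕ} {x y : R} (hx : x ∈ polySet A l)
    (hy : y ∈ polySet A l) : x + y ∈ polySet A (l + 1) :=
  ⟨x, hx, y, hy, Or.inl rfl⟩

theorem sub_mem_polySet {A : Set R} {l : ℕ} {x y : R} (hx : x ∈ polySet A l)
    (hy : y ∈ polySet A l) : x - y ∈ polySet A (l + 1) :=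
  ⟨x, hx, y, hy, Or.inr (Or.inl rfl)⟩

theorem mul_mem_polySet {A : Set R} {l : ℕ} {x y : R} (hx : x ∈ polySet A l)
    (hy : y ∈ polySet A l) : x * y ∈ polySet A (l + 1) :=
  ⟨x, hx, y, hy, Or.inr (Or.inr rfl)⟩

theorem zero_mem_polySet (A : Set R) (l : ℕ) : (0 : R) ∈ polySet A l := by
  induction l with
  | zero => simp [polySet]
  | succ l ih => simpa using add_mem_polySet ih ih

theorem polySet_subset_succ (A : Set R) (l : ℕ) : polySet A l ⊆ polySet A (l + 1) := fun x hx => by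
  simpa using add_mem_polySet hx (zero_mem_polySet A l)

theorem polySet_mono (A : Set R) : Monotone (polySet A) :=
  monotone_nat_of_le_succ (polySet_subset_succ A)

theorem one_mem_polySet (A : Set R) (l : ℕ) : (1 : R) ∈ polySet A l :=
  polySet_mono A (Nat.zero_le l) (by simp [polySet])

theorem subset_polySet (A : Set R) (l : ℕ) : A ⊆ polySet A l := fun _ hx =>
  polySet_mono A (Nat.zero_le l) (Or.inl hx)

theorem sum_mem_polySet {A : Set R} {l : ℕ} {ι : Type*} (s : Finset ι) (f : ι → R)
    (hf : ∀ i ∈ s, f i ∈ polySet A l) : ∑ i ∈ s, f i ∈ polySet A (l + s.card) := by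
  classical
  induction s using Finset.induction_on with
  | empty => simpa using zero_mem_polySet A l
  | insert a s ha ih =>
    rw [sum_insert ha, card_insert_of_notMem ha, ← add_assoc]
    exact add_mem_polySet (polySet_mono A (by omega) (hf a (mem_insert_self a s)))
      (ih fun i hi => hf i (mem_insert_of_mem hi))

theorem norm_le_of_mem_polySet {A : Set R} {K : ℝ} (hK : 2 ≤ K) (h1 : ‖(1 : R)‖ ≤ 1)
    (hA : A ⊆ Metric.closedBall 0 K) (l : ℕ) : ∀ p ∈ polySet A l, ‖p‖ ≤ K ^ 2 ^ l := by
  induction l with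
  | zero =>
    rintro p (hp | rfl | rfl)
    · simpa using hA hp
    · simpa using by linarith
    · simpa using by linarith
  | succ l ih =>
    have h2 : (2 : ℝ) ≤ K ^ 2 ^ l := hK.trans (le_self_pow₀ (by linarith) (by positivity))
    have h3 : K ^ 2 ^ (l + 1) = K ^ 2 ^ l * K ^ 2 ^ l := by rw [← pow_add]; ring_nf
    rintro p ⟨x, hx, y, hy, rfl | rfl | rfl⟩
    · have := norm_add_le x y
      have := ih x hx
      have := ih y hy
      nlinarith
    · have := norm_sub_le x y
      have := ih x hx
      have := ih y hy
      nlinarith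
    · rw [h3]
      exact (norm_mul_le x y).trans
        (mul_le_mul (ih x hx) (ih y hy) (norm_nonneg _) (by linarith))

end PolySet

section QIndep

variable {V : Type*} [NormedAddCommGroup V] [NormedSpace ℝ V]

/-- Quantitative linear independence. -/
def QIndep (η : ℝ) {m : ℕ} (z : Fin m → V) : Prop :=
  ∀ (c : Fin m → ℝ) (i : Fin m), η * |c i| ≤ ‖∑ j, c j • z j‖

theorem QIndep.linearIndependent {η : ℝ} (hη : 0 < η) {m : ℕ} {z : Fin m → V}
    (hz : QIndep η z) : LinearIndependent ℝ z := by
  rw [Fintype.linearIndependent_iff]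
  intro c hc i
  have := hz c i
  rw [hc, norm_zero] at this
  by_contra h
  have := abs_pos.2 h
  nlinarith

theorem QIndep.snoc {η θ B : ℝ} (hη1 : η ≤ 1) (hθ : 0 < θ) (hB : 1 ≤ B) {m : ℕ}
    {z : Fin m → V} (hz : QIndep η z) {v : V} (hv : ‖v‖ ≤ B)
    (hd : ∀ w ∈ Submodule.span ℝ (Set.range z), θ ≤ ‖v - w‖) :
    QIndep (η * θ / (2 * B)) (Fin.snoc z v : Fin (m + 1) → V) := by
  intro c i
  have hθB : θ ≤ B := by
    simpa using (hd 0 (Submodule.zero_mem _)).trans (by simpa using hv)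
  set s : V := ∑ j : Fin m, c j.castSucc • z j with hs
  have hsum : ∑ j, c j • (Fin.snoc z v : Fin (m + 1) → V) j = s + c (Fin.last m) • v := by
    simp [Fin.sum_univ_castSucc, hs]
  rw [hsum]
  set c' := c (Fin.last m) with hc'
  have hsW : s ∈ Submodule.span ℝ (Set.range z) :=
    Submodule.sum_mem _ fun j _ => Submodule.smul_mem _ _ (Submodule.subset_span ⟨j, rfl⟩)
  have h1 : |c'| * θ ≤ ‖s + c' • v‖ := by
    by_cases h0 : c' = 0
    · simp [h0]
    · have := hd (-(c'⁻¹ • s)) (Submodule.neg_mem _ (Submodule.smul_mem _ _ hsW))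
      calc |c'| * θ ≤ |c'| * ‖v - -(c'⁻¹ • s)‖ := by gcongr
        _ = ‖s + c' • v‖ := by
          rw [← Real.norm_eq_abs, ← norm_smul, smul_sub, smul_neg, smul_smul,
            mul_inv_cancel₀ h0, one_smul, sub_neg_eq_add, add_comm]
  have hn := norm_nonneg (s + c' • v)
  have e : η * θ / (2 * B) * |c i| = (η * θ * |c i|) / (2 * B) := by ring
  rw [e, div_le_iff₀ (by positivity)]
  refine Fin.lastCases ?_ (fun j => ?_) i
  · have h2 : η * θ * |c'| ≤ 1 * (|c'| * θ) := by
      rw [mul_assoc, mul_comm θ]; gcongr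
    nlinarith
  · have h2 := hz (fun j => c j.castSucc) j
    have h3 : ‖s‖ ≤ ‖s + c' • v‖ + |c'| * B := by
      calc ‖s‖ = ‖(s + c' • v) - c' • v‖ := by simp
        _ ≤ _ := norm_sub_le _ _
        _ ≤ _ := by rw [norm_smul, Real.norm_eq_abs]; gcongr
    have h4 : η * |c j.castSucc| ≤ ‖s + c' • v‖ + |c'| * B := h2.trans h3
    calc η * θ * |c j.castSucc| = (η * |c j.castSucc|) * θ := by ring
      _ ≤ (‖s + c' • v‖ + |c'| * B) * θ := by gcongr
      _ = ‖s + c' • v‖ * θ + (|c'| * θ) * B := by ring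
      _ ≤ ‖s + c' • v‖ * B + ‖s + c' • v‖ * B := by gcongr
      _ = _ := by ring

end QIndep

/-- Coordinates with respect to a family of nearly maximal volume in a spanning set are bounded. -/
theorem exists_bounded_coords_of_span_eq_top {F : Type*} [NormedAddCommGroup F] [NormedSpace ℝ F]
    [FiniteDimensional ℝ F] {S : Set F} {B : ℝ} (hB : ∀ x ∈ S, ‖x‖ ≤ B)
    (hS : Submodule.span ℝ S = ⊤) :
    ∃ g : Fin (Module.finrank ℝ F) → F, (∀ i, g i ∈ S) ∧
      ∀ p ∈ S, ∃ c : Fin (Module.finrank ℝ F) → ℝ, (∀ i, |c i| ≤ 2) ∧ p = ∑ i, c i • g i := by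
  classical
  set d := Module.finrank ℝ F
  obtain ⟨b, hbS⟩ : ∃ b : Module.Basis (Fin d) ℝ F, ∀ i, b i ∈ S := by
    let b₀ := Module.Basis.ofSpan hS.ge
    have : Fintype _ := FiniteDimensional.fintypeBasisIndex b₀
    refine ⟨b₀.reindex (Fintype.equivFinOfCardEq (Module.finrank_eq_card_basis b₀).symm), ?_⟩
    intro i
    rw [Module.Basis.reindex_apply]
    exact Module.Basis.ofSpan_subset hS.ge ⟨_, rfl⟩
  let T : Set ℝ := {t | ∃ v : Fin d → F, (∀ i, v i ∈ S) ∧ t = |b.det v|}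
  have hbdd : BddAbove T := by
    have hc : ∃ D : ℝ, ∀ i, ∀ x ∈ S, |b.repr x i| ≤ D := by
      have h1 : ∀ i, ∃ D : ℝ, 0 ≤ D ∧ ∀ x ∈ S, |b.repr x i| ≤ D := fun i => by
        let φ : F →L[ℝ] ℝ := LinearMap.toContinuousLinearMap (b.coord i)
        refine ⟨‖φ‖ * |B|, by positivity, fun x hx => ?_⟩
        calc |b.repr x i| = ‖φ x‖ := rfl
          _ ≤ ‖φ‖ * ‖x‖ := φ.le_opNorm x
          _ ≤ ‖φ‖ * |B| := by gcongr; exact (hB x hx).trans (le_abs_self B)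
      choose D hD0 hD using h1
      exact ⟨∑ i, D i, fun i x hx => (hD i x hx).trans
        (single_le_sum (fun j _ => hD0 j) (mem_univ i))⟩
    obtain ⟨D, hD⟩ := hc
    refine ⟨(Nat.factorial (Fintype.card (Fin d))) • D ^ Fintype.card (Fin d), ?_⟩
    rintro t ⟨v, hv, rfl⟩
    rw [Module.Basis.det_apply]
    exact Matrix.det_le (abv := AbsoluteValue.abs) fun i j => hD i (v j) (hv j)
  have h1T : (1 : ℝ) ∈ T := ⟨b, hbS, by simp [Module.Basis.det_self]⟩
  have hsup : 1 ≤ sSup T := le_csSup hbdd h1T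
  obtain ⟨t, ⟨g, hg, rfl⟩, ht⟩ := exists_lt_of_lt_csSup ⟨1, h1T⟩ (show sSup T / 2 < sSup T by linarith)
  have hdet : b.det g ≠ 0 := by
    intro h; rw [h, abs_zero] at ht; linarith
  obtain ⟨hli, hsp⟩ := (Module.Basis.is_basis_iff_det b).2 hdet.isUnit
  refine ⟨g, hg, fun p hp => ⟨fun i => (Module.Basis.mk hli hsp.ge).coord i p, fun i => ?_, ?_⟩⟩
  · have h := congrArg (fun φ => φ p) (Module.Basis.det_smul_mk_coord_eq_det_update b hli hsp.ge i)
    simp only [LinearMap.smul_apply, smul_eq_mul, MultilinearMap.toLinearMap_apply] at h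
    have h2 : |b.det (Function.update g i p)| ≤ sSup T := by
      refine le_csSup hbdd ⟨_, fun j => ?_, rfl⟩
      by_cases hj : j = i
      · subst hj; simpa using hp
      · simpa [hj] using hg j
    have h3 : |b.det g| * |(Module.Basis.mk hli hsp.ge).coord i p| ≤ sSup T := by
      rw [← abs_mul, h]; exact h2
    by_contra hcon
    push Not at hcon
    nlinarith [abs_pos.2 hdet]
  · have := (Module.Basis.mk hli hsp.ge).sum_repr p
    simpa using this.symm

theorem exists_bounded_coords {F : Type*} [NormedAddCommGroup F] [NormedSpace ℝ F]
    [FiniteDimensional ℝ F] {S : Set F} {B : ℝ} (hB : ∀ x ∈ S, ‖x‖ ≤ B) (h0 : (0 : F) ∈ S)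
    {N : ℕ} (hN : Module.finrank ℝ F ≤ N) :
    ∃ g : Fin N → F, (∀ i, g i ∈ S) ∧
      ∀ p ∈ S, ∃ c : Fin N → ℝ, (∀ i, |c i| ≤ 2) ∧ p = ∑ i, c i • g i := by
  set W := Submodule.span ℝ S
  let S' : Set W := {x | (x : F) ∈ S}
  have hS' : Submodule.span ℝ S' = ⊤ := Submodule.span_span_coe_preimage
  obtain ⟨g, hg, hc⟩ := exists_bounded_coords_of_span_eq_top (S := S') (B := B)
    (fun x hx => hB x hx) hS'
  have hd : Module.finrank ℝ W ≤ N := (Submodule.finrank_le W).trans hN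
  generalize Module.finrank ℝ W = d at g hg hc hd
  refine ⟨fun i => if h : i.1 < d then (g ⟨i, h⟩ : F) else 0, fun i => ?_, fun p hp => ?_⟩
  · dsimp only
    split_ifs with h
    · exact hg _
    · exact h0
  · obtain ⟨c, hc1, hc2⟩ := hc ⟨p, Submodule.subset_span hp⟩ hp
    refine ⟨fun i => if h : i.1 < d then c ⟨i, h⟩ else 0, fun i => ?_, ?_⟩
    · dsimp only
      split_ifs with h
      · exact hc1 _
      · simp
    · have h1 : p = ∑ i, c i • (g i : F) := by
        have := congrArg (Subtype.val) hc2
        simpa using this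
      rw [h1]
      obtain ⟨e, rfl⟩ := Nat.exists_eq_add_of_le hd
      rw [Fin.sum_univ_add]
      simp

end LinearGrowth

namespace LinearGrowth

open Finset

/-- Euclidean space of dimension `n`. -/
abbrev Vec (n : ℕ) : Type := EuclideanSpace ℝ (Fin n)

/-- Endomorphisms of Euclidean space with the operator norm. -/
abbrev Op (n : ℕ) : Type := Vec n →L[ℝ] Vec n

theorem QIndep.mono {V : Type*} [NormedAddCommGroup V] [NormedSpace ℝ V] {η η' : ℝ} {m : ℕ}
    {z : Fin m → V} (hz : QIndep η z) (h : η' ≤ η) : QIndep η' z := fun c i =>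
  (mul_le_mul_of_nonneg_right h (abs_nonneg _)).trans (hz c i)

theorem norm_one_op_le (n : ℕ) : ‖(1 : Op n)‖ ≤ 1 := ContinuousLinearMap.norm_id_le

variable {n : ℕ}

/-- If `a` moves the span of a quantitatively independent family away from itself, it moves one
of its members away from it. -/
theorem QIndep.exists_far {η ρ : ℝ} (hη : 0 < η) (hρ : 0 < ρ) {m : ℕ} {z : Fin m → Vec n}
    (hz : QIndep η z) (a : Op n) {w : Vec n} (hw : w ∈ Submodule.span ℝ (Set.range z))
    (hw1 : ‖w‖ ≤ 1)
    (hd : ρ ≤ Metric.infDist (a w) (Submodule.span ℝ (Set.range z) : Set (Vec n))) :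
    ∃ i, ∀ u ∈ Submodule.span ℝ (Set.range z), η * ρ / m ≤ ‖a (z i) - u‖ := by
  obtain ⟨c, rfl⟩ := (Submodule.mem_span_range_iff_exists_fun ℝ).1 hw
  have hm : m ≠ 0 := by
    rintro rfl
    have : Metric.infDist (a (∑ i, c i • z i)) (Submodule.span ℝ (Set.range z) : Set (Vec n)) ≤ 0 := by
      simpa using Metric.infDist_le_dist_of_mem (x := a (∑ i, c i • z i)) (Submodule.zero_mem (Submodule.span ℝ (Set.range z)))
    linarith
  have hm0 : (0 : ℝ) < m := by positivity
  have hc : ∀ i, |c i| ≤ η⁻¹ := fun i => by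
    rw [← one_div, le_div_iff₀ hη, mul_comm]; exact (hz c i).trans hw1
  by_contra! hcon
  choose u hu hlt using hcon
  have h1 : ∑ i, c i • u i ∈ Submodule.span ℝ (Set.range z) :=
    Submodule.sum_mem _ fun i _ => Submodule.smul_mem _ _ (hu i)
  have h2 := hd.trans (Metric.infDist_le_dist_of_mem (x := a (∑ i, c i • z i)) h1)
  rw [dist_eq_norm, map_sum, ← sum_sub_distrib] at h2
  have h3 : ‖∑ i, (a (c i • z i) - c i • u i)‖ < ρ := by
    have : Nonempty (Fin m) := ⟨⟨0, Nat.pos_of_ne_zero hm⟩⟩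
    calc _ ≤ ∑ i, ‖a (c i • z i) - c i • u i‖ := norm_sum_le _ _
      _ ≤ ∑ i, η⁻¹ * ‖a (z i) - u i‖ := by
          refine sum_le_sum fun i _ => ?_
          rw [map_smul, ← smul_sub, norm_smul, Real.norm_eq_abs]
          gcongr
          exact hc i
      _ < ∑ i : Fin m, η⁻¹ * (η * ρ / m) :=
          sum_lt_sum_of_nonempty univ_nonempty fun i _ => by gcongr; exact hlt i
      _ = ρ := by simp; field_simp
  linarith

theorem exists_qIndep_orbit {m : ℕ} (hm : 1 ≤ m) (hmn : m ≤ n) :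
    ∃ C : ℕ, ∀ K : ℝ, 2 ≤ K → (n : ℝ) ≤ K → ∀ A : Set (Op n), A ⊆ Metric.closedBall 0 K →
      ActsIrreducibly K⁻¹ A → ∀ x : Vec n, ‖x‖ = 1 →
      ∃ p : Fin m → Op n, (∀ i, p i ∈ polySet A m) ∧ QIndep (K ^ C)⁻¹ fun i => p i x := by
  induction m, hm using Nat.le_induction with
  | base =>
    refine ⟨0, fun K _ _ A _ _ x hx => ⟨fun _ => 1, fun _ => one_mem_polySet A 1, fun c i => ?_⟩⟩
    have : i = 0 := Subsingleton.elim _ _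
    subst this
    simp [norm_smul, hx]
  | succ m hm ih =>
    obtain ⟨C, hC⟩ := ih (by omega)
    refine ⟨2 * C + 4 + 2 ^ m, fun K hK hnK A hA hirr x hx => ?_⟩
    obtain ⟨p, hp, hind⟩ := hC K hK hnK A hA hirr x hx
    have hK0 : 0 < K := by linarith
    set η := (K ^ C)⁻¹ with hηdef
    have hη : 0 < η := by positivity
    have hη1 : η ≤ 1 := inv_le_one_of_one_le₀ (one_le_pow₀ (by linarith))
    have hli := hind.linearIndependent hη
    set z : Fin m → Vec n := fun i => p i x with hz
    obtain ⟨a, haA, w, hw, hw1, hd⟩ := hirr (Submodule.span ℝ (Set.range z))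
      (by
        intro h
        have := hli.ne_zero ⟨0, hm⟩
        exact this ((Submodule.mem_bot ℝ).1 (h ▸ Submodule.subset_span ⟨_, rfl⟩)))
      (by
        intro h
        have h1 := finrank_span_eq_card hli
        rw [h, finrank_top] at h1
        simp at h1
        omega)
    obtain ⟨i, hi⟩ := hind.exists_far hη (inv_pos.2 hK0) a hw hw1 hd
    have hpos : (0 : ℝ) < m := by exact_mod_cast hm
    have hnorm : ‖a (z i)‖ ≤ K ^ (1 + 2 ^ m) := by
      calc ‖a (z i)‖ ≤ ‖a‖ * (‖p i‖ * ‖x‖) :=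
            (a.le_opNorm _).trans (by gcongr; exact (p i).le_opNorm x)
        _ ≤ K * (K ^ 2 ^ m * 1) := by
            gcongr
            · simpa using hA haA
            · exact norm_le_of_mem_polySet hK (norm_one_op_le n) hA m _ (hp i)
            · exact hx.le
        _ = _ := by ring
    have h := hind.snoc hη1 (θ := η * K⁻¹ / m) (by positivity)
      (one_le_pow₀ (by linarith : (1 : ℝ) ≤ K)) hnorm hi
    refine ⟨Fin.snoc p (a * p i), fun j => ?_, ?_⟩
    · refine Fin.lastCases ?_ (fun j => ?_) j
      · simpa using mul_mem_polySet (subset_polySet A m haA) (hp i)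
      · simpa using polySet_subset_succ A m (hp j)
    · have e : (fun j => (Fin.snoc p (a * p i) : Fin (m + 1) → Op n) j x) =
          (Fin.snoc z (a (z i)) : Fin (m + 1) → Vec n) := by
        funext j
        refine Fin.lastCases ?_ (fun j => ?_) j <;> simp [hz]
      rw [e]
      refine h.mono ?_
      have hmK : (m : ℝ) ≤ K := le_trans (by exact_mod_cast (by omega : m ≤ n)) hnK
      have e2 : η * (η * K⁻¹ / m) / (2 * K ^ (1 + 2 ^ m)) =
          (K ^ C * (K ^ C * K * m) * (2 * K ^ (1 + 2 ^ m)))⁻¹ := by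
        rw [hηdef]; field_simp
      rw [e2]
      gcongr
      calc K ^ C * (K ^ C * K * m) * (2 * K ^ (1 + 2 ^ m))
          ≤ K ^ C * (K ^ C * K * K) * (K * K ^ (1 + 2 ^ m)) := by gcongr
        _ = _ := by ring

theorem exists_coords_orbit (hn : 0 < n) :
    ∃ C : ℕ, ∀ K : ℝ, 2 ≤ K → (n : ℝ) ≤ K → ∀ A : Set (Op n), A ⊆ Metric.closedBall 0 K →
      ActsIrreducibly K⁻¹ A → ∀ x y : Vec n, x ≠ 0 →
      ∃ p : Fin n → Op n, (∀ i, p i ∈ polySet A n) ∧ ∃ c : Fin n → ℝ,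
        (∀ i, |c i| * ‖x‖ ≤ K ^ C * ‖y‖) ∧ ∑ i, c i • p i x = y := by
  obtain ⟨C, hC⟩ := exists_qIndep_orbit (n := n) hn le_rfl
  refine ⟨C, fun K hK hnK A hA hirr x y hx => ?_⟩
  have hx0 : 0 < ‖x‖ := norm_pos_iff.2 hx
  obtain ⟨p, hp, hind⟩ := hC K hK hnK A hA hirr (‖x‖⁻¹ • x) (by
    rw [norm_smul, norm_inv, norm_norm, inv_mul_cancel₀ hx0.ne'])
  have hKC : 0 < K ^ C := by positivity
  have hli := hind.linearIndependent (inv_pos.2 hKC)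
  have hsp : Submodule.span ℝ (Set.range fun i => p i (‖x‖⁻¹ • x)) = ⊤ := by
    refine hli.span_eq_top_of_card_eq_finrank' ?_
    simp
  obtain ⟨c, hc⟩ := (Submodule.mem_span_range_iff_exists_fun ℝ).1
    (hsp ▸ Submodule.mem_top : y ∈ Submodule.span ℝ (Set.range fun i => p i (‖x‖⁻¹ • x)))
  refine ⟨p, hp, fun i => c i * ‖x‖⁻¹, fun i => ?_, ?_⟩
  · have := hind c i
    rw [hc, inv_mul_le_iff₀ hKC] at this
    rw [abs_mul, abs_of_pos (inv_pos.2 hx0), mul_assoc, inv_mul_cancel₀ hx0.ne', mul_one]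
    exact this
  · simpa [smul_smul] using hc

/-- A family `g` of elements of `polySet A S₀` along which any vector can be reached from any
nonzero vector with coefficients controlled by `H`. -/
structure Frame (A : Set (Op n)) (H : ℝ) (S₀ N : ℕ) (g : Fin N → Op n) : Prop where
  mem : ∀ j, g j ∈ polySet A S₀
  norm_le : ∀ j, ‖g j‖ ≤ H
  span : ∀ x y : Vec n, x ≠ 0 → ∃ c : Fin N → ℝ,
    (∀ j, |c j| * ‖x‖ ≤ H * ‖y‖) ∧ ∑ j, c j • g j x = y
  card_le : 4 * (N : ℝ) + 4 ≤ H

theorem exists_frame (hn : 0 < n) :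
    ∃ C : ℕ, ∃ K₀ : ℝ, ∀ K : ℝ, K₀ ≤ K → ∀ A : Set (Op n), A ⊆ Metric.closedBall 0 K →
      ActsIrreducibly K⁻¹ A → ∀ H, K ^ C ≤ H → ∃ g : Fin (n * n) → Op n,
        Frame A H n (n * n) g := by
  obtain ⟨C, hC⟩ := exists_coords_orbit hn
  refine ⟨C + 2 + 2 ^ n, 4 * ((n * n : ℕ) : ℝ) + 4 + n, fun K hK A hA hirr H hH => ?_⟩
  have hn0 : (0 : ℝ) ≤ n := by positivity
  have hnn : (0 : ℝ) ≤ ((n * n : ℕ) : ℝ) := by positivity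
  have hK2 : 2 ≤ K := by linarith
  have hK1 : 1 ≤ K := by linarith
  have hnK : (n : ℝ) ≤ K := by linarith
  have hnorm := norm_le_of_mem_polySet hK2 (norm_one_op_le n) hA n
  obtain ⟨g, hg, hc⟩ := exists_bounded_coords hnorm (zero_mem_polySet A n) (N := n * n)
    (by
      rw [← (LinearMap.toContinuousLinearMap (𝕜 := ℝ) (E := Vec n) (F' := Vec n)).finrank_eq]
      simp [Module.finrank_linearMap])
  refine ⟨g, hg, fun j => (hnorm _ (hg j)).trans (le_trans ?_ hH), fun x y hx => ?_, ?_⟩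
  · exact pow_le_pow_right₀ hK1 (by omega)
  · obtain ⟨p, hp, c, hcn, rfl⟩ := hC K hK2 hnK A hA hirr x y hx
    choose d hd1 hd2 using fun i => hc (p i) (hp i)
    refine ⟨fun j => ∑ i, c i * d i j, fun j => ?_, ?_⟩
    · calc |∑ i, c i * d i j| * ‖x‖ ≤ (∑ i, |c i| * 2) * ‖x‖ := by
            gcongr
            refine (abs_sum_le_sum_abs _ _).trans (sum_le_sum fun i _ => ?_)
            rw [abs_mul]; gcongr; exact hd1 i j
        _ = ∑ i, 2 * (|c i| * ‖x‖) := by rw [sum_mul]; exact sum_congr rfl fun _ _ => by ring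
        _ ≤ ∑ i : Fin n, 2 * (K ^ C * ‖∑ i, c i • p i x‖) := sum_le_sum fun i _ => by linarith [hcn i]
        _ = n * 2 * K ^ C * ‖∑ i, c i • p i x‖ := by simp; ring
        _ ≤ H * ‖∑ i, c i • p i x‖ := by
            gcongr
            calc n * 2 * K ^ C ≤ K * K * K ^ C := by gcongr
              _ = K ^ (C + 2) := by ring
              _ ≤ K ^ (C + 2 + 2 ^ n) := pow_le_pow_right₀ hK1 (Nat.le_add_right _ _)
              _ ≤ H := hH
    · simp_rw [sum_smul]
      rw [sum_comm]
      refine sum_congr rfl fun i _ => ?_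
      conv_rhs => rw [hd2 i]
      rw [_root_.sum_apply, smul_sum]
      simp [smul_smul]
  · have : K ≤ H := (le_self_pow₀ hK1 (by positivity)).trans hH
    linarith

namespace Frame

variable {A : Set (Op n)} {H : ℝ} {S₀ N : ℕ} {g : Fin N → Op n}

theorem four_le (F : Frame A H S₀ N g) : 4 ≤ H := by
  have := F.card_le
  have : (0 : ℝ) ≤ N := by positivity
  linarith

theorem pos (F : Frame A H S₀ N g) : 0 < H := by linarith [F.four_le]

theorem one_le (F : Frame A H S₀ N g) : 1 ≤ H := by linarith [F.four_le]

theorem exists_unit_norm_apply (hn : 0 < n) (u : Op n) : ∃ y, ‖y‖ = 1 ∧ ‖u‖ ≤ 2 * ‖u y‖ := by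
  have : Nontrivial (Vec n) := by
    have : Nonempty (Fin n) := ⟨⟨0, hn⟩⟩
    infer_instance
  by_cases hu : u = 0
  · obtain ⟨y, hy⟩ := exists_norm_eq (Vec n) (zero_le_one)
    exact ⟨y, hy, by simp [hu]⟩
  · have hpos := norm_pos_iff.2 hu
    obtain ⟨x, hx1, hx2⟩ := u.exists_lt_apply_of_lt_opNorm (half_lt_self hpos)
    have hx0 : 0 < ‖x‖ := by
      rw [norm_pos_iff]; rintro rfl; simp at hx2; linarith
    refine ⟨‖x‖⁻¹ • x, by rw [norm_smul, norm_inv, norm_norm, inv_mul_cancel₀ hx0.ne'], ?_⟩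
    rw [map_smul, norm_smul, norm_inv, norm_norm]
    have : ‖u x‖ ≤ ‖x‖⁻¹ * ‖u x‖ := le_mul_of_one_le_left (norm_nonneg _) (one_le_inv_iff₀.2 ⟨hx0, hx1.le⟩)
    linarith

theorem exists_norm_mul_le_apply (hn : 0 < n) (F : Frame A H S₀ N g) (u : Op n) (x : Vec n) :
    x = 0 ∨ ∃ j, ‖u‖ * ‖x‖ ≤ H ^ 2 * ‖u (g j x)‖ := by
  by_cases hx : x = 0
  · exact Or.inl hx
  right
  obtain ⟨y, hy1, hy2⟩ := exists_unit_norm_apply hn u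
  obtain ⟨c, hc, hcy⟩ := F.span x y hx
  have hx0 := norm_pos_iff.2 hx
  by_contra! hcon
  have h1 : ‖u y‖ * ‖x‖ ≤ ∑ j, H * ‖u (g j x)‖ := by
    rw [← hcy, map_sum]
    calc _ ≤ (∑ j, ‖u (c j • g j x)‖) * ‖x‖ := by gcongr; exact norm_sum_le _ _
      _ = ∑ j, (|c j| * ‖x‖) * ‖u (g j x)‖ := by
          rw [sum_mul]; refine sum_congr rfl fun j _ => ?_
          rw [map_smul, norm_smul, Real.norm_eq_abs]; ring
      _ ≤ _ := by
          gcongr with j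
          simpa [hy1] using hc j
  have h2 : H * (‖u y‖ * ‖x‖) ≤ ∑ j : Fin N, ‖u‖ * ‖x‖ := by
    calc H * (‖u y‖ * ‖x‖) ≤ H * ∑ j, H * ‖u (g j x)‖ := by gcongr; exact F.pos.le
      _ = ∑ j, H ^ 2 * ‖u (g j x)‖ := by rw [mul_sum]; exact sum_congr rfl fun _ _ => by ring
      _ ≤ _ := sum_le_sum fun j _ => (hcon j).le
  simp only [sum_const, card_univ, Fintype.card_fin, nsmul_eq_mul] at h2
  by_cases hu : u = 0
  · have hN : 0 < N := by
      by_contra hN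
      have hN0 : N = 0 := by omega
      subst hN0
      simp at hcy
      rw [← hcy, norm_zero] at hy1; linarith
    have := hcon ⟨0, hN⟩
    simp [hu] at this
  · have hup : 0 < ‖u‖ * ‖x‖ := mul_pos (norm_pos_iff.2 hu) hx0
    have h3 : ‖u‖ * ‖x‖ ≤ 2 * (‖u y‖ * ‖x‖) := by nlinarith
    have h4 : H * (‖u‖ * ‖x‖) ≤ 2 * N * (‖u‖ * ‖x‖) := by nlinarith [F.pos]
    have := F.card_le
    have : (0 : ℝ) ≤ N := by positivity
    have h5 : H ≤ 2 * N := le_of_mul_le_mul_right h4 hup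
    linarith

theorem exists_le_apply (hn : 0 < n) (F : Frame A H S₀ N g) (u : Op n) (x : Vec n) :
    ∃ j, ‖u‖ * ‖x‖ ≤ H ^ 2 * ‖u (g j x)‖ := by
  rcases F.exists_norm_mul_le_apply hn u x with rfl | h
  · obtain ⟨y, hy1, -⟩ := exists_unit_norm_apply hn u
    have hy : y ≠ 0 := by rintro rfl; simp at hy1
    obtain ⟨j, -⟩ := (F.exists_norm_mul_le_apply hn u y).resolve_left hy
    exact ⟨j, by simp⟩
  · exact h

theorem exists_le_mul (hn : 0 < n) (F : Frame A H S₀ N g) (u v : Op n) :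
    ∃ j, ‖u‖ * ‖v‖ ≤ H ^ 3 * ‖u * g j * v‖ := by
  obtain ⟨x, hx1, hx2⟩ := exists_unit_norm_apply hn v
  obtain ⟨j, hj⟩ := F.exists_le_apply hn u (v x)
  refine ⟨j, ?_⟩
  have h1 : ‖u (g j (v x))‖ ≤ ‖u * g j * v‖ := by
    simpa [hx1] using (u * g j * v).le_opNorm x
  calc ‖u‖ * ‖v‖ ≤ ‖u‖ * (2 * ‖v x‖) := by gcongr
    _ = 2 * (‖u‖ * ‖v x‖) := by ring
    _ ≤ H * (H ^ 2 * ‖u * g j * v‖) := by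
        have h2 := hj.trans (mul_le_mul_of_nonneg_left h1 (by positivity : 0 ≤ H ^ 2))
        have h3 : 0 ≤ ‖u‖ * ‖v x‖ := by positivity
        exact mul_le_mul (by linarith [F.four_le]) h2 h3 F.pos.le
    _ = _ := by ring

theorem norm_mul_mul_le (F : Frame A H S₀ N g) (u v : Op n) (j : Fin N) :
    ‖u * g j * v‖ ≤ H * ‖u‖ * ‖v‖ := by
  calc ‖u * g j * v‖ ≤ ‖u‖ * ‖g j‖ * ‖v‖ :=
        (norm_mul_le _ _).trans (by gcongr; exact norm_mul_le _ _)
    _ ≤ ‖u‖ * H * ‖v‖ := by gcongr; exact F.norm_le j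
    _ = _ := by ring

end Frame

end LinearGrowth

namespace LinearGrowth

open Finset

theorem exists_separated_of_le_covNum {X : Type*} [PseudoMetricSpace X] {ρ : ℝ} (hρ : 0 ≤ ρ)
    {S : Set X} {M : ℕ} (h : M ≤ covNum ρ S) :
    ∃ F : Finset X, (F : Set X) ⊆ S ∧ F.card = M ∧ ∀ x ∈ F, ∀ y ∈ F, x ≠ y → ρ < dist x y := by
  classical
  induction M with
  | zero => exact ⟨∅, by simp, rfl, by simp⟩
  | succ M ih =>
    obtain ⟨F, hFS, hFc, hF⟩ := ih (by omega)
    have : ¬ S ⊆ ⋃ x ∈ F, Metric.closedBall x ρ := fun hcov => by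
      have : covNum ρ S ≤ M := Nat.sInf_le ⟨F, hFc.le, hcov⟩
      omega
    obtain ⟨x, hxS, hx⟩ := Set.not_subset.1 this
    simp only [Set.mem_iUnion, Metric.mem_closedBall, not_exists, not_le] at hx
    have hxF : x ∉ F := fun hxF => absurd (hx x hxF) (by simp [hρ])
    refine ⟨insert x F, ?_, ?_, ?_⟩
    · rw [coe_insert]; exact Set.insert_subset hxS hFS
    · rw [card_insert_of_notMem hxF, hFc]
    · intro y hy z hz hyz
      rcases mem_insert.1 hy with rfl | hy' <;> rcases mem_insert.1 hz with rfl | hz'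
      · exact absurd rfl hyz
      · exact hx z hz'
      · rw [dist_comm]; exact hx y hy'
      · exact hF y hy' z hz' hyz

theorem card_mul_pow_le_of_separated {F : Type*} [NormedAddCommGroup F] [NormedSpace ℝ F]
    [FiniteDimensional ℝ F] {ρ R : ℝ} (hρ : 0 < ρ) (hR : 0 ≤ R) {T : Finset F}
    (hT : ∀ x ∈ T, ‖x‖ ≤ R) (hsep : ∀ x ∈ T, ∀ y ∈ T, x ≠ y → ρ < dist x y) :
    (T.card : ℝ) * (ρ / 2) ^ Module.finrank ℝ F ≤ (R + ρ / 2) ^ Module.finrank ℝ F := by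
  borelize F
  let μ : MeasureTheory.Measure F := MeasureTheory.Measure.addHaar
  have h1 : μ (⋃ x ∈ T, Metric.closedBall x (ρ / 2)) = ∑ x ∈ T, μ (Metric.closedBall x (ρ / 2)) := by
    refine MeasureTheory.measure_biUnion_finset ?_ fun x _ => Metric.isClosed_closedBall.measurableSet
    intro x hx y hy hxy
    exact Metric.closedBall_disjoint_closedBall (by linarith [hsep x hx y hy hxy])
  have h2 : μ (⋃ x ∈ T, Metric.closedBall x (ρ / 2)) ≤ μ (Metric.closedBall 0 (R + ρ / 2)) := by
    refine MeasureTheory.measure_mono (Set.iUnion₂_subset fun x hx => ?_)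
    refine Metric.closedBall_subset_closedBall' ?_
    rw [dist_zero_right]
    linarith [hT x hx]
  rw [h1] at h2
  simp_rw [MeasureTheory.Measure.addHaar_closedBall μ _ (by positivity : 0 ≤ ρ / 2),
    MeasureTheory.Measure.addHaar_closedBall μ _ (by positivity : 0 ≤ R + ρ / 2)] at h2
  rw [sum_const, nsmul_eq_mul, ← mul_assoc] at h2
  have hpos : μ (Metric.ball 0 1) ≠ 0 := (Metric.measure_ball_pos μ _ one_pos).ne'
  have hfin : μ (Metric.ball 0 1) ≠ ⊤ := MeasureTheory.measure_ball_lt_top.ne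
  rw [ENNReal.mul_le_mul_iff_left hpos hfin, ← ENNReal.ofReal_natCast, ← ENNReal.ofReal_mul (by positivity),
    ENNReal.ofReal_le_ofReal_iff (by positivity)] at h2
  exact h2

variable {n : ℕ}

theorem finrank_op (n : ℕ) : Module.finrank ℝ (Op n) = n * n := by
  rw [← (LinearMap.toContinuousLinearMap (𝕜 := ℝ) (E := Vec n) (F' := Vec n)).finrank_eq]
  simp [Module.finrank_linearMap]

/-- A frame together with a large separated subset of `A`. -/
structure RichFrame (A : Set (Op n)) (H : ℝ) (S₀ N e₁ : ℕ) (g : Fin N → Op n)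
    (T : Finset (Op n)) : Prop extends Frame A H S₀ N g where
  sub : (T : Set (Op n)) ⊆ A
  bound : ∀ a ∈ T, ‖a‖ ≤ H
  sep : ∀ a ∈ T, ∀ b ∈ T, a ≠ b → 1 < H ^ e₁ * ‖a - b‖
  card : H ^ (4 * N) < T.card
  le_card : n * n ≤ N
  pos_dim : 0 < n

namespace RichFrame

variable {A : Set (Op n)} {H : ℝ} {S₀ N e₁ : ℕ} {g : Fin N → Op n} {T : Finset (Op n)}

theorem exists_small (F : RichFrame A H S₀ N e₁ g T) :
    ∃ z ∈ polySet A 1, 1 ≤ H ^ e₁ * ‖z‖ ∧ H ^ 2 * ‖z‖ ≤ 1 := by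
  have hH := F.four_le
  have hH0 := F.pos
  by_contra! hcon
  have h1 : ∀ x ∈ T, ∀ y ∈ T, x ≠ y → (H ^ 2)⁻¹ < dist x y := fun x hx y hy hxy => by
    have := hcon (x - y) (sub_mem_polySet (subset_polySet A 0 (F.sub hx))
      (subset_polySet A 0 (F.sub hy))) (F.sep x hx y hy hxy).le
    rw [dist_eq_norm, inv_lt_iff_one_lt_mul₀' (by positivity)]
    exact this
  have h2 := card_mul_pow_le_of_separated (by positivity) hH0.le F.bound h1
  rw [finrank_op, ← le_div_iff₀ (by positivity), ← div_pow] at h2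
  have h3 : (H + (H ^ 2)⁻¹ / 2) / ((H ^ 2)⁻¹ / 2) ≤ H ^ 4 := by
    have : (H + (H ^ 2)⁻¹ / 2) / ((H ^ 2)⁻¹ / 2) = 2 * H ^ 3 + 1 := by field_simp
    rw [this]
    have : 1 ≤ H ^ 3 := one_le_pow₀ F.one_le
    nlinarith
  have h4 : (T.card : ℝ) ≤ H ^ (4 * N) :=
    calc (T.card : ℝ) ≤ (H ^ 4) ^ (n * n) := h2.trans (pow_le_pow_left₀ (by positivity) h3 _)
      _ = H ^ (4 * (n * n)) := by rw [← pow_mul]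
      _ ≤ _ := pow_le_pow_right₀ F.one_le (by have := F.le_card; omega)
  linarith [F.card]

/-- Elements of every prescribed size, up to a fixed power of `H`. -/
theorem exists_size (S₀ q : ℕ) : ∃ c, ∀ {n : ℕ} {A : Set (Op n)} {H : ℝ} {N e₁ : ℕ}
    {g : Fin N → Op n} {T : Finset (Op n)}, RichFrame A H S₀ N e₁ g T → ∀ τ : ℝ,
    1 ≤ H ^ q * τ → τ ≤ 1 → ∃ z ∈ polySet A c, ‖z‖ ≤ τ ∧ τ ≤ H ^ (e₁ + 3) * ‖z‖ := by
  induction q with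
  | zero =>
    refine ⟨0, fun {n A H N e₁ g T} F τ h1 h2 => ⟨1, one_mem_polySet A 0, ?_⟩⟩
    have hn : Nonempty (Fin n) := ⟨⟨0, F.pos_dim⟩⟩
    have : ‖(1 : Op n)‖ = 1 := norm_one
    have hτ : τ = 1 := by linarith
    subst hτ
    rw [this]
    exact ⟨le_rfl, by simpa using one_le_pow₀ F.one_le⟩
  | succ q ih =>
    obtain ⟨c, hc⟩ := ih
    refine ⟨max c (max S₀ 1) + 2, fun {n A H N e₁ g T} F τ h1 h2 => ?_⟩
    have hH := F.one_le
    have hH0 := F.pos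
    have hτ0 : 0 < τ := by
      by_contra hτ
      have : H ^ (q + 1) * τ ≤ 0 := mul_nonpos_of_nonneg_of_nonpos (by positivity) (not_lt.1 hτ)
      linarith
    obtain ⟨z, hz, hz1, hz2⟩ := hc F (min 1 (τ * H)) (by
      rw [mul_min_of_nonneg _ _ (by positivity), le_min_iff]
      refine ⟨by simpa using one_le_pow₀ hH, by rw [pow_succ] at h1; linarith⟩) (min_le_left _ _)
    have hτmin : τ ≤ min 1 (τ * H) := le_min h2 (by nlinarith)
    by_cases hzτ : ‖z‖ ≤ τ
    · exact ⟨z, polySet_mono A (by omega) hz, hzτ, hτmin.trans hz2⟩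
    · push Not at hzτ
      obtain ⟨z₁, hz₁, hz₁l, hz₁u⟩ := F.exists_small
      obtain ⟨j, hj⟩ := F.exists_le_mul F.pos_dim z z₁
      refine ⟨z * g j * z₁, ?_, ?_, ?_⟩
      · exact mul_mem_polySet (mul_mem_polySet (polySet_mono A (by omega) hz)
          (polySet_mono A (by omega) (F.mem j))) (polySet_mono A (by omega) hz₁)
      · calc ‖z * g j * z₁‖ ≤ H * ‖z‖ * ‖z₁‖ := F.norm_mul_mul_le z z₁ j
          _ ≤ H * (τ * H) * ‖z₁‖ := by gcongr; exact hz1.trans (min_le_right _ _)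
          _ = τ * (H ^ 2 * ‖z₁‖) := by ring
          _ ≤ τ * 1 := by gcongr
          _ = τ := mul_one τ
      · calc τ = τ * 1 := (mul_one τ).symm
          _ ≤ ‖z‖ * (H ^ e₁ * ‖z₁‖) := by gcongr
          _ = H ^ e₁ * (‖z‖ * ‖z₁‖) := by ring
          _ ≤ H ^ e₁ * (H ^ 3 * ‖z * g j * z₁‖) := by gcongr
          _ = _ := by ring

/-- Some coordinate orbit map separates many elements of `A`. -/
theorem exists_separating (F : RichFrame A H S₀ N e₁ g T) {M : ℕ} (hM : (M : ℝ) ≤ H ^ 4)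
    {x : Vec n} (hx : ‖x‖ = 1) : ∃ j, ∃ T' ⊆ T, T'.card = M ∧
      ∀ a ∈ T', ∀ b ∈ T', a ≠ b → 1 < H ^ (e₁ + 3) * ‖(a - b) (g j x)‖ := by
  classical
  by_contra! hcon
  set ρ : ℝ := (H ^ (e₁ + 3))⁻¹ with hρ
  have hH0 := F.pos
  have hρ0 : 0 < ρ := by positivity
  have key : ∀ j, ∃ G : Finset (Vec n), G.card ≤ M ∧ ∀ a ∈ T, ∃ v ∈ G, ‖a (g j x) - v‖ ≤ ρ := by
    intro j
    by_contra! hno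
    have hlt : M ≤ covNum ρ ((fun a : Op n => a (g j x)) '' T) := by
      by_contra! hlt
      have hne : {N : ℕ | ∃ G : Finset (Vec n), G.card ≤ N ∧
          ((fun a : Op n => a (g j x)) '' T) ⊆ ⋃ y ∈ G, Metric.closedBall y ρ}.Nonempty := by
        refine ⟨_, T.image fun a : Op n => a (g j x), le_rfl, ?_⟩
        rintro _ ⟨a, ha, rfl⟩
        simp only [Set.mem_iUnion]
        exact ⟨_, mem_image_of_mem _ ha, Metric.mem_closedBall_self hρ0.le⟩
      obtain ⟨G, hG1, hG2⟩ := Nat.sInf_mem hne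
      obtain ⟨a, ha, hav⟩ := hno G (hG1.trans hlt.le)
      have := hG2 ⟨a, ha, rfl⟩
      simp only [Set.mem_iUnion, Metric.mem_closedBall, dist_eq_norm] at this
      obtain ⟨v, hv, h⟩ := this
      exact absurd h (not_le.2 (hav v hv))
    obtain ⟨G, hG1, hG2, hG3⟩ := exists_separated_of_le_covNum hρ0.le hlt
    have hlift : ∀ v ∈ G, ∃ a ∈ T, a (g j x) = v := fun v hv => by simpa using hG1 hv
    choose! f hf1 hf2 using hlift
    obtain ⟨a, ha, b, hb, hab, h⟩ := hcon j (G.image f)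
      (by intro a ha; obtain ⟨v, hv, rfl⟩ := mem_image.1 ha; exact hf1 v hv)
      (by
        rw [card_image_of_injOn, hG2]
        intro v hv w hw hvw
        rw [← hf2 v hv, ← hf2 w hw, hvw])
    obtain ⟨v, hv, rfl⟩ := mem_image.1 ha
    obtain ⟨w, hw, rfl⟩ := mem_image.1 hb
    have h3 := hG3 v hv w hw (fun h => hab (h ▸ rfl))
    rw [dist_eq_norm, hρ, inv_lt_iff_one_lt_mul₀' (by positivity), ← hf2 v hv, ← hf2 w hw] at h3
    rw [_root_.sub_apply] at h
    rw [hf2 v hv, hf2 w hw] at h h3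
    linarith
  choose G hG1 hG2 using key
  choose! φ hφ1 hφ2 using hG2
  have hcard : T.card ≤ (Fintype.piFinset G).card := by
    refine card_le_card_of_injOn (fun a j => φ j a) (fun a ha => ?_) (fun a ha b hb hab => ?_)
    · simpa using fun j => hφ1 j a ha
    · by_contra hne
      obtain ⟨j, hj⟩ := F.exists_le_apply F.pos_dim (a - b) x
      have h1 : ‖(a - b) (g j x)‖ ≤ 2 * ρ := by
        have e : (a - b) (g j x) = (a (g j x) - φ j a) - (b (g j x) - φ j b) := by
          rw [show φ j a = φ j b from congrFun hab j]; simp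
        rw [e]
        refine (norm_sub_le _ _).trans ?_
        linarith [hφ2 j a ha, hφ2 j b hb]
      have h2 := F.sep a ha b hb hne
      rw [hx, mul_one] at hj
      have h3 : H ^ e₁ * ‖a - b‖ ≤ H ^ e₁ * (H ^ 2 * (2 * ρ)) := by gcongr; exact hj.trans (by gcongr)
      have h4 : H ^ e₁ * (H ^ 2 * (2 * ρ)) = 2 / H := by rw [hρ]; field_simp; ring
      have h5 : 2 / H ≤ 1 := by rw [div_le_one hH0]; linarith [F.four_le]
      linarith
  rw [Fintype.card_piFinset] at hcard
  have h1 : (∏ j, (G j).card) ≤ M ^ N := by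
    simpa using prod_le_pow_card univ (fun j => (G j).card) M fun j _ => hG1 j
  have h2 : (T.card : ℝ) ≤ H ^ (4 * N) := by
    calc (T.card : ℝ) ≤ ((M ^ N : ℕ) : ℝ) := by exact_mod_cast hcard.trans h1
      _ = (M : ℝ) ^ N := by push_cast; rfl
      _ ≤ (H ^ 4) ^ N := by gcongr
      _ = _ := by rw [← pow_mul]
  linarith [F.card]

end RichFrame

end LinearGrowth

namespace LinearGrowth

open Finset MeasureTheory

variable {n : ℕ}

/-- Nonnegative measurable functions that are integrable and square integrable. -/
structure Profile (Ψ : Vec n → ℝ) : Prop where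
  nonneg : ∀ x, 0 ≤ Ψ x
  meas : Measurable Ψ
  memLp : MemLp Ψ 2
  integrable : Integrable Ψ

/-- Autocorrelation of a function. -/
noncomputable def corr (Ψ : Vec n → ℝ) (b : Vec n) : ℝ := ∫ x, Ψ (x + b) * Ψ x

/-- Sum of translates of a function. -/
def spread {ι : Type*} [Fintype ι] (Ψ : Vec n → ℝ) (v : ι → Vec n) (x : Vec n) : ℝ :=
  ∑ a, Ψ (x + v a)

namespace Profile

variable {Ψ : Vec n → ℝ}

theorem memLp_translate (P : Profile Ψ) (b : Vec n) : MemLp (fun x => Ψ (x + b)) 2 :=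
  P.memLp.comp_measurePreserving (measurePreserving_add_right volume b)

theorem integrable_mul (P : Profile Ψ) (b c : Vec n) :
    Integrable fun x => Ψ (x + b) * Ψ (x + c) :=
  (P.memLp_translate b).integrable_mul (P.memLp_translate c)

theorem integrable_mul' (P : Profile Ψ) (b : Vec n) :
    Integrable fun x => Ψ (x + b) * Ψ x := by
  simpa using P.integrable_mul b 0

theorem corr_nonneg (P : Profile Ψ) (b : Vec n) : 0 ≤ corr Ψ b :=
  integral_nonneg fun _ => mul_nonneg (P.nonneg _) (P.nonneg _)

theorem corr_le (P : Profile Ψ) (b : Vec n) : corr Ψ b ≤ corr Ψ 0 := by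
  have h0 : corr Ψ 0 = ∫ x, Ψ x * Ψ x := by simp [corr]
  have hb : ∫ x, Ψ (x + b) * Ψ (x + b) = corr Ψ 0 := by
    rw [h0, integral_add_right_eq_self (fun x => Ψ x * Ψ x) b]
  have h1 : corr Ψ b ≤ ∫ x, (Ψ (x + b) * Ψ (x + b) / 2 + Ψ x * Ψ x / 2) := by
    refine integral_mono (P.integrable_mul' b) (((P.integrable_mul b b).div_const 2).add
      ((by simpa using P.integrable_mul' 0 : Integrable fun x => Ψ x * Ψ x).div_const 2)) fun x => ?_
    dsimp only
    nlinarith [sq_nonneg (Ψ (x + b) - Ψ x)]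
  rw [integral_add ((P.integrable_mul b b).div_const 2)
    ((by simpa using P.integrable_mul' 0 : Integrable fun x => Ψ x * Ψ x).div_const 2),
    integral_div, integral_div, hb, ← h0] at h1
  linarith

theorem measurable_corr (P : Profile Ψ) : Measurable (corr Ψ) := by
  have : StronglyMeasurable (Function.uncurry fun b x : Vec n => Ψ (x + b) * Ψ x) := by
    refine Measurable.stronglyMeasurable ?_
    have := P.meas
    exact (P.meas.comp (measurable_snd.add measurable_fst)).mul (P.meas.comp measurable_snd)
  exact this.integral_prod_right'.measurable

theorem exists_ne_zero {b : Vec n} (h : corr Ψ b ≠ 0) : ∃ x, Ψ (x + b) ≠ 0 ∧ Ψ x ≠ 0 := by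
  by_contra! hcon
  refine h (integral_eq_zero_of_ae (Filter.Eventually.of_forall fun x => ?_))
  by_cases hx : Ψ (x + b) = 0
  · simp [hx]
  · simp [hcon x hx]

theorem spread {ι : Type*} [Fintype ι] (P : Profile Ψ) (v : ι → Vec n) :
    Profile (spread Ψ v) where
  nonneg _ := sum_nonneg fun _ _ => P.nonneg _
  meas := Finset.measurable_fun_sum _ fun _ _ => P.meas.comp (measurable_add_const _)
  memLp := memLp_finsetSum _ fun a _ => P.memLp_translate (v a)
  integrable := integrable_finsetSum _ fun a _ => P.integrable.comp_add_right (v a)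

theorem integral_spread {ι : Type*} [Fintype ι] (P : Profile Ψ) (v : ι → Vec n) :
    ∫ x, LinearGrowth.spread Ψ v x = Fintype.card ι * ∫ x, Ψ x := by
  unfold LinearGrowth.spread
  rw [integral_finsetSum _ fun a _ => P.integrable.comp_add_right (v a)]
  simp [integral_add_right_eq_self]

theorem corr_spread {ι : Type*} [Fintype ι] (P : Profile Ψ) (v : ι → Vec n) (b : Vec n) :
    corr (LinearGrowth.spread Ψ v) b = ∑ a, ∑ a', corr Ψ (v a - v a' + b) := by
  unfold corr LinearGrowth.spread
  simp_rw [sum_mul_sum]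
  rw [integral_finsetSum _ fun a _ => integrable_finsetSum _ fun a' _ => by
    simpa [add_assoc] using P.integrable_mul (b + v a) (v a')]
  refine sum_congr rfl fun a _ => ?_
  rw [integral_finsetSum _ fun a' _ => by
    simpa [add_assoc] using P.integrable_mul (b + v a) (v a')]
  refine sum_congr rfl fun a' _ => ?_
  rw [← integral_add_right_eq_self (fun x => Ψ (x + (v a - v a' + b)) * Ψ x) (v a')]
  congr 1
  funext x
  congr 2
  abel

end Profile

/-- Averages over a large box are nearly invariant under translations. -/
theorem setIntegral_box_le {J : ℕ} (hJ0 : 0 < J) {f : (Fin J → ℝ) → ℝ} (hf : Measurable f) {D : ℝ}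
    (h0 : ∀ t, 0 ≤ f t) (hD : ∀ t, f t ≤ D) {L B θ : ℝ} (hL : 0 < L) (hB : 0 ≤ B) (hθ : θ ≤ 1)
    (hJ : J * B ≤ L * θ) {c : Fin J → ℝ} (hc : ∀ j, |c j| ≤ B) :
    ∫ t in Set.Icc (0 : Fin J → ℝ) (fun _ => L), f t ≤
      (∫ t in Set.Icc (0 : Fin J → ℝ) (fun _ => L), f (t + c)) + θ * L ^ J * D := by
  have hJ1 : (1 : ℝ) ≤ J := by exact_mod_cast hJ0
  have hBL : B ≤ L := by nlinarith
  set Q := Set.Icc (0 : Fin J → ℝ) (fun _ => L) with hQ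
  set Q' := Set.Icc c (fun j => L + c j) with hQ'
  have hinteg : ∀ (S : Set (Fin J → ℝ)), volume S ≠ ⊤ → IntegrableOn f S := fun S hS =>
    Measure.integrableOn_of_bounded (M := D) hS hf.aestronglyMeasurable
      (Filter.Eventually.of_forall fun t => by
        rw [Real.norm_of_nonneg (h0 t)]; exact hD t)
  have hQfin : volume Q ≠ ⊤ := isCompact_Icc.measure_lt_top.ne
  have hQ'fin : volume Q' ≠ ⊤ := isCompact_Icc.measure_lt_top.ne
  have hshift : ∫ t in Q, f (t + c) = ∫ t in Q', f t := by
    have hpre : (fun t : Fin J → ℝ => t + c) ⁻¹' Q' = Q := by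
      ext t
      simp only [hQ, hQ', Set.mem_preimage, Set.mem_Icc, Pi.le_def, Pi.add_apply, Pi.zero_apply]
      constructor
      · rintro ⟨h1, h2⟩
        exact ⟨fun i => by linarith [h1 i], fun i => by linarith [h2 i]⟩
      · rintro ⟨h1, h2⟩
        exact ⟨fun i => by linarith [h1 i], fun i => by linarith [h2 i]⟩
    rw [← hpre]
    exact (measurePreserving_add_right volume c).setIntegral_preimage_emb
      (MeasurableEquiv.addRight c).measurableEmbedding f Q'
  have hsplit : ∫ t in Q, f t = (∫ t in Q ∩ Q', f t) + ∫ t in Q \ Q', f t :=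
    (integral_inter_add_sdiff measurableSet_Icc (hinteg Q hQfin)).symm
  have h1 : ∫ t in Q ∩ Q', f t ≤ ∫ t in Q', f t :=
    setIntegral_mono_set (hinteg Q' hQ'fin) (Filter.Eventually.of_forall h0)
      (Filter.Eventually.of_forall fun _ h => h.2)
  have hdfin : volume (Q \ Q') ≠ ⊤ := ne_top_of_le_ne_top hQfin (measure_mono Set.sdiff_subset)
  have h2 : ∫ t in Q \ Q', f t ≤ D * volume.real (Q \ Q') := by
    calc ∫ t in Q \ Q', f t ≤ ∫ t in Q \ Q', D :=
          setIntegral_mono_on (hinteg _ hdfin) (integrableOn_const hdfin)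
            (measurableSet_Icc.diff measurableSet_Icc) fun t _ => hD t
      _ = _ := by rw [setIntegral_const, smul_eq_mul, mul_comm]
  have h3 : volume.real (Q \ Q') ≤ θ * L ^ J := by
    have e1 : volume.real (Q ∩ Q') + volume.real (Q \ Q') = volume.real Q :=
      measureReal_inter_add_sdiff measurableSet_Icc hQfin
    have e2 : volume.real Q = L ^ J := by
      rw [hQ, Measure.real, Real.volume_Icc_pi_toReal]
      · simp
      · intro j; exact hL.le
    have e3 : (L - B) ^ J ≤ volume.real (Q ∩ Q') := by
      have : Set.Icc (fun j => max 0 (c j)) (fun j => min L (L + c j)) ⊆ Q ∩ Q' := by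
        rintro t ⟨ht1, ht2⟩
        refine ⟨⟨fun j => ?_, fun j => ?_⟩, ⟨fun j => ?_, fun j => ?_⟩⟩
        · exact (le_max_left _ _).trans (ht1 j)
        · exact (ht2 j).trans (min_le_left _ _)
        · exact (le_max_right _ _).trans (ht1 j)
        · exact (ht2 j).trans (min_le_right _ _)
      have hle : ∀ j, L - B ≤ min L (L + c j) - max 0 (c j) := fun j => by
        have := abs_le.1 (hc j)
        rcases le_total 0 (c j) with h | h
        · rw [max_eq_right h, min_eq_left (by linarith)]; linarith
        · rw [max_eq_left h, min_eq_right (by linarith)]; linarith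
      calc (L - B) ^ J = ∏ _j : Fin J, (L - B) := by simp
        _ ≤ ∏ j, (min L (L + c j) - max 0 (c j)) :=
            prod_le_prod (fun _ _ => by linarith) fun j _ => hle j
        _ = volume.real (Set.Icc (fun j => max 0 (c j)) (fun j => min L (L + c j))) := by
            rw [Measure.real, Real.volume_Icc_pi_toReal]
            intro j
            have := hle j
            dsimp only
            linarith
        _ ≤ _ := measureReal_mono this (ne_top_of_le_ne_top hQfin (measure_mono Set.inter_subset_left))
    have e4 : L ^ J * (1 - θ) ≤ (L - B) ^ J := by
      have hb : 1 + (J : ℝ) * (-(B / L)) ≤ (1 + -(B / L)) ^ J :=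
        one_add_mul_le_pow (by
          have : B / L ≤ 1 := (div_le_one hL).2 hBL
          linarith) J
      have e5 : (L - B) ^ J = L ^ J * (1 + -(B / L)) ^ J := by
        rw [← mul_pow]; congr 1; field_simp; ring
      rw [e5]
      refine mul_le_mul_of_nonneg_left (le_trans ?_ hb) (by positivity)
      have : J * (B / L) ≤ θ := by
        rw [← mul_div_assoc, div_le_iff₀ hL]; linarith
      linarith
    linarith
  have hD0 := (h0 0).trans (hD 0)
  rw [hsplit, hshift]
  nlinarith

end LinearGrowth

namespace LinearGrowth

open Finset MeasureTheory

variable {n : ℕ}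

/-- Linear combinations, with fixed coefficients, of a family of vectors. -/
def comb {ι : Type*} {J : ℕ} (τ : ι → Fin J → Vec n) (t : Fin J → ℝ) (a : ι) : Vec n :=
  ∑ j, t j • τ a j

theorem Profile.exists_box_sum_le {Ψ : Vec n → ℝ} (P : Profile Ψ) {ι : Type*} [Fintype ι]
    [Nonempty ι] {J : ℕ} (hJ : 0 < J) {τ : ι → Fin J → Vec n} {y : Vec n} {B L : ℝ} (hB : 0 < B)
    (hsep : ∀ a a', a ≠ a' → ∃ c : Fin J → ℝ, (∀ j, |c j| ≤ B) ∧
      ∑ j, c j • (τ a j - τ a' j) = y)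
    (hL : J * B * Fintype.card ι ≤ L) (Ns : ℕ) :
    ∃ t ∈ Set.Icc (0 : Fin J → ℝ) (fun _ => L), ∑ q ∈ range Ns,
      (corr (LinearGrowth.spread Ψ (comb τ t)) 0 -
        corr (LinearGrowth.spread Ψ (comb τ t)) (((q : ℝ) / Ns) • y)) ≤
      2 * Fintype.card ι * Ns * corr Ψ 0 := by
  classical
  set M : ℝ := (Fintype.card ι : ℝ) with hM
  have hM1 : 1 ≤ M := by rw [hM]; exact_mod_cast Fintype.card_pos (α := ι)
  have hJ1 : (1 : ℝ) ≤ J := by exact_mod_cast hJ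
  have hL0 : 0 < L := lt_of_lt_of_le (by positivity) hL
  set Q := Set.Icc (0 : Fin J → ℝ) (fun _ => L) with hQ
  have hQfin : volume Q ≠ ⊤ := isCompact_Icc.measure_lt_top.ne
  have hQvol : volume.real Q = L ^ J := by
    rw [hQ, Measure.real, Real.volume_Icc_pi_toReal]
    · simp
    · intro j; exact hL0.le
  have hcont : ∀ a, Measurable fun t : Fin J → ℝ => comb τ t a := fun a => by
    unfold comb
    exact Continuous.measurable (by fun_prop)
  have hmeas : ∀ (a a' : ι) (b : Vec n), Measurable fun t => corr Ψ (comb τ t a - comb τ t a' + b) :=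
    fun a a' b => P.measurable_corr.comp (((hcont a).sub (hcont a')).add_const b)
  have hinteg : ∀ (a a' : ι) (b : Vec n),
      IntegrableOn (fun t => corr Ψ (comb τ t a - comb τ t a' + b)) Q := fun a a' b =>
    Measure.integrableOn_of_bounded (M := corr Ψ 0) hQfin (hmeas a a' b).aestronglyMeasurable
      (Filter.Eventually.of_forall fun t => by
        rw [Real.norm_of_nonneg (P.corr_nonneg _)]; exact P.corr_le _)
  have hC0 := P.corr_nonneg 0
  have hterm : ∀ q ∈ range Ns, ∀ a a' : ι,
      ∫ t in Q, (corr Ψ (comb τ t a - comb τ t a' + 0) -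
        corr Ψ (comb τ t a - comb τ t a' + ((q : ℝ) / Ns) • y)) ≤
      ((if a = a' then 1 else 0) + M⁻¹) * (L ^ J * corr Ψ 0) := by
    intro q hq a a'
    rw [integral_sub (hinteg a a' 0) (hinteg a a' _)]
    by_cases haa : a = a'
    · subst haa
      simp only [sub_self, zero_add, if_true, setIntegral_const, hQvol, smul_eq_mul]
      have := mul_nonneg (pow_nonneg hL0.le J) (P.corr_nonneg (((q : ℝ) / Ns) • y))
      have : 0 ≤ M⁻¹ * (L ^ J * corr Ψ 0) := by positivity
      linarith
    · obtain ⟨c, hc, hcy⟩ := hsep a a' haa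
      have hs0 : (0 : ℝ) ≤ (q : ℝ) / Ns := by positivity
      have hs1 : (q : ℝ) / Ns ≤ 1 :=
        div_le_one_of_le₀ (by exact_mod_cast (mem_range.1 hq).le) (by positivity)
      have h := setIntegral_box_le hJ (f := fun t => corr Ψ (comb τ t a - comb τ t a' + 0))
        (hmeas a a' 0) (fun t => P.corr_nonneg _) (fun t => P.corr_le _) hL0 hB.le
        (θ := M⁻¹) (inv_le_one_of_one_le₀ hM1)
        (by rw [← div_eq_mul_inv, le_div_iff₀ (by linarith)]; exact hL)
        (c := ((q : ℝ) / Ns) • c) (fun j => by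
          simp only [Pi.smul_apply, smul_eq_mul, abs_mul, abs_of_nonneg hs0]
          nlinarith [abs_nonneg (c j), hc j])
      have e : ∀ t, comb τ (t + ((q : ℝ) / Ns) • c) a - comb τ (t + ((q : ℝ) / Ns) • c) a' + 0 =
          comb τ t a - comb τ t a' + ((q : ℝ) / Ns) • y := fun t => by
        rw [← hcy]
        simp only [comb, Pi.add_apply, Pi.smul_apply, add_smul, sum_add_distrib, smul_sum,
          smul_sub, sum_sub_distrib, smul_smul, smul_eq_mul]
        abel
      simp_rw [e] at h
      rw [if_neg haa, zero_add]
      linarith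
  let G : (Fin J → ℝ) → ℝ := fun t => ∑ q ∈ range Ns, ∑ a, ∑ a',
    (corr Ψ (comb τ t a - comb τ t a' + 0) -
      corr Ψ (comb τ t a - comb τ t a' + ((q : ℝ) / Ns) • y))
  have hinteg2 : ∀ (q : ℕ) (a a' : ι), IntegrableOn (fun t =>
      corr Ψ (comb τ t a - comb τ t a' + 0) -
        corr Ψ (comb τ t a - comb τ t a' + ((q : ℝ) / Ns) • y)) Q :=
    fun q a a' => (hinteg a a' 0).sub (hinteg a a' _)
  have hGint : IntegrableOn G Q := integrable_finsetSum _ fun q _ => integrable_finsetSum _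
    fun a _ => integrable_finsetSum _ fun a' _ => hinteg2 q a a'
  have hGle : ∫ t in Q, G t ≤ 2 * M * Ns * corr Ψ 0 * L ^ J := by
    have e1 : ∫ t in Q, G t = ∑ q ∈ range Ns, ∑ a, ∑ a', ∫ t in Q,
        (corr Ψ (comb τ t a - comb τ t a' + 0) -
          corr Ψ (comb τ t a - comb τ t a' + ((q : ℝ) / Ns) • y)) := by
      refine (integral_finsetSum _ fun q _ => integrable_finsetSum _ fun a _ =>
        integrable_finsetSum _ fun a' _ => hinteg2 q a a').trans ?_
      refine sum_congr rfl fun q _ => ?_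
      refine (integral_finsetSum _ fun a _ =>
        integrable_finsetSum _ fun a' _ => hinteg2 q a a').trans ?_
      refine sum_congr rfl fun a _ => ?_
      exact (integral_finsetSum _ fun a' _ => hinteg2 q a a')
    rw [e1]
    calc _ ≤ ∑ q ∈ range Ns, ∑ a : ι, ∑ a' : ι,
          ((if a = a' then 1 else 0) + M⁻¹) * (L ^ J * corr Ψ 0) :=
          sum_le_sum fun q hq => sum_le_sum fun a _ => sum_le_sum fun a' _ => hterm q hq a a'
      _ = _ := by
          simp only [← sum_mul, sum_add_distrib, sum_ite_eq, mem_univ, if_true, sum_const,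
            card_univ, nsmul_eq_mul, ← hM, card_range]
          field_simp
          ring
  have hQ0 : volume Q ≠ 0 := by
    intro h
    rw [Measure.real, h] at hQvol
    have := pow_pos hL0 J
    simp at hQvol
    linarith
  obtain ⟨t, ht, htle⟩ := exists_le_setAverage hQ0 hQfin hGint
  refine ⟨t, ht, ?_⟩
  rw [setAverage_eq, hQvol, smul_eq_mul, inv_mul_eq_div] at htle
  have h1 := htle.trans ((div_le_iff₀ (pow_pos hL0 J)).2 hGle)
  refine le_trans (le_of_eq ?_) h1
  refine sum_congr rfl fun q _ => ?_
  rw [P.corr_spread, P.corr_spread, ← sum_sub_distrib]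
  exact sum_congr rfl fun a _ => sum_sub_distrib _ _ |>.symm

theorem Profile.sq_integral_le {Ψ : Vec n → ℝ} (P : Profile Ψ) {R : ℝ} (hR : 0 < R)
    (hsupp : ∀ x, Ψ x ≠ 0 → ‖x‖ ≤ R) :
    (∫ x, Ψ x) ^ 2 ≤ volume.real (Metric.closedBall (0 : Vec n) R) * corr Ψ 0 := by
  set D := Metric.closedBall (0 : Vec n) R
  have hz : ∀ x, x ∉ D → Ψ x = 0 := fun x hx => by
    by_contra h
    exact hx (by simpa [D] using hsupp x h)
  have hfin : volume D ≠ ⊤ := measure_closedBall_lt_top.ne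
  have hpos : 0 < volume.real D :=
    ENNReal.toReal_pos (Metric.measure_closedBall_pos volume _ hR).ne' hfin
  have hsq : Integrable fun x => Ψ x * Ψ x := by simpa using P.integrable_mul' 0
  have e1 : ∫ x in D, Ψ x = ∫ x, Ψ x := setIntegral_eq_integral_of_forall_compl_eq_zero hz
  have e2 : ∫ x in D, Ψ x * Ψ x = corr Ψ 0 := by
    rw [setIntegral_eq_integral_of_forall_compl_eq_zero fun x hx => by simp [hz x hx]]
    simp [corr]
  set l := (∫ x, Ψ x) / volume.real D with hl
  have h : 0 ≤ ∫ x in D, (Ψ x * Ψ x - 2 * l * Ψ x + l * l) :=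
    integral_nonneg fun x => by dsimp only [Pi.zero_apply]; nlinarith [sq_nonneg (Ψ x - l)]
  have i1 : IntegrableOn (fun x => 2 * l * Ψ x) D := P.integrable.integrableOn.const_mul _
  have i2 : IntegrableOn (fun x => Ψ x * Ψ x - 2 * l * Ψ x) D := hsq.integrableOn.sub i1
  rw [integral_add i2 (integrableOn_const hfin), integral_sub hsq.integrableOn i1,
    integral_const_mul, e1, e2, setIntegral_const,
    smul_eq_mul] at h
  have e3 : (∫ x, Ψ x) = l * volume.real D := by rw [hl]; field_simp
  rw [e3] at h ⊢
  nlinarith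

end LinearGrowth

namespace LinearGrowth

open Finset MeasureTheory

variable {n : ℕ}

theorem exists_good_pair {Ns : ℕ} {good : ℕ → Prop} [DecidablePred good]
    (h : 8 * ((range Ns).filter fun q => ¬ good q).card < Ns) {d : ℕ} (hd : 2 * d ≤ Ns) :
    ∃ q, good q ∧ good (q + d) := by
  by_contra! hcon
  have hsub : range (Ns - d) ⊆ ((range Ns).filter fun q => ¬ good q) ∪
      ((range (Ns - d)).filter fun q => ¬ good (q + d)) := by
    intro q hq
    rw [mem_range] at hq
    by_cases hg : good q
    · exact mem_union_right _ (mem_filter.2 ⟨mem_range.2 hq, hcon q hg⟩)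
    · exact mem_union_left _ (mem_filter.2 ⟨mem_range.2 (by omega), hg⟩)
  have h1 := (card_le_card hsub).trans (card_union_le _ _)
  have h2 : ((range (Ns - d)).filter fun q => ¬ good (q + d)).card ≤
      ((range Ns).filter fun q => ¬ good q).card := by
    refine card_le_card_of_injOn (fun q => q + d) (fun q hq => ?_) fun a _ b _ hab => by simpa using hab
    have hq' := mem_filter.1 hq
    have := mem_range.1 hq'.1
    exact mem_filter.2 ⟨mem_range.2 (by dsimp only; omega), hq'.2⟩
  rw [card_range] at h1
  omega

/-- Every `s • y` with `s ∈ [0, 1/2]` is close to an alternating sum of four random-walk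
positions. -/
def SegCover {ι : Type*} {J k : ℕ} (τ : ι → Fin J → Vec n) (r : ℝ) (y : Vec n)
    (t : Fin k → Fin J → ℝ) : Prop :=
  ∀ s ∈ Set.Icc (0 : ℝ) (1 / 2), ∃ α : Fin 4 → Fin k → ι,
    ‖(∑ i, comb τ (t i) (α 0 i) - ∑ i, comb τ (t i) (α 1 i) - ∑ i, comb τ (t i) (α 2 i) +
      ∑ i, comb τ (t i) (α 3 i)) - s • y‖ ≤ 5 * r

theorem Profile.segCover {ι : Type*} {J k : ℕ} {τ : ι → Fin J → Vec n} {r : ℝ} {y : Vec n}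
    {t : Fin k → Fin J → ℝ} {Ψ : Vec n → ℝ} (P : Profile Ψ) (hy : ‖y‖ ≤ 1)
    (hsupp : ∀ x, Ψ x ≠ 0 → ∃ α : Fin k → ι, ‖x + ∑ i, comb τ (t i) (α i)‖ ≤ r)
    (h0 : 0 < corr Ψ 0) {Ns : ℕ} (hNs : 0 < Ns) (hr : 1 ≤ r * Ns)
    (hsum : 8 * ∑ q ∈ range Ns, (corr Ψ 0 - corr Ψ (((q : ℝ) / Ns) • y)) < Ns * corr Ψ 0) :
    SegCover τ r y t := by
  classical
  have hNs0 : (0 : ℝ) < Ns := by exact_mod_cast hNs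
  let good : ℕ → Prop := fun q => corr Ψ (((q : ℝ) / Ns) • y) ≠ 0
  have hcard : 8 * ((range Ns).filter fun q => ¬ good q).card < Ns := by
    have h1 : ((range Ns).filter fun q => ¬ good q).card * corr Ψ 0 ≤
        ∑ q ∈ range Ns, (corr Ψ 0 - corr Ψ (((q : ℝ) / Ns) • y)) := by
      calc _ = ∑ q ∈ (range Ns).filter fun q => ¬ good q,
              (corr Ψ 0 - corr Ψ (((q : ℝ) / Ns) • y)) := by
            rw [← nsmul_eq_mul, ← sum_const]
            refine sum_congr rfl fun q hq => ?_
            have := (mem_filter.1 hq).2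
            simp only [good, ne_eq, not_not] at this
            rw [this, sub_zero]
        _ ≤ _ := sum_le_sum_of_subset_of_nonneg (filter_subset _ _) fun q _ _ =>
            sub_nonneg.2 (P.corr_le _)
    have h2 : (8 * ((range Ns).filter fun q => ¬ good q).card : ℝ) * corr Ψ 0 < Ns * corr Ψ 0 := by
      linarith
    exact_mod_cast lt_of_mul_lt_mul_right h2 h0.le
  intro s hs
  set d := ⌊s * Ns⌋₊ with hd
  have hd1 : (d : ℝ) ≤ s * Ns := Nat.floor_le (mul_nonneg hs.1 hNs0.le)
  have hd2 : s * Ns < d + 1 := Nat.lt_floor_add_one _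
  have hd3 : 2 * d ≤ Ns := by
    have : (2 * d : ℝ) ≤ Ns := by nlinarith [hs.2]
    exact_mod_cast this
  obtain ⟨q, hq1, hq2⟩ := exists_good_pair hcard hd3
  have hclose : ∀ q, good q → ∃ α β : Fin k → ι, ‖((q : ℝ) / Ns) • y +
      (∑ i, comb τ (t i) (α i) - ∑ i, comb τ (t i) (β i))‖ ≤ 2 * r := by
    intro q hq
    obtain ⟨x, hx1, hx2⟩ := Profile.exists_ne_zero hq
    obtain ⟨α, hα⟩ := hsupp _ hx1
    obtain ⟨β, hβ⟩ := hsupp _ hx2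
    refine ⟨α, β, ?_⟩
    calc _ = ‖(x + ((q : ℝ) / Ns) • y + ∑ i, comb τ (t i) (α i)) -
          (x + ∑ i, comb τ (t i) (β i))‖ := by congr 1; abel
      _ ≤ _ := (norm_sub_le _ _).trans (by linarith)
  obtain ⟨α, β, h1⟩ := hclose q hq1
  obtain ⟨α', β', h2⟩ := hclose (q + d) hq2
  refine ⟨![β', α', β, α], ?_⟩
  simp only [Matrix.cons_val_zero, Matrix.cons_val_one, Matrix.cons_val]
  have e : (∑ i, comb τ (t i) (β' i) - ∑ i, comb τ (t i) (α' i) - ∑ i, comb τ (t i) (β i) +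
      ∑ i, comb τ (t i) (α i)) - s • y =
      (((q : ℝ) / Ns) • y + (∑ i, comb τ (t i) (α i) - ∑ i, comb τ (t i) (β i))) -
      ((((q + d : ℕ) : ℝ) / Ns) • y + (∑ i, comb τ (t i) (α' i) - ∑ i, comb τ (t i) (β' i))) +
      ((d : ℝ) / Ns - s) • y := by
    push_cast
    rw [add_div, add_smul, sub_smul]
    abel
  rw [e]
  have h3 : ‖((d : ℝ) / Ns - s) • y‖ ≤ r := by
    rw [norm_smul, Real.norm_eq_abs]
    have : |(d : ℝ) / Ns - s| ≤ r := by
      have e1 : (d : ℝ) / Ns - s = (d - s * Ns) / Ns := by field_simp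
      rw [e1, abs_div, abs_of_pos hNs0, div_le_iff₀ hNs0, abs_le]
      constructor <;> linarith
    calc _ ≤ r * 1 := mul_le_mul this hy (norm_nonneg _) ((abs_nonneg _).trans this)
      _ = r := mul_one r
  refine (norm_add_le _ _).trans ?_
  have := norm_sub_le (((q : ℝ) / Ns) • y + (∑ i, comb τ (t i) (α i) - ∑ i, comb τ (t i) (β i)))
    ((((q + d : ℕ) : ℝ) / Ns) • y + (∑ i, comb τ (t i) (α' i) - ∑ i, comb τ (t i) (β' i)))
  linarith

theorem SegCover.append {ι : Type*} [Nonempty ι] {J k l : ℕ} {τ : ι → Fin J → Vec n} {r : ℝ}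
    {y : Vec n} {t : Fin k → Fin J → ℝ} (h : SegCover τ r y t) :
    SegCover τ r y (Fin.append t (0 : Fin l → Fin J → ℝ)) := by
  intro s hs
  obtain ⟨α, hα⟩ := h s hs
  refine ⟨fun b => Fin.append (α b) fun _ => Classical.arbitrary ι, ?_⟩
  have e : ∀ b, ∑ i, comb τ (Fin.append t (0 : Fin l → Fin J → ℝ) i)
      (Fin.append (α b) (fun _ => Classical.arbitrary ι) i) = ∑ i, comb τ (t i) (α b i) := fun b => by
    rw [Fin.sum_univ_add]
    simp [comb]
  simpa only [e] using hα

/-- Iterating the step of `Profile.exists_box_sum_le` either produces a covered segment or makes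
the energy drop. -/
theorem segCover_or_profile {ι : Type*} [Fintype ι] [Nonempty ι] {J : ℕ} (hJ : 0 < J)
    {τ : ι → Fin J → Vec n} {y : Vec n} (hy : ‖y‖ ≤ 1) {B L r : ℝ} (hB : 0 < B)
    (hsep : ∀ a a', a ≠ a' → ∃ c : Fin J → ℝ, (∀ j, |c j| ≤ B) ∧
      ∑ j, c j • (τ a j - τ a' j) = y)
    (hL : J * B * Fintype.card ι ≤ L) (hr : 0 < r) (k : ℕ) :
    (∃ t : Fin k → Fin J → ℝ, (∀ i, t i ∈ Set.Icc (0 : Fin J → ℝ) fun _ => L) ∧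
      SegCover τ r y t) ∨
    ∃ (t : Fin k → Fin J → ℝ) (Ψ : Vec n → ℝ), (∀ i, t i ∈ Set.Icc (0 : Fin J → ℝ) fun _ => L) ∧
      Profile Ψ ∧
      ∫ x, Ψ x = (Fintype.card ι : ℝ) ^ k * volume.real (Metric.closedBall (0 : Vec n) r) ∧
      corr Ψ 0 ≤ (16 * Fintype.card ι : ℝ) ^ k * volume.real (Metric.closedBall (0 : Vec n) r) ∧
      ∀ x, Ψ x ≠ 0 → ∃ α : Fin k → ι, ‖x + ∑ i, comb τ (t i) (α i)‖ ≤ r := by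
  have hM : (0 : ℝ) < Fintype.card ι := by exact_mod_cast Fintype.card_pos (α := ι)
  have hL0 : 0 ≤ L := le_trans (by positivity) hL
  induction k with
  | zero =>
    right
    refine ⟨Fin.elim0, (Metric.closedBall (0 : Vec n) r).indicator fun _ => 1, fun i => i.elim0,
      ?_, ?_, ?_, ?_⟩
    · have hfin : volume (Metric.closedBall (0 : Vec n) r) ≠ ⊤ := measure_closedBall_lt_top.ne
      exact ⟨fun x => Set.indicator_nonneg (fun _ _ => zero_le_one) x,
        measurable_const.indicator Metric.isClosed_closedBall.measurableSet,
        memLp_indicator_const 2 Metric.isClosed_closedBall.measurableSet 1 (Or.inr hfin),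
        (integrable_indicator_iff Metric.isClosed_closedBall.measurableSet).2
          (integrableOn_const hfin)⟩
    · rw [integral_indicator_const _ Metric.isClosed_closedBall.measurableSet]
      simp
    · have : corr ((Metric.closedBall (0 : Vec n) r).indicator fun _ => (1 : ℝ)) 0 =
          ∫ x, (Metric.closedBall (0 : Vec n) r).indicator (fun _ => (1 : ℝ)) x := by
        unfold corr
        refine integral_congr_ae (Filter.Eventually.of_forall fun x => ?_)
        by_cases hx : x ∈ Metric.closedBall (0 : Vec n) r <;> simp [Set.indicator, hx]
      rw [this, integral_indicator_const _ Metric.isClosed_closedBall.measurableSet]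
      simp
    · intro x hx
      refine ⟨Fin.elim0, ?_⟩
      have := Set.mem_of_indicator_ne_zero hx
      simpa using this
  | succ k ih =>
    rcases ih with ⟨t, ht, hcov⟩ | ⟨t, Ψ, ht, P, hinteg, hcorr, hsupp⟩
    · left
      refine ⟨Fin.append t (0 : Fin 1 → Fin J → ℝ), fun i => ?_, hcov.append⟩
      refine Fin.addCases (fun i => ?_) (fun i => ?_) i
      · simpa using ht i
      · rw [Fin.append_right]
        exact ⟨le_rfl, fun _ => hL0⟩
    · obtain ⟨Ns, hNs⟩ := exists_nat_gt (max 1 r⁻¹)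
      have hNs1 : (1 : ℝ) < Ns := (le_max_left _ _).trans_lt hNs
      have hNs2 : r⁻¹ < Ns := (le_max_right _ _).trans_lt hNs
      have hNs0 : 0 < Ns := by
        have : (0 : ℝ) < Ns := by linarith
        exact_mod_cast this
      obtain ⟨t', ht', hsum⟩ := P.exists_box_sum_le hJ hB hsep hL Ns
      have P' := P.spread (comb τ t')
      have ht'' : ∀ i, (Fin.snoc t t' : Fin (k + 1) → Fin J → ℝ) i ∈
          Set.Icc (0 : Fin J → ℝ) fun _ => L := fun i => by
        refine Fin.lastCases ?_ (fun i => ?_) i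
        · simpa using ht'
        · simpa using ht i
      have hsupp' : ∀ x, spread Ψ (comb τ t') x ≠ 0 → ∃ α : Fin (k + 1) → ι,
          ‖x + ∑ i, comb τ ((Fin.snoc t t' : Fin (k + 1) → Fin J → ℝ) i) (α i)‖ ≤ r := by
        intro x hx
        obtain ⟨a, -, ha⟩ := exists_ne_zero_of_sum_ne_zero hx
        obtain ⟨α, hα⟩ := hsupp _ ha
        refine ⟨Fin.snoc α a, ?_⟩
        rw [Fin.sum_univ_castSucc]
        simp only [Fin.snoc_castSucc, Fin.snoc_last]
        rwa [add_comm (∑ i, _), ← add_assoc]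
      by_cases hdrop : corr (spread Ψ (comb τ t')) 0 ≤ 16 * Fintype.card ι * corr Ψ 0
      · right
        refine ⟨Fin.snoc t t', spread Ψ (comb τ t'), ht'', P', ?_, ?_, hsupp'⟩
        · rw [P.integral_spread, hinteg]; ring
        · refine hdrop.trans ?_
          rw [pow_succ', mul_assoc (16 * _)]
          exact mul_le_mul_of_nonneg_left hcorr (by positivity)
      · left
        push Not at hdrop
        refine ⟨Fin.snoc t t', ht'', P'.segCover hy hsupp' ?_ hNs0 ?_ ?_ (Ns := Ns)⟩
        · exact lt_of_le_of_lt (mul_nonneg (by positivity) (P.corr_nonneg 0)) hdrop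
        · rw [inv_lt_iff_one_lt_mul₀' hr] at hNs2
          linarith
        · have : (0 : ℝ) < Ns := by linarith
          nlinarith

theorem exists_segCover {ι : Type*} [Fintype ι] [Nonempty ι] {J : ℕ} (hJ : 0 < J)
    {τ : ι → Fin J → Vec n} {y : Vec n} (hy : ‖y‖ ≤ 1) {B B₀ L r : ℝ} (hB : 0 < B)
    (hsep : ∀ a a', a ≠ a' → ∃ c : Fin J → ℝ, (∀ j, |c j| ≤ B) ∧
      ∑ j, c j • (τ a j - τ a' j) = y)
    (hL : J * B * Fintype.card ι ≤ L) (hr : 0 < r) (hB₀ : ∀ a j, ‖τ a j‖ ≤ B₀) {k : ℕ}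
    (hk : 16 ^ k * (r + k * (J * L * B₀)) ^ n < (Fintype.card ι : ℝ) ^ k * r ^ n) :
    ∃ t : Fin k → Fin J → ℝ, (∀ i, t i ∈ Set.Icc (0 : Fin J → ℝ) fun _ => L) ∧
      SegCover τ r y t := by
  refine (segCover_or_profile hJ hy hB hsep hL hr k).resolve_right ?_
  rintro ⟨t, Ψ, ht, P, hinteg, hcorr, hsupp⟩
  have hM : (0 : ℝ) < Fintype.card ι := by exact_mod_cast Fintype.card_pos (α := ι)
  have hL0 : 0 ≤ L := le_trans (by positivity) hL
  have hB₀0 : 0 ≤ B₀ := (norm_nonneg _).trans (hB₀ (Classical.arbitrary ι) ⟨0, hJ⟩)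
  set R := r + k * (J * L * B₀) with hR
  have hR0 : 0 < R := by positivity
  have hsuppR : ∀ x, Ψ x ≠ 0 → ‖x‖ ≤ R := fun x hx => by
    obtain ⟨α, hα⟩ := hsupp x hx
    have h1 : ‖∑ i, comb τ (t i) (α i)‖ ≤ k * (J * L * B₀) := by
      have h2 : ∀ i, ‖comb τ (t i) (α i)‖ ≤ J * L * B₀ := fun i => by
        calc ‖comb τ (t i) (α i)‖ ≤ ∑ j, ‖t i j • τ (α i) j‖ := norm_sum_le _ _
          _ ≤ ∑ j : Fin J, L * B₀ := by
              refine sum_le_sum fun j _ => ?_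
              rw [norm_smul, Real.norm_eq_abs, abs_of_nonneg ((ht i).1 j)]
              exact mul_le_mul ((ht i).2 j) (hB₀ _ _) (norm_nonneg _) hL0
          _ = _ := by simp; ring
      calc _ ≤ ∑ i, ‖comb τ (t i) (α i)‖ := norm_sum_le _ _
        _ ≤ ∑ i : Fin k, J * L * B₀ := sum_le_sum fun i _ => h2 i
        _ = _ := by simp
    calc ‖x‖ = ‖(x + ∑ i, comb τ (t i) (α i)) - ∑ i, comb τ (t i) (α i)‖ := by simp
      _ ≤ _ := (norm_sub_le _ _).trans (by linarith)
  have h := P.sq_integral_le hR0 hsuppR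
  rw [hinteg, Measure.addHaar_real_closedBall _ _ hR0.le] at h
  rw [Measure.addHaar_real_closedBall _ _ hr.le] at h hcorr
  have hv : 0 < volume.real (Metric.ball (0 : Vec n) 1) :=
    ENNReal.toReal_pos (Metric.measure_ball_pos volume _ one_pos).ne' measure_ball_lt_top.ne
  set v := volume.real (Metric.ball (0 : Vec n) 1)
  rw [finrank_euclideanSpace, Fintype.card_fin] at h hcorr
  set M : ℝ := (Fintype.card ι : ℝ)
  have h1 : (M ^ k * (r ^ n * v)) ^ 2 ≤ R ^ n * v * ((16 * M) ^ k * (r ^ n * v)) :=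
    h.trans (mul_le_mul_of_nonneg_left hcorr (by positivity))
  have h2 : (M ^ k * r ^ n) * (M ^ k * r ^ n * v ^ 2) ≤ (16 ^ k * R ^ n) * (M ^ k * r ^ n * v ^ 2) := by
    rw [mul_pow 16 M k] at h1
    calc _ = (M ^ k * (r ^ n * v)) ^ 2 := by ring
      _ ≤ _ := h1
      _ = _ := by ring
  have h3 := le_of_mul_le_mul_right h2 (by positivity)
  linarith

end LinearGrowth

namespace LinearGrowth

open Finset

variable {n : ℕ}

/-- The multiples `s • x₀`, `|s| ≤ 1`, are approximated within `H⁻ᵉ` by combinations, with the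
fixed coefficients `t`, of points of the orbit of `x₀` under `polySet A S`. -/
def OrbitCover (A : Set (Op n)) (H : ℝ) (x₀ : Vec n) {k : ℕ} (t : Fin k → ℝ) (S e : ℕ) : Prop :=
  ∀ s ∈ Set.Icc (-1 : ℝ) 1, ∃ p : Fin k → Op n, (∀ i, p i ∈ polySet A S) ∧
    H ^ e * ‖∑ i, t i • p i x₀ - s • x₀‖ ≤ 1

theorem RichFrame.exists_orbitCover (n e₁ S₀ N : ℕ) : ∃ k : ℕ, ∀ {A : Set (Op n)} {H : ℝ}
    {g : Fin N → Op n} {T : Finset (Op n)}, RichFrame A H S₀ N e₁ g T → (k : ℝ) ≤ H →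
    ∀ x₀ : Vec n, ‖x₀‖ = 1 → ∃ t : Fin (k * N) → ℝ, (∀ i, |t i| ≤ H ^ (e₁ + 9)) ∧
      OrbitCover A H x₀ t (S₀ + 8) (e₁ + 10) := by
  refine ⟨(2 * e₁ + 27) * n + 1, fun {A H g T} F hk x₀ hx₀ => ?_⟩
  set k := (2 * e₁ + 27) * n + 1 with hkdef
  have hH4 := F.four_le
  have hH1 := F.one_le
  have hH0 := F.pos
  have hn := F.pos_dim
  have hN : 0 < N := (Nat.mul_pos hn hn).trans_le F.le_card
  have hNr : (1 : ℝ) ≤ N := by exact_mod_cast hN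
  have hH8 : 8 ≤ H := by linarith [F.card_le]
  have hNH : (N : ℝ) ≤ H := by linarith [F.card_le]
  have hM : ((⌈H ^ 3⌉₊ : ℕ) : ℝ) ≤ H ^ 4 := by
    have h1 := (Nat.ceil_lt_add_one (pow_nonneg hH0.le 3)).le
    have h2 : 1 ≤ H ^ 3 := one_le_pow₀ hH1
    calc _ ≤ _ := h1
      _ ≤ H ^ 3 * 8 := by linarith
      _ ≤ H ^ 3 * H := by gcongr
      _ = _ := by ring
  obtain ⟨j₀, T', hT', hcard, hsep⟩ := F.exists_separating hM hx₀
  have hM3 : H ^ 3 ≤ (T'.card : ℝ) := by rw [hcard]; exact Nat.le_ceil _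
  have hM4 : (T'.card : ℝ) ≤ H ^ 4 := by rw [hcard]; exact hM
  have hne : T'.Nonempty := by
    rw [← card_pos]
    have : (0 : ℝ) < T'.card := lt_of_lt_of_le (by positivity) hM3
    exact_mod_cast this
  have : Nonempty T' := hne.to_subtype
  let τ : T' → Fin N → Vec n := fun a j => g j (a.1 (g j₀ x₀))
  have hτ : ∀ a j, ‖τ a j‖ ≤ H ^ 3 := fun a j => by
    calc ‖τ a j‖ ≤ ‖g j‖ * (‖a.1‖ * (‖g j₀‖ * ‖x₀‖)) :=
          (ContinuousLinearMap.le_opNorm _ _).trans (mul_le_mul_of_nonneg_left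
            ((ContinuousLinearMap.le_opNorm _ _).trans (mul_le_mul_of_nonneg_left
              (ContinuousLinearMap.le_opNorm _ _) (norm_nonneg _))) (norm_nonneg _))
      _ ≤ H * (H * (H * 1)) := by
          gcongr
          · exact F.norm_le j
          · exact F.bound _ (hT' a.2)
          · exact F.norm_le j₀
          · exact hx₀.le
      _ = _ := by ring
  have hspan : ∀ a a', a ≠ a' → ∃ c : Fin N → ℝ, (∀ j, |c j| ≤ H ^ (e₁ + 4)) ∧
      ∑ j, c j • (τ a j - τ a' j) = x₀ := by
    intro a a' haa'
    have h1 := hsep a.1 a.2 a'.1 a'.2 fun h => haa' (Subtype.ext h)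
    set d := (a.1 - a'.1) (g j₀ x₀) with hd
    have hd0 : 0 < ‖d‖ := by
      by_contra h
      have : ‖d‖ = 0 := le_antisymm (not_lt.1 h) (norm_nonneg _)
      rw [this] at h1
      linarith
    obtain ⟨c, hc, hsum⟩ := F.span d x₀ (norm_pos_iff.1 hd0)
    refine ⟨c, fun j => ?_, ?_⟩
    · have h2 := hc j
      rw [hx₀, mul_one] at h2
      refine le_of_mul_le_mul_right (h2.trans ?_) hd0
      calc H ≤ H * (H ^ (e₁ + 3) * ‖d‖) := le_mul_of_one_le_right hH0.le h1.le
        _ = _ := by ring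
    · rw [← hsum]
      refine sum_congr rfl fun j _ => ?_
      simp only [τ, hd, _root_.sub_apply, map_sub]
  obtain ⟨t, ht, hcov⟩ := exists_segCover (k := k) (r := (H ^ (e₁ + 12))⁻¹) (L := H ^ (e₁ + 9))
    (B := H ^ (e₁ + 4)) hN hx₀.le (by positivity) hspan (by
      rw [Fintype.card_coe]
      calc N * H ^ (e₁ + 4) * (T'.card : ℝ) ≤ H * H ^ (e₁ + 4) * H ^ 4 := by gcongr
        _ = _ := by ring) (by positivity) hτ (by
      rw [Fintype.card_coe]
      have hbase : (H ^ (e₁ + 12))⁻¹ + k * (N * H ^ (e₁ + 9) * H ^ 3) ≤ H ^ (e₁ + 15) := by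
        have h1 : (H ^ (e₁ + 12))⁻¹ ≤ 1 := inv_le_one_of_one_le₀ (one_le_pow₀ hH1)
        have h2 : (1 : ℝ) ≤ H ^ (e₁ + 14) := one_le_pow₀ hH1
        have h3 : (k : ℝ) * (N * H ^ (e₁ + 9) * H ^ 3) ≤ H * (H * H ^ (e₁ + 9) * H ^ 3) := by gcongr
        calc _ ≤ H ^ (e₁ + 14) + H * (H * H ^ (e₁ + 9) * H ^ 3) := by linarith
          _ = 2 * H ^ (e₁ + 14) := by ring
          _ ≤ H * H ^ (e₁ + 14) := by gcongr; linarith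
          _ = _ := by ring
      have h16 : (16 : ℝ) ≤ H ^ 2 := by nlinarith
      rw [inv_pow, ← div_eq_mul_inv, lt_div_iff₀ (by positivity)]
      calc (16 : ℝ) ^ k * ((H ^ (e₁ + 12))⁻¹ + k * (N * H ^ (e₁ + 9) * H ^ 3)) ^ n *
            (H ^ (e₁ + 12)) ^ n ≤ (H ^ 2) ^ k * (H ^ (e₁ + 15)) ^ n * (H ^ (e₁ + 12)) ^ n := by
              gcongr
        _ = H ^ (2 * k + (2 * e₁ + 27) * n) := by ring
        _ < H ^ (3 * k) := pow_lt_pow_right₀ (by linarith) (by omega)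
        _ = (H ^ 3) ^ k := by ring
        _ ≤ (T'.card : ℝ) ^ k := by gcongr)
  refine ⟨fun i => t (finProdFinEquiv.symm i).1 (finProdFinEquiv.symm i).2, fun i => ?_, ?_⟩
  · rw [abs_of_nonneg ((ht _).1 _)]
    exact (ht _).2 _
  intro s hs
  have hflat : ∀ P : Fin k → Fin N → Op n,
      ∑ i : Fin (k * N), t (finProdFinEquiv.symm i).1 (finProdFinEquiv.symm i).2 •
        P (finProdFinEquiv.symm i).1 (finProdFinEquiv.symm i).2 x₀ =
      ∑ i, ∑ j, t i j • P i j x₀ := fun P => by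
    rw [Equiv.sum_comp finProdFinEquiv.symm fun q : Fin k × Fin N => t q.1 q.2 • P q.1 q.2 x₀,
      Fintype.sum_prod_type]
  have key : ∀ s' ∈ Set.Icc (0 : ℝ) (1 / 2), ∃ P : Fin k → Fin N → Op n,
      (∀ i j, P i j ∈ polySet A (S₀ + 6)) ∧
        ‖∑ i, ∑ j, t i j • P i j x₀ - s' • x₀‖ ≤ 5 * (H ^ (e₁ + 12))⁻¹ := by
    intro s' hs'
    obtain ⟨α, hα⟩ := hcov s' hs'
    have hmem : ∀ q i, (α q i).1 ∈ polySet A S₀ := fun q i =>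
      subset_polySet A _ (F.sub (hT' (α q i).2))
    refine ⟨fun i j => g j * ((α 0 i).1 - (α 1 i).1 - (α 2 i).1 + (α 3 i).1) * g j₀,
      fun i j => ?_, ?_⟩
    · have h1 := sub_mem_polySet (hmem 0 i) (hmem 1 i)
      have h2 := sub_mem_polySet h1 (polySet_mono A (Nat.le_succ _) (hmem 2 i))
      have h3 := add_mem_polySet h2 (polySet_mono A (by omega) (hmem 3 i))
      have h4 := mul_mem_polySet (polySet_mono A (by omega) (F.mem j)) h3
      exact polySet_mono A (by omega) (mul_mem_polySet h4 (polySet_mono A (by omega) (F.mem j₀)))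
    · refine le_of_eq_of_le ?_ hα
      congr 2
      simp only [comb, τ, ← sum_sub_distrib, ← sum_add_distrib]
      refine sum_congr rfl fun i _ => sum_congr rfl fun j _ => ?_
      simp only [mul_apply_eq_comp, _root_.sub_apply, _root_.add_apply,
        map_add, map_sub, smul_add, smul_sub]
  have hfin : H ^ (e₁ + 10) * (2 * (5 * (H ^ (e₁ + 12))⁻¹)) ≤ 1 := by
    have h1 : (10 : ℝ) ≤ H ^ 2 := by nlinarith
    rw [show H ^ (e₁ + 10) * (2 * (5 * (H ^ (e₁ + 12))⁻¹)) = 10 * H ^ (e₁ + 10) / H ^ (e₁ + 12) by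
      ring, div_le_one (by positivity)]
    calc 10 * H ^ (e₁ + 10) ≤ H ^ 2 * H ^ (e₁ + 10) := by gcongr
      _ = _ := by ring
  obtain ⟨P, hP, hPs⟩ := key (|s| / 2) ⟨by positivity, by
    have := abs_le.2 ⟨hs.1, hs.2⟩; linarith⟩
  have hsgn : ∃ Q : Fin k → Fin N → Op n, (∀ i j, Q i j ∈ polySet A (S₀ + 8)) ∧
      ‖∑ i, ∑ j, t i j • Q i j x₀ - s • x₀‖ = 2 * ‖∑ i, ∑ j, t i j • P i j x₀ - (|s| / 2) • x₀‖ := by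
    rcases abs_cases s with ⟨h, -⟩ | ⟨h, -⟩
    · refine ⟨fun i j => P i j + P i j, fun i j =>
        polySet_mono A (by omega) (add_mem_polySet (hP i j) (hP i j)), ?_⟩
      rw [h, ← abs_of_pos (zero_lt_two' ℝ), ← Real.norm_eq_abs, ← norm_smul]
      congr 1
      simp only [_root_.add_apply, smul_add, sum_add_distrib, smul_sub, Real.norm_eq_abs,
        Nat.abs_ofNat, two_smul]
      module
    · refine ⟨fun i j => 0 - (P i j + P i j), fun i j =>
        polySet_mono A (by omega) (sub_mem_polySet (zero_mem_polySet A _)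
          (add_mem_polySet (hP i j) (hP i j))), ?_⟩
      rw [h, ← abs_of_pos (zero_lt_two' ℝ), ← Real.norm_eq_abs, ← norm_smul, ← norm_neg]
      congr 1
      simp only [_root_.add_apply, smul_add, sum_add_distrib, smul_sub, Real.norm_eq_abs,
        Nat.abs_ofNat, two_smul, zero_sub, smul_neg, sum_neg_distrib, _root_.neg_apply]
      module
  obtain ⟨Q, hQ, hQs⟩ := hsgn
  refine ⟨fun i => Q (finProdFinEquiv.symm i).1 (finProdFinEquiv.symm i).2, fun i => hQ _ _, ?_⟩
  rw [hflat, hQs]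
  exact le_trans (by gcongr) hfin

theorem RichFrame.orbitCover_step (n e₁ S₀ N S m : ℕ) : ∃ S' : ℕ, ∀ {A : Set (Op n)} {H : ℝ}
    {g : Fin N → Op n} {T : Finset (Op n)}, RichFrame A H S₀ N e₁ g T →
    ∀ {x₀ : Vec n}, ‖x₀‖ = 1 → ∀ {k : ℕ} {t : Fin k → ℝ}, OrbitCover A H x₀ t S (e₁ + 10) →
      OrbitCover A H x₀ t S (e₁ + 10 + m) → OrbitCover A H x₀ t S' (e₁ + 10 + m + 1) := by
  obtain ⟨c, hc⟩ := RichFrame.exists_size S₀ (4 + m)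
  refine ⟨S + S₀ + c + N + 5, fun {A H g T} F x₀ hx₀ k t h0 hm s hs => ?_⟩
  have hH0 := F.pos
  have hH1 := F.one_le
  have hNH : (N : ℝ) ≤ H := by linarith [F.card_le, (Nat.cast_nonneg N : (0 : ℝ) ≤ N)]
  obtain ⟨p, hp, hps⟩ := hm s hs
  set e : Vec n := s • x₀ - ∑ i, t i • p i x₀ with he
  rw [norm_sub_rev, ← he] at hps
  obtain ⟨z, hz, hzτ, hτz⟩ := hc F (H ^ (4 + m))⁻¹
    (mul_inv_cancel₀ (by positivity)).ge (inv_le_one_of_one_le₀ (one_le_pow₀ hH1))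
  obtain ⟨j₀, hj₀⟩ := F.exists_le_apply F.pos_dim z x₀
  rw [hx₀, mul_one] at hj₀
  set x := z (g j₀ x₀) with hx
  have hxlow : 1 ≤ H ^ (e₁ + 9 + m) * ‖x‖ := by
    have h1 : 1 ≤ H ^ (4 + m) * (H ^ (e₁ + 3) * ‖z‖) := by
      rwa [inv_le_iff_one_le_mul₀' (by positivity)] at hτz
    calc (1 : ℝ) ≤ H ^ (4 + m) * (H ^ (e₁ + 3) * ‖z‖) := h1
      _ ≤ H ^ (4 + m) * (H ^ (e₁ + 3) * (H ^ 2 * ‖x‖)) := by gcongr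
      _ = _ := by ring
  have hx0 : x ≠ 0 := by
    rintro h
    rw [h, norm_zero, mul_zero] at hxlow
    linarith
  obtain ⟨d, hd, hsum⟩ := F.span x e hx0
  have hd1 : ∀ j, d j ∈ Set.Icc (-1 : ℝ) 1 := fun j => by
    rw [Set.mem_Icc, ← abs_le]
    calc |d j| ≤ |d j| * (H ^ (e₁ + 9 + m) * ‖x‖) := le_mul_of_one_le_right (abs_nonneg _) hxlow
      _ = H ^ (e₁ + 9 + m) * (|d j| * ‖x‖) := by ring
      _ ≤ H ^ (e₁ + 9 + m) * (H * ‖e‖) := mul_le_mul_of_nonneg_left (hd j) (by positivity)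
      _ = H ^ (e₁ + 10 + m) * ‖e‖ := by ring
      _ ≤ 1 := hps
  choose q hq hqs using fun j => h0 (d j) (hd1 j)
  refine ⟨fun i => p i + ∑ j, g j * z * g j₀ * q j i, fun i => ?_, ?_⟩
  · have h1 : ∀ j ∈ (univ : Finset (Fin N)), g j * z * g j₀ * q j i ∈ polySet A (S + S₀ + c + 4) :=
      fun j _ => by
        have h2 := mul_mem_polySet (polySet_mono A (by omega : _ ≤ S + S₀ + c) (F.mem j))
          (polySet_mono A (by omega) hz)
        have h3 := mul_mem_polySet h2 (polySet_mono A (by omega) (F.mem j₀))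
        exact polySet_mono A (by omega)
          (mul_mem_polySet h3 (polySet_mono A (by omega) (hq j i)))
    have h4 := sum_mem_polySet univ _ h1
    rw [card_univ, Fintype.card_fin] at h4
    exact polySet_mono A (by omega)
      (add_mem_polySet (polySet_mono A (by omega) (hp i)) h4)
  have hrw : ∑ i, t i • (p i + ∑ j, g j * z * g j₀ * q j i) x₀ - s • x₀ =
      ∑ j, g j (z (g j₀ (∑ i, t i • q j i x₀ - d j • x₀))) := by
    have h1 : ∑ i, t i • (p i + ∑ j, g j * z * g j₀ * q j i) x₀ =
        ∑ i, t i • p i x₀ + ∑ j, g j (z (g j₀ (∑ i, t i • q j i x₀))) := by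
      simp only [_root_.add_apply, _root_.sum_apply, mul_apply_eq_comp, smul_add,
        sum_add_distrib, map_sum, map_smul, smul_sum]
      rw [sum_comm]
    have h2 : s • x₀ = ∑ i, t i • p i x₀ + ∑ j, g j (z (g j₀ (d j • x₀))) := by
      simp only [map_smul, ← hx, hsum, he]
      abel
    rw [h1]
    rw [h2]
    simp only [map_sub, sum_sub_distrib]
    abel
  rw [hrw]
  have hterm : ∀ j, ‖g j (z (g j₀ (∑ i, t i • q j i x₀ - d j • x₀)))‖ ≤
      H * ((H ^ (4 + m))⁻¹ * (H * (H ^ (e₁ + 10))⁻¹)) := fun j => by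
    refine (ContinuousLinearMap.le_opNorm _ _).trans ?_
    refine mul_le_mul (F.norm_le j) ?_ (norm_nonneg _) hH0.le
    refine (ContinuousLinearMap.le_opNorm _ _).trans ?_
    refine mul_le_mul hzτ ?_ (norm_nonneg _) (by positivity)
    refine (ContinuousLinearMap.le_opNorm _ _).trans ?_
    refine mul_le_mul (F.norm_le j₀) ?_ (norm_nonneg _) hH0.le
    rw [← one_div, le_div_iff₀' (by positivity)]
    exact hqs j
  calc _ ≤ H ^ (e₁ + 10 + m + 1) * ∑ j : Fin N,
        H * ((H ^ (4 + m))⁻¹ * (H * (H ^ (e₁ + 10))⁻¹)) := by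
        gcongr
        exact (norm_sum_le _ _).trans (sum_le_sum fun j _ => hterm j)
    _ = H ^ (e₁ + 10 + m + 1) * (N * (H * ((H ^ (4 + m))⁻¹ * (H * (H ^ (e₁ + 10))⁻¹)))) := by simp
    _ ≤ H ^ (e₁ + 10 + m + 1) * (H * (H * ((H ^ (4 + m))⁻¹ * (H * (H ^ (e₁ + 10))⁻¹)))) := by
        gcongr
    _ = H ^ (e₁ + 14 + m) / (H ^ (4 + m) * H ^ (e₁ + 10)) := by
        rw [div_eq_mul_inv, mul_inv]; ring
    _ = 1 := by
        rw [div_eq_one_iff_eq (by positivity)]; ring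

/-- Refined form of `exists_orbitCover`: the same coefficients work at every scale. -/
theorem RichFrame.exists_orbitCover_forall (n e₁ S₀ N : ℕ) : ∃ (k : ℕ) (S : ℕ → ℕ),
    ∀ {A : Set (Op n)} {H : ℝ}
    {g : Fin N → Op n} {T : Finset (Op n)}, RichFrame A H S₀ N e₁ g T → (k : ℝ) ≤ H →
    ∀ x₀ : Vec n, ‖x₀‖ = 1 → ∃ t : Fin (k * N) → ℝ, (∀ i, |t i| ≤ H ^ (e₁ + 9)) ∧
      ∀ m, OrbitCover A H x₀ t (S m) m := by
  obtain ⟨k, hk⟩ := RichFrame.exists_orbitCover n e₁ S₀ N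
  choose f hf using RichFrame.orbitCover_step n e₁ S₀ N
  have hex : ∀ m, ∃ S, ∀ {A : Set (Op n)} {H : ℝ} {g : Fin N → Op n} {T : Finset (Op n)},
      RichFrame A H S₀ N e₁ g T → ∀ {x₀ : Vec n}, ‖x₀‖ = 1 → ∀ {k : ℕ} {t : Fin k → ℝ},
      OrbitCover A H x₀ t (S₀ + 8) (e₁ + 10) → OrbitCover A H x₀ t S (e₁ + 10 + m) := by
    intro m
    induction m with
    | zero => exact ⟨S₀ + 8, fun _ _ _ _ _ h => h⟩
    | succ m ih =>
      obtain ⟨S, hS⟩ := ih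
      refine ⟨f (max S (S₀ + 8)) m, fun {A H g T} F x₀ hx₀ k t h => ?_⟩
      refine hf _ _ F hx₀ (fun s hs => ?_) (fun s hs => ?_)
      · obtain ⟨p, hp, hps⟩ := h s hs
        exact ⟨p, fun i => polySet_mono A (le_max_right _ _) (hp i), hps⟩
      · obtain ⟨p, hp, hps⟩ := hS F hx₀ h s hs
        exact ⟨p, fun i => polySet_mono A (le_max_left _ _) (hp i), hps⟩
  choose S hS using hex
  refine ⟨k, S, fun {A H g T} F hkH x₀ hx₀ => ?_⟩
  obtain ⟨t, ht, hcov⟩ := hk F hkH x₀ hx₀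
  refine ⟨t, ht, fun m s hs => ?_⟩
  obtain ⟨p, hp, hps⟩ := hS m F hx₀ hcov s hs
  refine ⟨p, hp, le_trans ?_ hps⟩
  gcongr
  · exact F.one_le
  · omega

end LinearGrowth

namespace LinearGrowth

open Finset

variable {n : ℕ}

instance : IsScalarTower ℝ (Op n) (Op n) := ⟨fun a p q => by ext1 v; simp⟩

instance : SMulCommClass ℝ (Op n) (Op n) := ⟨fun a p q => by ext1 v; simp⟩

/-- Combinations of `m` elements of `polySet A S` with coefficients bounded by `B`. -/
def combSet (A : Set (Op n)) (m : ℕ) (B : ℝ) (S : ℕ) : Set (Op n) :=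
  {u | ∃ (c : Fin m → ℝ) (p : Fin m → Op n), (∀ i, |c i| ≤ B) ∧ (∀ i, p i ∈ polySet A S) ∧
    u = ∑ i, c i • p i}

theorem one_mem_combSet (A : Set (Op n)) (S : ℕ) : 1 ∈ combSet A 1 1 S :=
  ⟨fun _ => 1, fun _ => 1, fun _ => by simp, fun _ => one_mem_polySet A S, by simp⟩

theorem smul_mem_combSet {A : Set (Op n)} {m S : ℕ} {B C x : ℝ} {u : Op n}
    (hu : u ∈ combSet A m B S) (hx : |x| ≤ C) : x • u ∈ combSet A m (C * B) S := by
  obtain ⟨c, p, hc, hp, rfl⟩ := hu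
  refine ⟨fun i => x * c i, p, fun i => ?_, hp, ?_⟩
  · rw [abs_mul]
    exact mul_le_mul hx (hc i) (abs_nonneg _) ((abs_nonneg _).trans hx)
  · simp only [smul_sum, smul_smul]

theorem mul_mem_combSet {A : Set (Op n)} {m m' S S' : ℕ} {B B' : ℝ} {u u' : Op n}
    (hu : u ∈ combSet A m B S) (hu' : u' ∈ combSet A m' B' S') (hS : S ≤ S') :
    u * u' ∈ combSet A (m * m') (B * B') (S' + 1) := by
  obtain ⟨c, p, hc, hp, rfl⟩ := hu
  obtain ⟨c', p', hc', hp', rfl⟩ := hu'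
  refine ⟨fun q => c (finProdFinEquiv.symm q).1 * c' (finProdFinEquiv.symm q).2,
    fun q => p (finProdFinEquiv.symm q).1 * p' (finProdFinEquiv.symm q).2, fun i => ?_,
    fun i => mul_mem_polySet (polySet_mono A hS (hp _)) (hp' _), ?_⟩
  · rw [abs_mul]
    exact mul_le_mul (hc _) (hc' _) (abs_nonneg _) ((abs_nonneg _).trans (hc (finProdFinEquiv.symm i).1))
  · rw [Equiv.sum_comp finProdFinEquiv.symm fun q : Fin m × Fin m' =>
      (c q.1 * c' q.2) • (p q.1 * p' q.2), Fintype.sum_prod_type, sum_mul_sum]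
    refine sum_congr rfl fun i _ => sum_congr rfl fun j _ => ?_
    rw [smul_mul_assoc, mul_smul_comm, smul_smul]

theorem norm_le_of_mem_combSet {A : Set (Op n)} {m S : ℕ} {B H : ℝ}
    (hA : ∀ p ∈ polySet A S, ‖p‖ ≤ H) {u : Op n} (hu : u ∈ combSet A m B S) :
    ‖u‖ ≤ m * (B * H) := by
  obtain ⟨c, p, hc, hp, rfl⟩ := hu
  calc _ ≤ ∑ i, ‖c i • p i‖ := norm_sum_le _ _
    _ ≤ ∑ _i : Fin m, B * H := sum_le_sum fun i _ => by
        rw [norm_smul, Real.norm_eq_abs]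
        exact mul_le_mul (hc i) (hA _ (hp i)) (norm_nonneg _) ((abs_nonneg _).trans (hc i))
    _ = _ := by simp

/-- If a norm-one operator almost kills a quantitatively independent family, then the family can be
extended by a unit vector which the operator does not contract. -/
theorem exists_snoc_qIndep (hn : 0 < n) {i : ℕ} {w : Op n} (hw : ‖w‖ = 1) {x : Fin i → Vec n}
    {η ζ : ℝ} (hη : 0 < η) (hη1 : η ≤ 1) (hx : QIndep η x) (hζ : ∀ j, ‖w (x j)‖ ≤ ζ)
    (hi : 8 * i * ζ ≤ η) :
    ∃ v : Vec n, ‖v‖ = 1 ∧ 1 / 2 ≤ ‖w v‖ ∧ QIndep (η / 8) (Fin.snoc x v : Fin (i + 1) → Vec n) := by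
  obtain ⟨v, hv1, hv2⟩ := Frame.exists_unit_norm_apply hn w
  rw [hw] at hv2
  refine ⟨v, hv1, by linarith, (hx.snoc hη1 (θ := 1 / 4) (by norm_num) le_rfl hv1.le ?_).mono
    (by linarith)⟩
  intro y hy
  obtain ⟨c, rfl⟩ := (Submodule.mem_span_range_iff_exists_fun ℝ).1 hy
  by_contra! hlt
  set y := ∑ j, c j • x j with hydef
  have hy2 : ‖y‖ ≤ 2 := by
    have : ‖y‖ ≤ ‖v‖ + ‖v - y‖ := by
      calc ‖y‖ = ‖v - (v - y)‖ := by congr 1; abel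
        _ ≤ _ := norm_sub_le _ _
    linarith
  have hwy : ‖w y‖ ≤ 1 / 4 := by
    rw [hydef, map_sum]
    have hterm : ∀ j, η * ‖w (c j • x j)‖ ≤ 2 * ζ := fun j => by
      rw [map_smul, norm_smul, Real.norm_eq_abs, ← mul_assoc]
      exact mul_le_mul ((hx c j).trans hy2) (hζ j) (norm_nonneg _) (by norm_num)
    have h1 : η * ‖∑ j, w (c j • x j)‖ ≤ i * (2 * ζ) := by
      calc _ ≤ η * ∑ j, ‖w (c j • x j)‖ := by gcongr; exact norm_sum_le _ _
        _ = ∑ j, η * ‖w (c j • x j)‖ := mul_sum _ _ _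
        _ ≤ ∑ _j : Fin i, 2 * ζ := sum_le_sum fun j _ => hterm j
        _ = _ := by simp
    refine le_of_mul_le_mul_left ?_ hη
    linarith
  have h3 : ‖w v‖ ≤ ‖w y‖ + ‖v - y‖ := by
    calc ‖w v‖ = ‖w y + w (v - y)‖ := by rw [← map_add]; congr 2; abel
      _ ≤ ‖w y‖ + ‖w (v - y)‖ := norm_add_le _ _
      _ ≤ ‖w y‖ + 1 * ‖v - y‖ := by
          gcongr
          rw [← hw]
          exact w.le_opNorm _
      _ = _ := by ring
  linarith

theorem exists_injective_stage (hn : 0 < n) {A : Set (Op n)} {H : ℝ} {k S : ℕ} (a : ℕ → ℕ)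
    (hH : (n * 8 ^ (n + 1) : ℝ) ≤ H) (hk : (k : ℝ) + 1 ≤ H) (hA : ∀ p ∈ polySet A S, ‖p‖ ≤ H) :
    ∃ i < n, ∃ w ∈ combSet A ((k + 1) ^ i) (H ^ ∑ q ∈ range i, a q) (S + i), ‖w‖ = 1 ∧
      ∃ x : Vec n, ‖x‖ = 1 ∧ 1 / 2 ≤ ‖w x‖ ∧ ∀ l ∈ combSet A (k + 1) 1 S,
        H ^ a i * ‖l * w‖ ≤ 1 ∨ ‖l * w‖ ≤ H ^ (3 + ∑ q ∈ range n, (a q + 2)) * ‖l (w x)‖ := by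
  by_contra! hcon
  have hH1 : 1 ≤ H := by linarith [(Nat.cast_nonneg k : (0 : ℝ) ≤ k)]
  have hH0 : 0 < H := by linarith
  have hsmall : ∀ i ≤ n, ∀ e : ℕ, 8 * i * (H ^ (3 + e))⁻¹ ≤ (1 / 8 : ℝ) ^ i := by
    intro i hi e
    rw [← div_eq_mul_inv, div_le_iff₀ (by positivity), one_div, inv_pow, inv_mul_eq_div,
      le_div_iff₀ (by positivity)]
    calc 8 * (i : ℝ) * 8 ^ i ≤ 8 * n * 8 ^ n := by gcongr; norm_num
      _ = n * 8 ^ (n + 1) := by ring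
      _ ≤ H ^ 1 := by simpa using hH
      _ ≤ _ := pow_le_pow_right₀ hH1 (by omega)
  have main : ∀ i ≤ n, ∃ w ∈ combSet A ((k + 1) ^ i) (H ^ ∑ q ∈ range i, a q) (S + i), ‖w‖ = 1 ∧
      ∃ x : Fin i → Vec n, QIndep ((1 / 8) ^ i) x ∧
        ∀ j, ‖w (x j)‖ ≤ (H ^ (3 + ∑ q ∈ Ico i n, (a q + 2)))⁻¹ := by
    intro i
    induction i with
    | zero =>
      intro _
      refine ⟨1, by simpa using one_mem_combSet A S, ?_, Fin.elim0, fun c i => i.elim0,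
        fun j => j.elim0⟩
      have : Nontrivial (Vec n) := by
        have : Nonempty (Fin n) := ⟨⟨0, hn⟩⟩
        infer_instance
      exact norm_one
    | succ i ih =>
      intro hi
      obtain ⟨w, hw, hw1, x, hx, hwx⟩ := ih (by omega)
      obtain ⟨v, hv1, hv2, hv3⟩ := exists_snoc_qIndep hn hw1 (by positivity)
        (pow_le_one₀ (by norm_num) (by norm_num)) hx hwx (hsmall i (by omega) _)
      obtain ⟨l, hl, hl1, hl2⟩ := hcon i (by omega) w hw hw1 v hv1 hv2
      have hlw : 0 < ‖l * w‖ := by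
        by_contra h
        have : ‖l * w‖ = 0 := le_antisymm (not_lt.1 h) (norm_nonneg _)
        rw [this] at hl1
        linarith
      have hinv : ‖l * w‖⁻¹ ≤ H ^ a i := by
        rw [inv_le_iff_one_le_mul₀ hlw]; exact hl1.le
      have hlnorm : ‖l‖ ≤ H ^ 2 := by
        have h1 := norm_le_of_mem_combSet hA hl
        push_cast at h1
        calc ‖l‖ ≤ _ := h1
          _ ≤ H * (1 * H) := by gcongr
          _ = _ := by ring
      refine ⟨‖l * w‖⁻¹ • (l * w), ?_, ?_, Fin.snoc x v, ?_, ?_⟩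
      · have h1 := smul_mem_combSet (mul_mem_combSet hl hw (Nat.le_add_right S i))
          (x := ‖l * w‖⁻¹) (C := H ^ a i)
          (by rwa [abs_of_pos (inv_pos.2 hlw)])
        rw [pow_succ' (k + 1) i, sum_range_succ, pow_add, mul_comm (H ^ _) (H ^ a i)]
        simpa [add_assoc] using h1
      · rw [norm_smul, norm_inv, norm_norm, inv_mul_cancel₀ hlw.ne']
      · rw [pow_succ]
        exact hv3.mono (by linarith)
      · have hsum : ∑ q ∈ Ico i n, (a q + 2) = (a i + 2) + ∑ q ∈ Ico (i + 1) n, (a q + 2) :=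
          sum_eq_sum_Ico_succ_bot (by omega) _
        intro j
        refine Fin.lastCases ?_ (fun j => ?_) j
        · rw [Fin.snoc_last, _root_.smul_apply, norm_smul, norm_inv, norm_norm,
            mul_apply_eq_comp, inv_mul_eq_div, div_le_iff₀ hlw, inv_mul_eq_div,
            le_div_iff₀ (by positivity)]
          refine le_trans ?_ hl2.le
          rw [mul_comm]
          have hsub : Ico (i + 1) n ⊆ range n := by
            rw [range_eq_Ico]
            exact Ico_subset_Ico_left (by omega)
          gcongr
        · rw [Fin.snoc_castSucc, _root_.smul_apply, norm_smul, norm_inv, norm_norm,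
            mul_apply_eq_comp]
          have h1 := hwx j
          rw [hsum] at h1
          calc ‖l * w‖⁻¹ * ‖l (w (x j))‖ ≤ H ^ a i * (H ^ 2 *
                (H ^ (3 + (a i + 2 + ∑ q ∈ Ico (i + 1) n, (a q + 2))))⁻¹) := by
                gcongr
                refine (l.le_opNorm _).trans ?_
                gcongr
            _ = (H ^ (a i) * H ^ 2) / H ^ (3 + (a i + 2 + ∑ q ∈ Ico (i + 1) n, (a q + 2))) := by
                rw [div_eq_mul_inv]; ring
            _ = _ := by
                rw [div_eq_iff (by positivity), inv_mul_eq_div, eq_div_iff (by positivity)]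
                ring
  obtain ⟨w, -, hw1, x, hx, hwx⟩ := main n le_rfl
  obtain ⟨v, -, -, hv⟩ := exists_snoc_qIndep hn hw1 (by positivity)
    (pow_le_one₀ (by norm_num) (by norm_num)) hx hwx (hsmall n le_rfl _)
  have := (hv.linearIndependent (by positivity)).fintype_card_le_finrank
  simp at this

end LinearGrowth

namespace LinearGrowth

open Finset

variable {n : ℕ}

/-- Hyers–Ulam stability of the Cauchy equation on `[0, 1]`. -/
theorem norm_sub_smul_le_of_almost_additive {E : Type*} [NormedAddCommGroup E] [NormedSpace ℝ E]
    {f : ℝ → E} {B η : ℝ} (hB : ∀ s ∈ Set.Icc (0 : ℝ) 1, ‖f s‖ ≤ B)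
    (h : ∀ s s' : ℝ, 0 ≤ s → 0 ≤ s' → s + s' ≤ 1 → ‖f s + f s' - f (s + s')‖ ≤ η) :
    ∀ s ∈ Set.Icc (0 : ℝ) 1, ‖f s - s • f 1‖ ≤ 3 * η := by
  set D : ℝ → E := fun s => f s - s • f 1 with hD
  have hadd : ∀ s s' : ℝ, 0 ≤ s → 0 ≤ s' → s + s' ≤ 1 → ‖D s + D s' - D (s + s')‖ ≤ η := by
    intro s s' h1 h2 h3
    convert h s s' h1 h2 h3 using 2
    simp only [hD]
    module
  have hbdd : BddAbove ((fun s => ‖D s‖) '' Set.Icc 0 1) := by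
    refine ⟨B + B, ?_⟩
    rintro _ ⟨s, hs, rfl⟩
    refine (norm_sub_le _ _).trans (add_le_add (hB s hs) ?_)
    rw [norm_smul, Real.norm_eq_abs, abs_of_nonneg hs.1]
    calc s * ‖f 1‖ ≤ 1 * ‖f 1‖ := by gcongr; exact hs.2
      _ ≤ B := by rw [one_mul]; exact hB 1 (by simp)
  set M := sSup ((fun s => ‖D s‖) '' Set.Icc 0 1) with hM
  have hle : ∀ s ∈ Set.Icc (0 : ℝ) 1, ‖D s‖ ≤ M := fun s hs => le_csSup hbdd ⟨s, hs, rfl⟩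
  have hhalf : ∀ s : ℝ, 0 ≤ s → s ≤ 1 / 2 → ‖D s‖ ≤ (M + η) / 2 := by
    intro s h0 h1
    have h2 := hadd s s h0 h0 (by linarith)
    have h3 := hle (s + s) ⟨by linarith, by linarith⟩
    have h4 : 2 * ‖D s‖ ≤ ‖D (s + s)‖ + ‖D s + D s - D (s + s)‖ := by
      calc 2 * ‖D s‖ = ‖(2 : ℝ) • D s‖ := by rw [norm_smul]; simp
        _ = ‖D (s + s) + (D s + D s - D (s + s))‖ := by congr 1; module
        _ ≤ _ := norm_add_le _ _
    linarith
  have hη : 0 ≤ η := (norm_nonneg _).trans (hadd 0 0 le_rfl le_rfl (by norm_num))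
  have hD1 : D 1 = 0 := by simp [hD]
  have hall : ∀ s ∈ Set.Icc (0 : ℝ) 1, ‖D s‖ ≤ (M + η) / 2 + η := by
    intro s hs
    rcases le_total s (1 / 2) with h1 | h1
    · linarith [hhalf s hs.1 h1]
    · have h2 := hhalf (1 - s) (by linarith [hs.2]) (by linarith)
      have h3 := hadd s (1 - s) hs.1 (by linarith [hs.2]) (by linarith)
      rw [add_sub_cancel, hD1, sub_zero] at h3
      calc ‖D s‖ = ‖(D s + D (1 - s)) - D (1 - s)‖ := by congr 1; abel
        _ ≤ ‖D s + D (1 - s)‖ + ‖D (1 - s)‖ := norm_sub_le _ _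
        _ ≤ _ := by linarith
  have hM' : M ≤ (M + η) / 2 + η := csSup_le ⟨_, 0, by simp, rfl⟩ (by
    rintro _ ⟨s, hs, rfl⟩
    exact hall s hs)
  intro s hs
  linarith [hle s hs]

/-- All `τ • v`, `0 ≤ τ ≤ 1`, lie within `H⁻ᵉ ‖v‖` of `polySet A S`. -/
def IsSegment (A : Set (Op n)) (H : ℝ) (S e : ℕ) (v : Op n) : Prop :=
  ∀ τ ∈ Set.Icc (0 : ℝ) 1, ∃ p ∈ polySet A S, H ^ e * ‖p - τ • v‖ ≤ ‖v‖

/-- If a segment is covered by combinations of elements of a polynomial set with `k` fixed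
coefficients, then a polynomial set itself contains an approximate segment. -/
theorem exists_isSegment (hn : 0 < n) (k : ℕ) : ∀ eT e : ℕ, ∃ ψ σ e₂ : ℕ, ∀ {A : Set (Op n)} {H : ℝ}
    {S₀ N S : ℕ} {g : Fin N → Op n}, Frame A H S₀ N g → S₀ ≤ S → (6 * k : ℝ) ≤ H →
    (∀ p ∈ polySet A (S + σ), ‖p‖ ≤ H) → ∀ (t : Fin k → ℝ) (y : Op n), (∀ i, |t i| ≤ H ^ eT) →
    ‖y‖ = 1 → (∀ s ∈ Set.Icc (0 : ℝ) 1, ∃ p : Fin k → Op n, (∀ i, p i ∈ polySet A S) ∧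
      H ^ ψ * ‖∑ i, t i • p i - s • y‖ ≤ 1) →
    ∃ v ∈ polySet A (S + σ), 1 ≤ H ^ e₂ * ‖v‖ ∧ IsSegment A H (S + σ) e v := by
  induction k with
  | zero =>
    intro eT e
    refine ⟨1, 0, 0, fun {A H S₀ N S g} F _ _ _ t y _ hy hcov => ?_⟩
    obtain ⟨p, -, hp⟩ := hcov 1 (by simp)
    have := F.four_le
    simp [hy] at hp
    linarith
  | succ k ih =>
    intro eT e
    obtain ⟨ψ, σ, e₂, hψ⟩ := ih (2 * eT + e + 4) e
    refine ⟨ψ + eT + e + 7, σ + 4, max e₂ (eT + 1), fun {A H S₀ N S g} F hS hk hA t y ht hy hcov => ?_⟩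
    have hH4 := F.four_le
    have hH1 := F.one_le
    have hH0 := F.pos
    push_cast at hk
    choose! p hp hps using hcov
    set r : ℝ := (H ^ (ψ + eT + e + 7))⁻¹ with hr
    have hr0 : 0 < r := by positivity
    have hps' : ∀ s ∈ Set.Icc (0 : ℝ) 1, ‖∑ i, t i • p s i - s • y‖ ≤ r := fun s hs => by
      rw [hr, ← one_div, le_div_iff₀' (by positivity)]
      exact hps s hs
    by_cases hcol : ∃ s s' : ℝ, 0 ≤ s ∧ 0 ≤ s' ∧ s + s' ≤ 1 ∧
        ∃ j, 1 < H ^ (e + 1) * ‖t j • (p s j + p s' j - p (s + s') j)‖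
    · obtain ⟨s, s', hs, hs', hss', j, hj⟩ := hcol
      set u : Fin (k + 1) → Op n := fun i => p s i + p s' i - p (s + s') i with hu
      have hus : ∀ i, u i ∈ polySet A (S + 2) := fun i =>
        sub_mem_polySet (add_mem_polySet (hp s ⟨hs, by linarith⟩ i) (hp s' ⟨hs', by linarith⟩ i))
          (polySet_subset_succ A S (hp (s + s') ⟨by linarith, hss'⟩ i))
      have hunorm : ∀ i, ‖u i‖ ≤ H := fun i => hA _ (polySet_mono A (by omega) (hus i))
      have husum : ‖∑ i, t i • u i‖ ≤ 3 * r := by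
        have h1 := hps' s ⟨hs, by linarith⟩
        have h2 := hps' s' ⟨hs', by linarith⟩
        have h3 := hps' (s + s') ⟨by linarith, hss'⟩
        have h4 : ∑ i, t i • u i = (∑ i, t i • p s i - s • y) + (∑ i, t i • p s' i - s' • y) -
            (∑ i, t i • p (s + s') i - (s + s') • y) := by
          simp only [hu, smul_sub, smul_add, sum_sub_distrib, sum_add_distrib]
          module
        rw [h4]
        refine (norm_sub_le _ _).trans ?_
        have := norm_add_le (∑ i, t i • p s i - s • y) (∑ i, t i • p s' i - s' • y)
        linarith
      change 1 < H ^ (e + 1) * ‖t j • u j‖ at hj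
      have huj : 1 ≤ H ^ (eT + e + 1) * ‖u j‖ := by
        rw [norm_smul, Real.norm_eq_abs] at hj
        calc 1 ≤ H ^ (e + 1) * (|t j| * ‖u j‖) := hj.le
          _ ≤ H ^ (e + 1) * (H ^ eT * ‖u j‖) := by gcongr; exact ht j
          _ = _ := by ring
      obtain ⟨b, hb⟩ := F.exists_le_mul hn y (u j)
      rw [hy, one_mul] at hb
      set z := y * g b * u j with hz
      have hzlow : 1 ≤ H ^ (eT + e + 4) * ‖z‖ := by
        calc 1 ≤ H ^ (eT + e + 1) * ‖u j‖ := huj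
          _ ≤ H ^ (eT + e + 1) * (H ^ 3 * ‖z‖) := by gcongr
          _ = _ := by ring
      have hz0 : 0 < ‖z‖ := by
        by_contra h
        have : ‖z‖ = 0 := le_antisymm (not_lt.1 h) (norm_nonneg _)
        rw [this] at hzlow
        linarith
      have hzinv : ‖z‖⁻¹ ≤ H ^ (eT + e + 4) := by
        rwa [inv_le_iff_one_le_mul₀ hz0]
      obtain ⟨v, hv, hv1, hv2⟩ := hψ F (S := S + 4) (by omega) (by linarith)
        (fun q hq => hA q (polySet_mono A (by omega) hq))
        (fun i => ‖z‖⁻¹ * t (j.succAbove i)) (‖z‖⁻¹ • z) (fun i => by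
          rw [abs_mul, abs_of_pos (inv_pos.2 hz0)]
          calc ‖z‖⁻¹ * |t (j.succAbove i)| ≤ H ^ (eT + e + 4) * H ^ eT := by
                gcongr
                exact ht _
            _ = _ := by ring)
        (by rw [norm_smul, norm_inv, norm_norm, inv_mul_cancel₀ hz0.ne']) (fun x hx => by
          have hpn : ∀ i, ‖p x i‖ ≤ H := fun i => hA _ (polySet_mono A (by omega) (hp x hx i))
          refine ⟨fun i => p x (j.succAbove i) * g b * u j - p x j * g b * u (j.succAbove i),
            fun i => ?_, ?_⟩
          · have h1 : ∀ i i', p x i * g b * u i' ∈ polySet A (S + 3) := fun i i' =>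
              mul_mem_polySet (polySet_mono A (by omega) (mul_mem_polySet (hp x hx i)
                (polySet_mono A hS (F.mem b)))) (hus i')
            exact sub_mem_polySet (h1 _ _) (h1 _ _)
          · have hid : ∑ i, (‖z‖⁻¹ * t (j.succAbove i)) •
                (p x (j.succAbove i) * g b * u j - p x j * g b * u (j.succAbove i)) -
                x • (‖z‖⁻¹ • z) = ‖z‖⁻¹ • ((∑ i, t i • p x i - x • y) * g b * u j -
                  p x j * g b * ∑ i, t i • u i) := by
              rw [Fin.sum_univ_succAbove _ j, Fin.sum_univ_succAbove _ j, hz]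
              simp only [mul_smul, ← smul_sum, smul_sub, sum_sub_distrib, add_mul, sub_mul,
                mul_add, sum_mul, mul_sum, smul_mul_assoc, mul_smul_comm]
              module
            rw [hid, norm_smul, norm_inv, norm_norm]
            have h1 : ‖(∑ i, t i • p x i - x • y) * g b * u j‖ ≤ r * H * H := by
              refine (norm_mul_le _ _).trans ?_
              have := norm_mul_le (∑ i, t i • p x i - x • y) (g b)
              gcongr
              · exact this.trans (by gcongr; exacts [hps' x hx, F.norm_le b])
              · exact hunorm j
            have h2 : ‖p x j * g b * ∑ i, t i • u i‖ ≤ H * H * (3 * r) := by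
              refine (norm_mul_le _ _).trans ?_
              have := norm_mul_le (p x j) (g b)
              gcongr
              exact this.trans (by gcongr; exacts [hpn j, F.norm_le b])
            calc H ^ ψ * (‖z‖⁻¹ * ‖(∑ i, t i • p x i - x • y) * g b * u j -
                  p x j * g b * ∑ i, t i • u i‖) ≤
                  H ^ ψ * (H ^ (eT + e + 4) * (H * (H * H * r))) := by
                  gcongr
                  refine (norm_sub_le _ _).trans ?_
                  calc _ ≤ r * H * H + H * H * (3 * r) := add_le_add h1 h2
                    _ = 4 * (H * H * r) := by ring
                    _ ≤ _ := by gcongr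
              _ = H ^ (ψ + eT + e + 7) * r := by ring
              _ ≤ 1 := by rw [hr, mul_inv_cancel₀ (by positivity)])
      refine ⟨v, by rwa [show S + (σ + 4) = S + 4 + σ by ring], hv1.trans ?_, ?_⟩
      · gcongr
        exact le_max_left _ _
      · rwa [show S + (σ + 4) = S + 4 + σ by ring]
    · push Not at hcol
      have h1mem : (1 : ℝ) ∈ Set.Icc (0 : ℝ) 1 := by simp
      have hstab : ∀ i, ∀ s ∈ Set.Icc (0 : ℝ) 1,
          ‖t i • p s i - s • (t i • p 1 i)‖ ≤ 3 * (H ^ (e + 1))⁻¹ := fun i => by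
        refine norm_sub_smul_le_of_almost_additive (f := fun s => t i • p s i)
          (B := H ^ eT * H) (fun s hs => ?_) fun s s' h0 h0' h1 => ?_
        · rw [norm_smul, Real.norm_eq_abs]
          gcongr
          · exact ht i
          · exact hA _ (polySet_mono A (by omega) (hp s hs i))
        · rw [← one_div, le_div_iff₀' (by positivity)]
          have h2 := hcol s s' h0 h0' h1 i
          rwa [smul_sub, smul_add] at h2
      have hbig : ∃ i, 1 ≤ 2 * ((k : ℝ) + 1) * ‖t i • p 1 i‖ := by
        by_contra! hlt
        have h1 := hps' 1 h1mem
        rw [one_smul] at h1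
        have h2 : r ≤ 1 / 4 := by
          rw [hr, ← one_div]
          gcongr
          calc (4 : ℝ) ≤ H ^ 1 := by simpa using hH4
            _ ≤ _ := pow_le_pow_right₀ hH1 (by omega)
        have h3 : 2 * ((k : ℝ) + 1) * ‖∑ i, t i • p 1 i‖ ≤ (k : ℝ) + 1 := by
          calc _ ≤ 2 * ((k : ℝ) + 1) * ∑ i, ‖t i • p 1 i‖ := by gcongr; exact norm_sum_le _ _
            _ = ∑ i, 2 * ((k : ℝ) + 1) * ‖t i • p 1 i‖ := mul_sum _ _ _
            _ ≤ ∑ _i : Fin (k + 1), 1 := sum_le_sum fun i _ => (hlt i).le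
            _ = _ := by simp
        have h4 : ‖y‖ ≤ ‖∑ i, t i • p 1 i‖ + ‖∑ i, t i • p 1 i - y‖ := by
          calc ‖y‖ = ‖∑ i, t i • p 1 i - (∑ i, t i • p 1 i - y)‖ := by congr 1; abel
            _ ≤ _ := norm_sub_le _ _
        rw [hy] at h4
        have hk0 : (0 : ℝ) ≤ k := Nat.cast_nonneg k
        nlinarith
      obtain ⟨i, hi⟩ := hbig
      rw [norm_smul, Real.norm_eq_abs] at hi
      have ht0 : 0 < |t i| := by
        by_contra h
        have : |t i| = 0 := le_antisymm (not_lt.1 h) (abs_nonneg _)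
        rw [this] at hi
        norm_num at hi
      refine ⟨p 1 i, polySet_mono A (by omega) (hp 1 h1mem i), ?_, fun τ hτ =>
        ⟨p τ i, polySet_mono A (by omega) (hp τ hτ i), ?_⟩⟩
      · calc 1 ≤ 2 * ((k : ℝ) + 1) * (|t i| * ‖p 1 i‖) := hi
          _ ≤ H * (H ^ eT * ‖p 1 i‖) := by
              gcongr
              · linarith [(Nat.cast_nonneg k : (0 : ℝ) ≤ k)]
              · exact ht i
          _ = H ^ (eT + 1) * ‖p 1 i‖ := by ring
          _ ≤ _ := by
              gcongr
              exact le_max_right _ _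
      · have h1 := hstab i τ hτ
        rw [show t i • p τ i - τ • t i • p 1 i = t i • (p τ i - τ • p 1 i) by module, norm_smul,
          Real.norm_eq_abs] at h1
        refine le_of_mul_le_mul_left ?_ ht0
        calc |t i| * (H ^ e * ‖p τ i - τ • p 1 i‖) = H ^ e * (|t i| * ‖p τ i - τ • p 1 i‖) := by ring
          _ ≤ H ^ e * (3 * (H ^ (e + 1))⁻¹) := by gcongr
          _ = 3 / H := by rw [pow_succ]; field_simp
          _ ≤ 3 / H * (2 * ((k : ℝ) + 1) * (|t i| * ‖p 1 i‖)) :=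
              le_mul_of_one_le_right (by positivity) hi
          _ = (6 * (k + 1)) / H * (|t i| * ‖p 1 i‖) := by ring
          _ ≤ 1 * (|t i| * ‖p 1 i‖) := by
              gcongr
              exact (div_le_one hH0).2 hk
          _ = _ := one_mul _

end LinearGrowth

namespace LinearGrowth

open Finset

variable {n : ℕ}

theorem IsSegment.mono {A : Set (Op n)} {H : ℝ} {S S' e : ℕ} {v : Op n}
    (h : IsSegment A H S e v) (hS : S ≤ S') : IsSegment A H S' e v := fun τ hτ => by
  obtain ⟨p, hp, hpv⟩ := h τ hτ
  exact ⟨p, polySet_mono A hS hp, hpv⟩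

theorem RichFrame.exists_isSegment (hn : 0 < n) (e₁ S₀ N e : ℕ) : ∃ (S e₂ : ℕ) (H₀ : ℝ),
    ∀ {A : Set (Op n)} {H : ℝ} {g : Fin N → Op n} {T : Finset (Op n)},
    RichFrame A H S₀ N e₁ g T → H₀ ≤ H → (∀ p ∈ polySet A S, ‖p‖ ≤ H) →
    ∃ v ∈ polySet A S, 1 ≤ H ^ e₂ * ‖v‖ ∧ IsSegment A H S e v := by
  obtain ⟨k₀, S₂, hcov⟩ := RichFrame.exists_orbitCover_forall n e₁ S₀ N
  choose ψ σ e₂ hseg using fun m eT => LinearGrowth.exists_isSegment hn m eT e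
  set k := k₀ * N with hk
  let inc : ℕ → ℕ → ℕ := fun i b => e₁ + 9 + ψ (k * (k + 1) ^ i) (e₁ + 9 + b)
  let b : ℕ → ℕ := fun i => Nat.rec 0 (fun i b => b + inc i b) i
  let a : ℕ → ℕ := fun i => inc i (b i)
  have hb : ∀ i, ∑ q ∈ range i, a q = b i := by
    intro i
    induction i with
    | zero => rfl
    | succ i ih => rw [sum_range_succ, ih]
  set f := 3 + ∑ q ∈ range n, (a q + 2) + ∑ q ∈ range n, a q with hf
  set S' := S₂ f + n + 1 + S₀ with hS'
  refine ⟨S' + ∑ i ∈ range n, σ (k * (k + 1) ^ i) (e₁ + 9 + b i),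
    ∑ i ∈ range n, e₂ (k * (k + 1) ^ i) (e₁ + 9 + b i),
    k₀ + (n * 8 ^ (n + 1) : ℝ) + (k + 1) + 6 * (k * (k + 1) ^ n),
    fun {A H g T} F hH hA => ?_⟩
  have hH0 := F.pos
  have hH1 := F.one_le
  have hk0 : (0 : ℝ) ≤ k₀ := Nat.cast_nonneg _
  have hk0' : (0 : ℝ) ≤ k := Nat.cast_nonneg _
  have hp1 : (0 : ℝ) ≤ (n * 8 ^ (n + 1) : ℝ) := by positivity
  have hp2 : (0 : ℝ) ≤ 6 * (k * (k + 1) ^ n : ℝ) := by positivity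
  obtain ⟨i, hi, w, hw, hw1, x, hx1, hx2, hinj⟩ := exists_injective_stage hn (A := A) (H := H)
    (k := k) (S := S₂ f) a (by linarith) (by linarith)
    (fun p hp => hA p (polySet_mono A (by omega) hp))
  rw [hb] at hw
  have hwx0 : 0 < ‖w x‖ := by linarith
  obtain ⟨t, ht, hts⟩ := hcov F (by linarith) (‖w x‖⁻¹ • w x)
    (by rw [norm_smul, norm_inv, norm_norm, inv_mul_cancel₀ hwx0.ne'])
  obtain ⟨c, q, hc, hq, hwq⟩ := hw
  have hσ : σ (k * (k + 1) ^ i) (e₁ + 9 + b i) ≤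
      ∑ i ∈ range n, σ (k * (k + 1) ^ i) (e₁ + 9 + b i) :=
    single_le_sum (f := fun i => σ (k * (k + 1) ^ i) (e₁ + 9 + b i)) (fun _ _ => Nat.zero_le _)
      (mem_range.2 hi)
  have he₂ : e₂ (k * (k + 1) ^ i) (e₁ + 9 + b i) ≤
      ∑ i ∈ range n, e₂ (k * (k + 1) ^ i) (e₁ + 9 + b i) :=
    single_le_sum (f := fun i => e₂ (k * (k + 1) ^ i) (e₁ + 9 + b i)) (fun _ _ => Nat.zero_le _)
      (mem_range.2 hi)
  have ha : a i ≤ ∑ q ∈ range n, a q :=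
    single_le_sum (f := a) (fun _ _ => Nat.zero_le _) (mem_range.2 hi)
  obtain ⟨v, hv, hv1, hv2⟩ := hseg (k * (k + 1) ^ i) (e₁ + 9 + b i) F.toFrame (S := S') (by omega)
    (by
      push_cast
      have : (k : ℝ) * (k + 1) ^ i ≤ k * (k + 1) ^ n := by
        gcongr
        linarith
      linarith) (fun p hp => hA p (polySet_mono A (by omega) hp))
    (fun r => t (finProdFinEquiv.symm r).1 * c (finProdFinEquiv.symm r).2) w (fun r => by
      rw [abs_mul, pow_add]
      exact mul_le_mul (ht _) (hc _) (abs_nonneg _) (by positivity)) hw1 (fun s hs => by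
    obtain ⟨p, hp, hps⟩ := hts f s ⟨by linarith [hs.1], hs.2⟩
    refine ⟨fun r => p (finProdFinEquiv.symm r).1 * q (finProdFinEquiv.symm r).2, fun r =>
      polySet_mono A (by omega) (mul_mem_polySet (polySet_mono A (Nat.le_add_right _ i) (hp _))
        (hq _)), ?_⟩
    have hsum : ∑ r, (t (finProdFinEquiv.symm r).1 * c (finProdFinEquiv.symm r).2) •
        (p (finProdFinEquiv.symm r).1 * q (finProdFinEquiv.symm r).2) =
        (∑ i, t i • p i) * w := by
      rw [Equiv.sum_comp finProdFinEquiv.symm fun r : Fin k × Fin ((k + 1) ^ i) =>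
        (t r.1 * c r.2) • (p r.1 * q r.2), Fintype.sum_prod_type, hwq, sum_mul_sum]
      refine sum_congr rfl fun _ _ => sum_congr rfl fun _ _ => ?_
      rw [smul_mul_smul_comm]
    rw [hsum]
    set l : Op n := (H ^ (e₁ + 9))⁻¹ • (∑ i, t i • p i - s • 1) with hl
    have hT1 : 1 ≤ H ^ (e₁ + 9) := one_le_pow₀ hH1
    have hlmem : l ∈ combSet A (k + 1) 1 (S₂ f) := by
      refine ⟨Fin.snoc (fun i => (H ^ (e₁ + 9))⁻¹ * t i) (-((H ^ (e₁ + 9))⁻¹ * s)),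
        Fin.snoc p 1, fun i => ?_, fun i => ?_, ?_⟩
      · refine Fin.lastCases ?_ (fun i => ?_) i
        · rw [Fin.snoc_last, abs_neg, abs_mul, abs_inv, abs_of_pos (by positivity : 0 < H ^ (e₁ + 9)),
            inv_mul_le_one₀ (by positivity), abs_of_nonneg hs.1]
          exact hs.2.trans hT1
        · rw [Fin.snoc_castSucc, abs_mul, abs_inv, abs_of_pos (by positivity : 0 < H ^ (e₁ + 9)),
            inv_mul_le_one₀ (by positivity)]
          exact ht i
      · refine Fin.lastCases ?_ (fun i => ?_) i
        · rw [Fin.snoc_last]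
          exact one_mem_polySet A _
        · rw [Fin.snoc_castSucc]
          exact hp i
      · rw [Fin.sum_univ_castSucc]
        simp only [Fin.snoc_castSucc, Fin.snoc_last, hl, smul_sub, smul_sum, smul_smul]
        module
    have hlw : ‖l * w‖ = (H ^ (e₁ + 9))⁻¹ * ‖(∑ i, t i • p i) * w - s • w‖ := by
      rw [hl, smul_mul_assoc, norm_smul, Real.norm_eq_abs, abs_of_pos (by positivity), sub_mul,
        smul_mul_assoc, one_mul]
    rcases hinj l hlmem with h | h
    · rw [hlw] at h
      refine le_trans (le_of_eq ?_) h
      simp only [a, inc]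
      rw [pow_add H (e₁ + 9) (ψ _ _)]
      field_simp
    · have hlx : ‖l (w x)‖ = (H ^ (e₁ + 9))⁻¹ * (‖w x‖ *
          ‖∑ i, t i • p i (‖w x‖⁻¹ • w x) - s • ‖w x‖⁻¹ • w x‖) := by
        rw [hl, _root_.smul_apply, norm_smul, Real.norm_eq_abs, abs_of_pos (by positivity)]
        congr 1
        conv_rhs => rw [← norm_norm (w x), ← norm_smul]
        congr 1
        simp only [_root_.sub_apply, _root_.sum_apply, _root_.smul_apply, one_apply_eq_self,
          map_smul, smul_sub, smul_sum, norm_norm]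
        congr 1
        · refine sum_congr rfl fun i _ => ?_
          rw [smul_comm ‖w x‖ (t i), smul_smul ‖w x‖, mul_inv_cancel₀ hwx0.ne', one_smul]
        · rw [smul_comm ‖w x‖ s, smul_smul ‖w x‖, mul_inv_cancel₀ hwx0.ne', one_smul]
      have hwx1 : ‖w x‖ ≤ 1 := by
        have := w.le_opNorm x
        rwa [hw1, hx1, one_mul] at this
      rw [hlw, hlx, mul_left_comm] at h
      have h2 := le_of_mul_le_mul_left h (by positivity)
      calc _ ≤ H ^ (∑ q ∈ range n, a q) * ‖(∑ i, t i • p i) * w - s • w‖ := by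
            gcongr
            refine le_trans ?_ ha
            simp only [a, inc]
            omega
        _ ≤ H ^ (∑ q ∈ range n, a q) * (H ^ (3 + ∑ q ∈ range n, (a q + 2)) * (1 *
              ‖∑ i, t i • p i (‖w x‖⁻¹ • w x) - s • ‖w x‖⁻¹ • w x‖)) := by
            gcongr
            exact h2.trans (by gcongr)
        _ = H ^ f * ‖∑ i, t i • p i (‖w x‖⁻¹ • w x) - s • ‖w x‖⁻¹ • w x‖ := by
            rw [hf, pow_add H (3 + _)]
            ring
        _ ≤ 1 := hps)
  refine ⟨v, polySet_mono A (by omega) hv, hv1.trans ?_, hv2.mono (by omega)⟩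
  gcongr

end LinearGrowth

namespace LinearGrowth
open Finset Module Metric

variable {n : ℕ}

/-- Some finite family of elements of `P` sends no unit vector too often into a given ball of
radius `R`: the proportion of the family doing so is at most `θ`. -/
def IsSpread (P : Set (Op n)) (R θ : ℝ) : Prop :=
  ∃ (ι : Type) (_ : Fintype ι) (_ : Nonempty ι) (f : ι → Op n), (∀ i, f i ∈ P) ∧
    ∀ x : Vec n, ‖x‖ = 1 → ∀ y : Vec n,
      (#{i | ‖f i x - y‖ ≤ R} : ℝ) ≤ θ * Fintype.card ι

lemma IsSpread.mono {P Q : Set (Op n)} {R R' θ θ' : ℝ} (h : IsSpread P R θ) (hPQ : P ⊆ Q)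
    (hR : R' ≤ R) (hθ : θ ≤ θ') : IsSpread Q R' θ' := by
  obtain ⟨ι, h₁, h₂, f, hf, hs⟩ := h
  refine ⟨ι, h₁, h₂, f, fun i => hPQ (hf i), fun x hx y => le_trans ?_ ((hs x hx y).trans ?_)⟩
  · gcongr
  · gcongr

lemma IsSpread.add {P₁ P₂ P : Set (Op n)} {R₁ R₂ θ₁ θ₂ B : ℝ} (h₁ : IsSpread P₁ R₁ θ₁)
    (h₂ : IsSpread P₂ R₂ θ₂) (hθ : 0 ≤ θ₂) (hB : ∀ p ∈ P₂, ‖p‖ ≤ B) (hR : R₂ + B ≤ R₁)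
    (hP : ∀ p ∈ P₁, ∀ q ∈ P₂, p + q ∈ P) : IsSpread P R₂ (θ₁ * θ₂) := by
  obtain ⟨ι, _, _, f, hf, hfs⟩ := h₁
  obtain ⟨κ, _, _, g, hg, hgs⟩ := h₂
  classical
  refine ⟨ι × κ, inferInstance, inferInstance, fun r => f r.1 + g r.2,
    fun r => hP _ (hf _) _ (hg _), fun x hx y => ?_⟩
  have hsub : ({r : ι × κ | ‖(f r.1 + g r.2) x - y‖ ≤ R₂} : Finset (ι × κ)) ⊆
      ({i : ι | ‖f i x - y‖ ≤ R₁} : Finset ι).biUnion fun i =>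
        ({j : κ | ‖g j x - (y - f i x)‖ ≤ R₂} : Finset κ).map ⟨Prod.mk i, Prod.mk_right_injective i⟩ := by
    rintro ⟨i, j⟩ hr
    simp only [mem_filter, mem_univ, true_and, _root_.add_apply] at hr
    simp only [mem_biUnion, mem_filter, mem_univ, true_and, mem_map, Function.Embedding.coeFn_mk,
      Prod.mk.injEq]
    refine ⟨i, ?_, j, ?_, rfl, rfl⟩
    · have hgx : ‖g j x‖ ≤ B := by
        have := (g j).le_opNorm x
        rw [hx, mul_one] at this
        exact this.trans (hB _ (hg j))
      calc ‖f i x - y‖ = ‖(f i x + g j x - y) - g j x‖ := by congr 1; abel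
        _ ≤ ‖f i x + g j x - y‖ + ‖g j x‖ := norm_sub_le _ _
        _ ≤ R₁ := by linarith
    · rwa [show g j x - (y - f i x) = f i x + g j x - y by abel]
  calc (#{r : ι × κ | ‖(f r.1 + g r.2) x - y‖ ≤ R₂} : ℝ)
      ≤ ∑ i ∈ ({i : ι | ‖f i x - y‖ ≤ R₁} : Finset ι),
          (#{j : κ | ‖g j x - (y - f i x)‖ ≤ R₂} : ℝ) := by
        refine (Nat.cast_le.2 ((card_le_card hsub).trans card_biUnion_le)).trans (le_of_eq ?_)
        simp only [card_map, Nat.cast_sum]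
    _ ≤ ∑ i ∈ ({i : ι | ‖f i x - y‖ ≤ R₁} : Finset ι), θ₂ * Fintype.card κ :=
        sum_le_sum fun i _ => hgs x hx _
    _ = #{i : ι | ‖f i x - y‖ ≤ R₁} * (θ₂ * Fintype.card κ) := by
        rw [sum_const, nsmul_eq_mul]
    _ ≤ θ₁ * Fintype.card ι * (θ₂ * Fintype.card κ) := by
        gcongr
        exact hfs x hx y
    _ = θ₁ * θ₂ * Fintype.card (ι × κ) := by
        rw [Fintype.card_prod, Nat.cast_mul]
        ring

lemma Frame.card_filter_grid_mul_le (hn : 0 < n) {A : Set (Op n)} {H : ℝ} {S₀ N : ℕ}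
    {g : Fin N → Op n} (F : Frame A H S₀ N g) (w : Op n) (hw : 0 < ‖w‖) {R : ℝ} (hR : 0 < R)
    {m : ℕ} (hm0 : 0 < m) (hm : H ^ 3 * ‖w‖ ≤ m * R) {x : Vec n} (hx : ‖x‖ = 1) (y : Vec n) :
    (#{τ : Fin N × Fin N → Fin (m + 1) |
      ‖∑ p, ((τ p : ℝ) / m) • g p.1 (w (g p.2 x)) - y‖ ≤ 2 * R} : ℝ) *
      (‖w‖ / (H ^ 3 * n * (7 * R))) ^ n ≤ (3 * m + 1) ^ (N * N) := by
  classical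
  have hH := F.pos
  have hm' : (0 : ℝ) < m := Nat.cast_pos.2 hm0
  have hn' : (1 : ℝ) ≤ n := Nat.one_le_cast.2 hn
  obtain ⟨b, hb⟩ := F.exists_le_apply hn w x
  rw [hx, mul_one] at hb
  set u : Vec n := w (g b x) with hu
  have hu0 : 0 < ‖u‖ := pos_of_mul_pos_right (hw.trans_le hb) (by positivity)
  have huH : ‖u‖ ≤ ‖w‖ * H := by
    refine (w.le_opNorm _).trans ?_
    gcongr
    have := (g b).le_opNorm x
    rw [hx, mul_one] at this
    exact this.trans (F.norm_le b)
  choose c hc hcs using fun z : Vec n => F.span u z (norm_pos_iff.1 hu0)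
  set Q : ℕ := ⌊‖w‖ / (H ^ 3 * n * (7 * R))⌋₊ with hQ
  have hQle : (Q : ℝ) * (H ^ 3 * n * (7 * R)) ≤ ‖w‖ := by
    rw [← le_div_iff₀ (by positivity)]
    exact Nat.floor_le (by positivity)
  have hQlt : ‖w‖ / (H ^ 3 * n * (7 * R)) ≤ (Q : ℝ) + 1 := (Nat.lt_floor_add_one _).le
  let z : (Fin n → Fin (Q + 1)) → Vec n := fun k => WithLp.toLp 2 fun i => 7 * R * (k i : ℝ)
  have hz : ∀ k, H ^ 3 * ‖z k‖ ≤ ‖w‖ := by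
    intro k
    have h1 : ‖z k‖ ≤ n * (7 * R * Q) := by
      refine abs_le_of_sq_le_sq' ?_ (by positivity) |>.2
      rw [EuclideanSpace.norm_sq_eq]
      calc ∑ i, ‖(z k) i‖ ^ 2 ≤ ∑ _i : Fin n, (7 * R * Q) ^ 2 := by
            refine sum_le_sum fun i _ => ?_
            have h3 : (z k) i = 7 * R * (k i : ℝ) := rfl
            have h2 : ((k i : ℕ) : ℝ) ≤ Q := Nat.cast_le.2 (by omega)
            rw [h3, Real.norm_of_nonneg (by positivity)]
            gcongr
        _ = n * (7 * R * Q) ^ 2 := by simp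
        _ ≤ n ^ 2 * (7 * R * Q) ^ 2 := by
            gcongr
            nlinarith
        _ = _ := by ring
    calc H ^ 3 * ‖z k‖ ≤ H ^ 3 * (n * (7 * R * Q)) := by gcongr
      _ = Q * (H ^ 3 * n * (7 * R)) := by ring
      _ ≤ ‖w‖ := hQle
  have hc1 : ∀ k j, |c (z k) j| ≤ 1 := by
    intro k j
    have h1 := hc (z k) j
    have h2 := hz k
    refine le_of_mul_le_mul_right (a := ‖u‖ * H ^ 2) ?_ (by positivity)
    calc |c (z k) j| * (‖u‖ * H ^ 2) = (|c (z k) j| * ‖u‖) * H ^ 2 := by ring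
      _ ≤ (H * ‖z k‖) * H ^ 2 := by gcongr
      _ = H ^ 3 * ‖z k‖ := by ring
      _ ≤ 1 * (‖u‖ * H ^ 2) := by linarith
  let r : (Fin n → Fin (Q + 1)) → Fin N → ℤ := fun k j => ⌊m * c (z k) j⌋
  have hr : ∀ k j, |(r k j : ℝ) / m - c (z k) j| ≤ 1 / m := by
    intro k j
    have h1 : (r k j : ℝ) ≤ m * c (z k) j := Int.floor_le _
    have h2 : m * c (z k) j < r k j + 1 := Int.lt_floor_add_one _
    rw [show (r k j : ℝ) / m - c (z k) j = (r k j - m * c (z k) j) / m by field_simp, abs_div,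
      abs_of_pos hm']
    gcongr
    rw [abs_le]
    constructor <;> linarith
  let φ : (Fin N × Fin N → Fin (m + 1)) × (Fin n → Fin (Q + 1)) → Fin N × Fin N → ℤ :=
    fun s p => ((s.1 p : ℕ) : ℤ) + if p.2 = b then r s.2 p.1 else 0
  let L : (Fin N × Fin N → ℤ) → Vec n := fun q => ∑ p, ((q p : ℝ) / m) • g p.1 (w (g p.2 x))
  have hL : ∀ s, ‖L (φ s) - ∑ p, ((s.1 p : ℝ) / m) • g p.1 (w (g p.2 x)) - z s.2‖ ≤ R := by
    intro s
    have h1 : L (φ s) - ∑ p, ((s.1 p : ℝ) / m) • g p.1 (w (g p.2 x)) =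
        ∑ j, ((r s.2 j : ℝ) / m) • g j u := by
      simp only [L, φ, ← sum_sub_distrib]
      rw [Fintype.sum_prod_type]
      refine sum_congr rfl fun j _ => ?_
      rw [Fintype.sum_eq_single b]
      · simp only [if_true, hu]
        push_cast
        module
      · intro d hd
        simp [hd]
    rw [h1]
    nth_rw 1 [← hcs (z s.2)]
    rw [← sum_sub_distrib]
    calc ‖∑ j, (((r s.2 j : ℝ) / m) • g j u - c (z s.2) j • g j u)‖
        ≤ ∑ _j : Fin N, 1 / m * (H * ‖u‖) := by
          refine norm_sum_le_of_le _ fun j _ => ?_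
          rw [← sub_smul, norm_smul]
          gcongr
          · exact hr _ _
          · exact ((g j).le_opNorm u).trans (by gcongr; exact F.norm_le j)
      _ = N * (H * ‖u‖) / m := by
          rw [sum_const, card_univ, Fintype.card_fin, nsmul_eq_mul]
          ring
      _ ≤ H * (H * (‖w‖ * H)) / m := by
          gcongr
          have := F.card_le
          have h0 : (0 : ℝ) ≤ N := Nat.cast_nonneg _
          linarith
      _ ≤ R := by
          rw [div_le_iff₀ hm']
          linarith
  set B : Finset (Fin N × Fin N → Fin (m + 1)) :=
    {τ | ‖∑ p, ((τ p : ℝ) / m) • g p.1 (w (g p.2 x)) - y‖ ≤ 2 * R} with hB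
  have hcard : (B ×ˢ (univ : Finset (Fin n → Fin (Q + 1)))).card ≤
      (Fintype.piFinset fun _ : Fin N × Fin N => Icc (-m : ℤ) (2 * m)).card := by
    refine card_le_card_of_injOn φ (fun s _ => ?_) ?_
    · refine Fintype.mem_piFinset.2 fun p => mem_Icc.2 ?_
      have h0 : (s.1 p : ℕ) ≤ m := by omega
      have h1 : -(m : ℤ) ≤ r s.2 p.1 ∧ r s.2 p.1 ≤ m := by
        have h2 := abs_le.1 (hc1 s.2 p.1)
        constructor
        · refine Int.le_floor.2 ?_
          push_cast
          nlinarith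
        · have : (m : ℤ) = ⌊(m : ℝ)⌋ := by simp
          rw [this]
          exact Int.floor_mono (by nlinarith)
      simp only [φ]
      split_ifs <;> omega
    · rintro ⟨τ, k⟩ hs ⟨τ', k'⟩ hs' heq
      have hs1 : ‖∑ p, ((τ p : ℝ) / m) • g p.1 (w (g p.2 x)) - y‖ ≤ 2 * R := by
        simpa [hB] using hs
      have hs2 : ‖∑ p, ((τ' p : ℝ) / m) • g p.1 (w (g p.2 x)) - y‖ ≤ 2 * R := by
        simpa [hB] using hs'
      have h1 := hL (τ, k)
      have h2 := hL (τ', k')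
      rw [heq] at h1
      have h3 : ‖z k - z k'‖ ≤ 6 * R := by
        calc ‖z k - z k'‖ = ‖(L (φ (τ', k')) - ∑ p, ((τ' p : ℝ) / m) • g p.1 (w (g p.2 x)) - z k') -
              (L (φ (τ', k')) - ∑ p, ((τ p : ℝ) / m) • g p.1 (w (g p.2 x)) - z k) +
              ((∑ p, ((τ' p : ℝ) / m) • g p.1 (w (g p.2 x)) - y) -
              (∑ p, ((τ p : ℝ) / m) • g p.1 (w (g p.2 x)) - y))‖ := by congr 1; abel
          _ ≤ (R + R) + (2 * R + 2 * R) := by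
              refine (norm_add_le _ _).trans (add_le_add ?_ ?_)
              · exact (norm_sub_le _ _).trans (add_le_add h2 h1)
              · exact (norm_sub_le _ _).trans (add_le_add hs2 hs1)
          _ = 6 * R := by ring
      have hk : k = k' := by
        funext i
        have h4 : |7 * R * (k i : ℝ) - 7 * R * (k' i : ℝ)| ≤ 6 * R :=
          (PiLp.norm_apply_le (z k - z k') i).trans h3
        rw [← mul_sub, abs_mul, abs_of_pos (by positivity)] at h4
        have h5 : |((k i : ℕ) : ℝ) - ((k' i : ℕ) : ℝ)| < 1 := by
          by_contra! h
          nlinarith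
        have h6 : |(((k i : ℕ) : ℤ) - ((k' i : ℕ) : ℤ))| < 1 := by exact_mod_cast h5
        rw [Int.abs_lt_one_iff] at h6
        exact Fin.ext (by omega)
      subst hk
      have hτ : τ = τ' := by
        funext p
        have := congr_fun heq p
        simp only [φ] at this
        exact Fin.ext (by omega)
      rw [hτ]
  rw [card_product, card_univ, Fintype.card_pi, Fintype.card_piFinset] at hcard
  simp only [Fintype.card_fin, prod_const, card_univ, Fintype.card_prod, Int.card_Icc] at hcard
  have h7 : (2 * (m : ℤ) + 1 - -m).toNat = 3 * m + 1 := by omega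
  rw [h7] at hcard
  calc (#B : ℝ) * (‖w‖ / (H ^ 3 * n * (7 * R))) ^ n ≤ #B * ((Q : ℝ) + 1) ^ n := by gcongr
    _ ≤ _ := by exact_mod_cast hcard

end LinearGrowth

namespace LinearGrowth
open Finset Module Metric

variable {n : ℕ}

theorem Frame.isSpread (hn : 0 < n) {A : Set (Op n)} {H : ℝ} {S₀ N S e : ℕ}
    {g : Fin N → Op n} (F : Frame A H S₀ N g) (hS : S₀ ≤ S) (hH₁ : 3 ^ (N * N) ≤ H)
    (hH₂ : 7 * n ≤ H) {w : Op n} (hw : 0 < ‖w‖) (hseg : IsSegment A H S e w) {R : ℝ} (hR : 0 < R)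
    (hRe : H ^ 4 * ‖w‖ ≤ H ^ e * R) :
    IsSpread (polySet A (S + 2 + N * N) ∩ closedBall 0 (H ^ 4 * ‖w‖)) R
      (H * (H ^ 4 * R / ‖w‖) ^ n) := by
  classical
  have hH := F.pos
  have hH1 : 1 ≤ H := F.one_le
  have hN0 : (0 : ℝ) ≤ N := Nat.cast_nonneg _
  have hNH : (4 : ℝ) * N ≤ H := by linarith [F.card_le]
  have hn0 : (0 : ℝ) < n := Nat.cast_pos.2 hn
  choose! P hP hPw using hseg
  obtain ⟨m, hm⟩ := exists_nat_ge (H ^ 3 * ‖w‖ / R)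
  rw [div_le_iff₀ hR] at hm
  have hm0 : 0 < m := by
    rcases Nat.eq_zero_or_pos m with h | h
    · rw [h, Nat.cast_zero, zero_mul] at hm
      have : 0 < H ^ 3 * ‖w‖ := by positivity
      linarith
    · exact h
  have hm' : (0 : ℝ) < m := Nat.cast_pos.2 hm0
  let f : (Fin N × Fin N → Fin (m + 1)) → Op n := fun τ =>
    ∑ p, g p.1 * P ((τ p : ℝ) / m) * g p.2
  have hgrid : ∀ i : Fin (m + 1), ((i : ℝ) / m) ∈ Set.Icc (0 : ℝ) 1 := fun i =>
    ⟨by positivity, div_le_one_of_le₀ (Nat.cast_le.2 (by omega)) hm'.le⟩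
  have hdist : ∀ i : Fin (m + 1), ‖P ((i : ℝ) / m) - ((i : ℝ) / m) • w‖ ≤ ‖w‖ / H ^ e := by
    intro i
    rw [le_div_iff₀ (by positivity), mul_comm]
    exact hPw _ (hgrid i)
  have hcardp : (Fintype.card (Fin N × Fin N) : ℝ) = N * N := by simp
  have hmul : ∀ (p : Fin N × Fin N) (q : Op n) (c : ℝ), ‖q‖ ≤ c →
      ‖g p.1 * q * g p.2‖ ≤ H * c * H := by
    intro p q c hq
    calc ‖g p.1 * q * g p.2‖ ≤ ‖g p.1‖ * ‖q‖ * ‖g p.2‖ := by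
          refine (norm_mul_le _ _).trans ?_
          gcongr
          exact norm_mul_le _ _
      _ ≤ H * c * H := by
          gcongr
          · exact mul_nonneg hH.le ((norm_nonneg _).trans hq)
          · exact F.norm_le _
          · exact F.norm_le _
  refine ⟨Fin N × Fin N → Fin (m + 1), inferInstance, inferInstance, f, fun τ => ⟨?_, ?_⟩, ?_⟩
  · have h := sum_mem_polySet (A := A) (l := S + 2) (univ : Finset (Fin N × Fin N))
      (fun p => g p.1 * P ((τ p : ℝ) / m) * g p.2) fun p _ =>
        mul_mem_polySet (mul_mem_polySet (polySet_mono A hS (F.mem _)) (hP _ (hgrid _)))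
          (polySet_mono A (by omega) (F.mem _))
    rwa [card_univ, Fintype.card_prod, Fintype.card_fin] at h
  · rw [mem_closedBall_zero_iff]
    calc ‖f τ‖ ≤ ∑ _p : Fin N × Fin N, H * (2 * ‖w‖) * H := by
          refine norm_sum_le_of_le _ fun p _ => hmul p _ _ ?_
          have h1 := hdist (τ p)
          have h2 : ‖w‖ / H ^ e ≤ ‖w‖ := div_le_self hw.le (one_le_pow₀ hH1)
          have h3 : ‖((τ p : ℝ) / m) • w‖ ≤ 1 * ‖w‖ := by
            rw [norm_smul, Real.norm_of_nonneg (hgrid _).1]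
            gcongr
            exact (hgrid _).2
          have h4 := norm_le_norm_add_norm_sub' (P ((τ p : ℝ) / m)) (((τ p : ℝ) / m) • w)
          linarith
      _ = 2 * (N * N) * (H ^ 2 * ‖w‖) := by
          rw [sum_const, card_univ, nsmul_eq_mul, hcardp]
          ring
      _ ≤ (H * H) * (H ^ 2 * ‖w‖) := by
          refine mul_le_mul_of_nonneg_right ?_ (by positivity)
          nlinarith
      _ = H ^ 4 * ‖w‖ := by ring
  · intro x hx y
    have happrox : ∀ τ : Fin N × Fin N → Fin (m + 1),
        ‖f τ x - ∑ p, ((τ p : ℝ) / m) • g p.1 (w (g p.2 x))‖ ≤ R := by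
      intro τ
      have h1 : f τ x - ∑ p, ((τ p : ℝ) / m) • g p.1 (w (g p.2 x)) =
          (∑ p, g p.1 * (P ((τ p : ℝ) / m) - ((τ p : ℝ) / m) • w) * g p.2) x := by
        simp only [f, _root_.sum_apply, ← sum_sub_distrib]
        refine sum_congr rfl fun p _ => ?_
        simp only [mul_apply_eq_comp, _root_.sub_apply, _root_.smul_apply, map_sub, map_smul]
      rw [h1]
      refine ((ContinuousLinearMap.le_opNorm _ x).trans (le_of_eq (by rw [hx, mul_one]))).trans ?_
      calc ‖∑ p, g p.1 * (P ((τ p : ℝ) / m) - ((τ p : ℝ) / m) • w) * g p.2‖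
          ≤ ∑ _p : Fin N × Fin N, H * (‖w‖ / H ^ e) * H :=
            norm_sum_le_of_le _ fun p _ => hmul p _ _ (hdist _)
        _ = (N * N) * (H ^ 2 * ‖w‖ / H ^ e) := by
            rw [sum_const, card_univ, nsmul_eq_mul, hcardp]
            ring
        _ ≤ (H * H) * (H ^ 2 * ‖w‖ / H ^ e) := by
            gcongr <;> linarith
        _ = H ^ 4 * ‖w‖ / H ^ e := by ring
        _ ≤ R := by
            rw [div_le_iff₀ (by positivity)]
            linarith
    have h1 := F.card_filter_grid_mul_le hn w hw hR hm0 hm hx y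
    set B : Finset (Fin N × Fin N → Fin (m + 1)) :=
      {τ | ‖∑ p, ((τ p : ℝ) / m) • g p.1 (w (g p.2 x)) - y‖ ≤ 2 * R} with hB
    have hle : (#{τ | ‖f τ x - y‖ ≤ R} : ℝ) ≤ #B := by
      refine Nat.cast_le.2 (card_le_card fun τ hτ => ?_)
      simp only [mem_filter, mem_univ, true_and, hB] at hτ ⊢
      calc ‖∑ p, ((τ p : ℝ) / m) • g p.1 (w (g p.2 x)) - y‖
          = ‖(f τ x - y) - (f τ x - ∑ p, ((τ p : ℝ) / m) • g p.1 (w (g p.2 x)))‖ := by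
            congr 1; abel
        _ ≤ R + R := (norm_sub_le _ _).trans (add_le_add hτ (happrox τ))
        _ = 2 * R := by ring
    have hD : 0 < ‖w‖ / (H ^ 3 * n * (7 * R)) := by positivity
    have hcard : (Fintype.card (Fin N × Fin N → Fin (m + 1)) : ℝ) = (m + 1) ^ (N * N) := by
      simp
    rw [hcard]
    rw [← le_div_iff₀ (by positivity)] at h1
    calc (#{τ | ‖f τ x - y‖ ≤ R} : ℝ) ≤ #B := hle
      _ ≤ (3 * m + 1) ^ (N * N) / (‖w‖ / (H ^ 3 * n * (7 * R))) ^ n := h1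
      _ ≤ (3 * (m + 1)) ^ (N * N) / (‖w‖ / (H ^ 3 * n * (7 * R))) ^ n := by
          gcongr
          linarith
      _ = 3 ^ (N * N) * (m + 1) ^ (N * N) * ((7 * n) * H ^ 3 * R / ‖w‖) ^ n := by
          rw [div_eq_mul_inv, ← inv_pow, inv_div, mul_pow]
          congr 3
          ring
      _ ≤ H * (m + 1) ^ (N * N) * (H * H ^ 3 * R / ‖w‖) ^ n := by
          gcongr
      _ = H * (H ^ 4 * R / ‖w‖) ^ n * (m + 1) ^ (N * N) := by ring

theorem RichFrame.isSpread_digit (hn : 0 < n) (e₁ S₀ N S e m : ℕ) : ∃ S' : ℕ,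
    ∀ {A : Set (Op n)} {H : ℝ} {g : Fin N → Op n} {T : Finset (Op n)},
    RichFrame A H S₀ N e₁ g T → 3 ^ (N * N) ≤ H → 7 * n ≤ H → ∀ v ∈ polySet A S, 0 < ‖v‖ →
    IsSegment A H S (e + 7) v →
    IsSpread (polySet A S' ∩ closedBall 0 (H ^ 5 * ‖v‖ / (H ^ e) ^ m))
      (H ^ 6 * ‖v‖ / (H ^ e) ^ (m + 1)) ((H ^ (e₁ + 17) / H ^ e) ^ n) := by
  obtain ⟨c, hc⟩ := RichFrame.exists_size S₀ (e * m)
  refine ⟨S + S₀ + c + 2 + 2 + N * N, fun {A H g T} F hH₁ hH₂ v hv hv0 hseg => ?_⟩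
  have hH := F.pos
  have hH1 := F.one_le
  set D := H ^ e with hD
  have hD0 : 0 < D := by positivity
  obtain ⟨z, hz, hzτ, hτz⟩ := hc F (D ^ m)⁻¹ (by
      rw [pow_mul, mul_inv_cancel₀ (by positivity)]) (inv_le_one_of_one_le₀
        (one_le_pow₀ (one_le_pow₀ hH1)))
  obtain ⟨j, hj⟩ := F.exists_le_mul hn v z
  set w := v * g j * z with hw
  have hz0 : 0 < ‖z‖ :=
    pos_of_mul_pos_right ((by positivity : 0 < (D ^ m)⁻¹).trans_le hτz) (by positivity)
  have hw0 : 0 < ‖w‖ :=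
    pos_of_mul_pos_right ((by positivity : 0 < ‖v‖ * ‖z‖).trans_le hj) (by positivity)
  have hwle : ‖w‖ ≤ H * ‖v‖ / D ^ m := by
    calc ‖w‖ ≤ H * ‖v‖ * ‖z‖ := F.norm_mul_mul_le v z j
      _ ≤ H * ‖v‖ * (D ^ m)⁻¹ := by gcongr
      _ = _ := by rw [div_eq_mul_inv]
  have hlew : ‖v‖ / D ^ m ≤ H ^ (e₁ + 6) * ‖w‖ := by
    calc ‖v‖ / D ^ m = ‖v‖ * (D ^ m)⁻¹ := div_eq_mul_inv _ _
      _ ≤ ‖v‖ * (H ^ (e₁ + 3) * ‖z‖) := by gcongr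
      _ = H ^ (e₁ + 3) * (‖v‖ * ‖z‖) := by ring
      _ ≤ H ^ (e₁ + 3) * (H ^ 3 * ‖w‖) := by gcongr
      _ = _ := by ring
  have hsegw : IsSegment A H (S + S₀ + c + 2) (e + 3) w := by
    intro τ hτ
    obtain ⟨p, hp, hpv⟩ := hseg τ hτ
    refine ⟨p * g j * z, mul_mem_polySet (mul_mem_polySet (polySet_mono A (by omega) hp)
      (polySet_mono A (by omega) (F.mem j))) (polySet_mono A (by omega) hz), ?_⟩
    have h1 : p * g j * z - τ • w = (p - τ • v) * g j * z := by
      rw [hw, sub_mul, sub_mul, smul_mul_assoc, smul_mul_assoc]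
    rw [h1]
    refine le_of_mul_le_mul_left ?_ (by positivity : 0 < H ^ 4)
    calc H ^ 4 * (H ^ (e + 3) * ‖(p - τ • v) * g j * z‖)
        ≤ H ^ 4 * (H ^ (e + 3) * (H * ‖p - τ • v‖ * ‖z‖)) := by
          gcongr
          exact F.norm_mul_mul_le _ _ _
      _ = H * (H ^ (e + 7) * ‖p - τ • v‖) * ‖z‖ := by ring
      _ ≤ H * ‖v‖ * ‖z‖ := by gcongr
      _ = H * (‖v‖ * ‖z‖) := by ring
      _ ≤ H * (H ^ 3 * ‖w‖) := by gcongr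
      _ = H ^ 4 * ‖w‖ := by ring
  have hR : 0 < H ^ 6 * ‖v‖ / D ^ (m + 1) := by positivity
  refine (F.toFrame.isSpread hn (S := S + S₀ + c + 2) (by omega) hH₁ hH₂ hw0 hsegw hR ?_).mono
    ?_ le_rfl ?_
  · calc H ^ 4 * ‖w‖ ≤ H ^ 4 * (H * ‖v‖ / D ^ m) := by gcongr
      _ = H ^ 5 * ‖v‖ / D ^ m := by ring
      _ ≤ H ^ 9 * ‖v‖ / D ^ m := by
          gcongr
          norm_num
      _ = H ^ (e + 3) * (H ^ 6 * ‖v‖ / D ^ (m + 1)) := by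
          rw [pow_add, ← hD]
          field_simp
          exact pow_succ D m
  · refine Set.inter_subset_inter_right _ (closedBall_subset_closedBall ?_)
    calc H ^ 4 * ‖w‖ ≤ H ^ 4 * (H * ‖v‖ / D ^ m) := by gcongr
      _ = H ^ 5 * ‖v‖ / D ^ m := by ring
  · have h1 : H ^ 4 * (H ^ 6 * ‖v‖ / D ^ (m + 1)) / ‖w‖ ≤ H ^ (e₁ + 16) / D := by
      rw [div_le_iff₀ hw0]
      calc H ^ 4 * (H ^ 6 * ‖v‖ / D ^ (m + 1)) = H ^ 10 * (‖v‖ / D ^ m) / D := by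
            field_simp
            exact (pow_succ D m).symm
        _ ≤ H ^ 10 * (H ^ (e₁ + 6) * ‖w‖) / D := by gcongr
        _ = _ := by ring
    calc H * (H ^ 4 * (H ^ 6 * ‖v‖ / D ^ (m + 1)) / ‖w‖) ^ n
        ≤ H ^ n * (H ^ (e₁ + 16) / D) ^ n := by
          gcongr
          exact le_self_pow₀ hH1 hn.ne'
      _ = (H ^ (e₁ + 17) / D) ^ n := by
          rw [← mul_pow]
          ring

theorem RichFrame.exists_isSpread (hn : 0 < n) (e₁ S₀ N S e q : ℕ) (he : 0 < e) : ∃ S' : ℕ,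
    ∀ {A : Set (Op n)} {H : ℝ} {g : Fin N → Op n} {T : Finset (Op n)},
    RichFrame A H S₀ N e₁ g T → 3 ^ (N * N) ≤ H → 7 * n ≤ H → ∀ v ∈ polySet A S, 0 < ‖v‖ →
    IsSegment A H S (e + 7) v →
    IsSpread (polySet A S') (H ^ 6 * ‖v‖ / (H ^ e) ^ (q + 1))
      ((H ^ (e₁ + 17) / H ^ e) ^ (n * (q + 1))) := by
  induction q with
  | zero =>
    obtain ⟨S', h⟩ := RichFrame.isSpread_digit hn e₁ S₀ N S e 0
    refine ⟨S', fun F hH₁ hH₂ v hv hv0 hseg => ?_⟩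
    rw [zero_add, mul_one]
    exact (h F hH₁ hH₂ v hv hv0 hseg).mono Set.inter_subset_left le_rfl le_rfl
  | succ q ih =>
    obtain ⟨S₁, h₁⟩ := ih
    obtain ⟨S₂, h₂⟩ := RichFrame.isSpread_digit hn e₁ S₀ N S e (q + 1)
    refine ⟨max S₁ S₂ + 1, fun {A H g T} F hH₁ hH₂ v hv hv0 hseg => ?_⟩
    have hH := F.pos
    have hH1 := F.one_le
    have hH4 := F.four_le
    have hHe : H ≤ H ^ e := le_self_pow₀ hH1 he.ne'
    rw [mul_add n (q + 1) 1, mul_one, pow_add _ (n * (q + 1))]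
    refine (h₁ F hH₁ hH₂ v hv hv0 hseg).add (h₂ F hH₁ hH₂ v hv hv0 hseg) (by positivity)
      (fun p hp => mem_closedBall_zero_iff.1 hp.2) ?_ fun p hp r hr =>
        add_mem_polySet (polySet_mono A (le_max_left _ _) hp) (polySet_mono A (le_max_right _ _) hr.1)
    calc H ^ 6 * ‖v‖ / (H ^ e) ^ (q + 1 + 1) + H ^ 5 * ‖v‖ / (H ^ e) ^ (q + 1)
        ≤ H ^ 6 * ‖v‖ / ((H ^ e) ^ (q + 1) * H) + H ^ 5 * ‖v‖ / (H ^ e) ^ (q + 1) := by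
          rw [pow_succ (H ^ e) (q + 1)]
          gcongr
      _ = 2 * (H ^ 5 * ‖v‖) / (H ^ e) ^ (q + 1) := by
          field_simp
          ring
      _ ≤ H * (H ^ 5 * ‖v‖) / (H ^ e) ^ (q + 1) := by
          gcongr
          linarith
      _ = _ := by ring

end LinearGrowth

namespace LinearGrowth
open Finset Module Metric

variable {n : ℕ}

lemma card_sq_le_card_mul_collisions {α β : Type*} [DecidableEq β] (s : Finset α) (t : Finset β)
    (f : α → β) (hf : ∀ a ∈ s, f a ∈ t) :
    #s ^ 2 ≤ #t * ∑ a ∈ s, #{b ∈ s | f a = f b} := by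
  have h1 : #s = ∑ c ∈ t, #{a ∈ s | f a = c} := card_eq_sum_card_fiberwise hf
  have h2 : ∑ a ∈ s, #{b ∈ s | f a = f b} = ∑ c ∈ t, #{a ∈ s | f a = c} ^ 2 := by
    rw [← sum_fiberwise_of_maps_to hf]
    refine sum_congr rfl fun c _ => ?_
    rw [sum_congr rfl (g := fun _ => #{a ∈ s | f a = c}), sum_const, smul_eq_mul, sq]
    intro a ha
    rw [(mem_filter.1 ha).2]
    congr 1
    ext b
    simp only [mem_filter, eq_comm]
  rw [h2]
  nth_rw 1 [h1]
  exact sq_sum_le_card_mul_sum_sq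

/-- If a spread family moves `X₁` so that `X₂ + f X₁` can always be covered by few balls, then
`X₁` is small. -/
theorem IsSpread.card_mul_card_le {P : Set (Op n)} {δ r θ : ℝ} {M : ℕ} (hδ : 0 < δ) (hr : 0 < r)
    (hθ : 0 ≤ θ) (hP : IsSpread P (2 * δ / r) θ) (X₁ X₂ : Finset (Vec n))
    (h₁ : ∀ a ∈ X₁, ∀ b ∈ X₁, a ≠ b → r < dist a b)
    (h₂ : ∀ a ∈ X₂, ∀ b ∈ X₂, a ≠ b → δ < dist a b)
    (hcov : ∀ f ∈ P, ∃ C : Finset (Vec n), #C ≤ M ∧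
      ∀ a ∈ X₂, ∀ b ∈ X₁, ∃ c ∈ C, dist (a + f b) c ≤ δ) :
    (#X₁ * #X₂ : ℝ) ≤ M * (5 ^ n + θ * (#X₁ * #X₂)) := by
  classical
  obtain ⟨ι, _, _, f, hf, hfs⟩ := hP
  set s : Finset (Vec n × Vec n) := X₂ ×ˢ X₁ with hs
  have hsc : (#s : ℝ) = #X₁ * #X₂ := by rw [hs, card_product, Nat.cast_mul, mul_comm]
  rw [← hsc]
  have hCS : ∀ i, (#s : ℝ) ^ 2 ≤ M * ∑ a ∈ s, ∑ b ∈ s,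
      (if ‖(a.1 + f i a.2) - (b.1 + f i b.2)‖ ≤ 2 * δ then 1 else 0 : ℝ) := by
    intro i
    obtain ⟨C, hCM, hC⟩ := hcov (f i) (hf i)
    choose! φ hφ hφd using fun a : Vec n × Vec n => fun ha : a ∈ s =>
      hC a.1 (mem_product.1 ha).1 a.2 (mem_product.1 ha).2
    have h := card_sq_le_card_mul_collisions s C φ hφ
    calc (#s : ℝ) ^ 2 ≤ #C * ∑ a ∈ s, (#{b ∈ s | φ a = φ b} : ℝ) := by exact_mod_cast h
      _ ≤ _ := by
        refine mul_le_mul (Nat.cast_le.2 hCM) (sum_le_sum fun a ha => ?_)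
          (sum_nonneg fun a _ => Nat.cast_nonneg _) (Nat.cast_nonneg _)
        rw [card_filter, Nat.cast_sum]
        refine sum_le_sum fun b hb => ?_
        by_cases hab : φ a = φ b
        · have h1 : ‖(a.1 + f i a.2) - (b.1 + f i b.2)‖ ≤ 2 * δ := by
            rw [← dist_eq_norm]
            have h2 := hφd a ha
            have h3 := hφd b hb
            rw [← hab] at h3
            linarith [dist_triangle_right (a.1 + f i a.2) (b.1 + f i b.2) (φ a)]
          rw [if_pos hab, if_pos h1, Nat.cast_one]
        · rw [if_neg hab, Nat.cast_zero]
          split_ifs <;> norm_num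
  have hnear : ∀ a ∈ s, (∑ b ∈ s, if a.2 = b.2 ∧ ‖a.1 - b.1‖ ≤ 2 * δ then 1 else 0 : ℝ) ≤
      5 ^ n := by
    intro a _
    rw [sum_boole]
    set U : Finset (Vec n) := ({b ∈ s | a.2 = b.2 ∧ ‖a.1 - b.1‖ ≤ 2 * δ}).image fun b => a.1 - b.1
      with hU
    have hcard : #{b ∈ s | a.2 = b.2 ∧ ‖a.1 - b.1‖ ≤ 2 * δ} = #U := by
      refine (card_image_of_injOn fun b hb c hc h => ?_).symm
      have hb' := (mem_filter.1 hb).2.1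
      have hc' := (mem_filter.1 hc).2.1
      exact Prod.ext (sub_right_injective h) (hb'.symm.trans hc')
    have hUnorm : ∀ u ∈ U, ‖u‖ ≤ 2 * δ := by
      intro u hu
      obtain ⟨b, hb, rfl⟩ := mem_image.1 hu
      exact (mem_filter.1 hb).2.2
    have hUsep : ∀ u ∈ U, ∀ v ∈ U, u ≠ v → δ < dist u v := by
      intro u hu v hv huv
      obtain ⟨b, hb, rfl⟩ := mem_image.1 hu
      obtain ⟨c, hc, rfl⟩ := mem_image.1 hv
      rw [dist_sub_left]
      refine h₂ _ (mem_product.1 (mem_filter.1 hb).1).1 _ (mem_product.1 (mem_filter.1 hc).1).1 ?_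
      rintro h
      exact huv (by rw [h])
    have h := card_mul_pow_le_of_separated hδ (by positivity) hUnorm hUsep
    rw [finrank_euclideanSpace_fin] at h
    rw [hcard]
    refine le_of_mul_le_mul_right (h.trans (le_of_eq ?_)) (by positivity : 0 < (δ / 2) ^ n)
    rw [← mul_pow]
    ring
  have hpair : ∀ a ∈ s, ∀ b ∈ s, (∑ i, if ‖(a.1 + f i a.2) - (b.1 + f i b.2)‖ ≤ 2 * δ then 1 else 0 : ℝ) ≤
      Fintype.card ι * ((if a.2 = b.2 ∧ ‖a.1 - b.1‖ ≤ 2 * δ then 1 else 0) + θ) := by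
    intro a ha b hb
    by_cases hab : a.2 = b.2
    · have h1 : ∀ i, (a.1 + f i a.2) - (b.1 + f i b.2) = a.1 - b.1 := fun i => by
        rw [hab, add_sub_add_right_eq_sub]
      simp only [h1]
      rw [sum_const, card_univ, nsmul_eq_mul]
      simp only [hab, true_and]
      gcongr
      linarith
    · rw [if_neg fun h => hab h.1, zero_add, mul_comm _ θ, sum_boole]
      have hd : r < ‖a.2 - b.2‖ := by
        rw [← dist_eq_norm]
        exact h₁ _ (mem_product.1 ha).2 _ (mem_product.1 hb).2 hab
      have hd0 : 0 < ‖a.2 - b.2‖ := hr.trans hd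
      refine le_trans ?_ (hfs (‖a.2 - b.2‖⁻¹ • (a.2 - b.2))
        (by rw [norm_smul, norm_inv, norm_norm, inv_mul_cancel₀ hd0.ne'])
        (‖a.2 - b.2‖⁻¹ • (b.1 - a.1)))
      refine Nat.cast_le.2 (card_le_card (monotone_filter_right _ fun i _ hi => ?_))
      rw [map_smul, ← smul_sub, norm_smul, norm_inv, norm_norm, map_sub,
        show f i a.2 - f i b.2 - (b.1 - a.1) = a.1 + f i a.2 - (b.1 + f i b.2) by abel,
        inv_mul_eq_div]
      gcongr
  rcases (Nat.cast_nonneg #s : (0 : ℝ) ≤ #s).eq_or_lt with h0 | h0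
  · rw [← h0]
    positivity
  have hι : (0 : ℝ) < Fintype.card ι := Nat.cast_pos.2 Fintype.card_pos
  refine le_of_mul_le_mul_left (a := Fintype.card ι * (#s : ℝ)) ?_ (by positivity)
  calc Fintype.card ι * (#s : ℝ) * #s = ∑ _i : ι, (#s : ℝ) ^ 2 := by
        rw [sum_const, card_univ, nsmul_eq_mul]
        ring
    _ ≤ ∑ i, M * ∑ a ∈ s, ∑ b ∈ s,
      (if ‖(a.1 + f i a.2) - (b.1 + f i b.2)‖ ≤ 2 * δ then 1 else 0 : ℝ) := sum_le_sum fun i _ => hCS i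
    _ = M * ∑ a ∈ s, ∑ b ∈ s, ∑ i,
      (if ‖(a.1 + f i a.2) - (b.1 + f i b.2)‖ ≤ 2 * δ then 1 else 0 : ℝ) := by
        rw [← mul_sum, sum_comm]
        congr 1
        exact sum_congr rfl fun a _ => sum_comm
    _ ≤ M * ∑ a ∈ s, ∑ b ∈ s, Fintype.card ι *
          ((if a.2 = b.2 ∧ ‖a.1 - b.1‖ ≤ 2 * δ then 1 else 0) + θ) := by
        gcongr with a ha b hb
        exact hpair a ha b hb
    _ = M * (Fintype.card ι * ∑ a ∈ s,
          (∑ b ∈ s, (if a.2 = b.2 ∧ ‖a.1 - b.1‖ ≤ 2 * δ then 1 else 0 : ℝ) + #s * θ)) := by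
        simp only [← mul_sum, sum_add_distrib, sum_const, nsmul_eq_mul]
    _ ≤ M * (Fintype.card ι * ∑ a ∈ s, (5 ^ n + #s * θ)) := by
        gcongr with a ha
        exact hnear a ha
    _ = Fintype.card ι * #s * (M * (5 ^ n + θ * #s)) := by
        rw [sum_const, nsmul_eq_mul]
        ring

end LinearGrowth

namespace LinearGrowth
open Finset Module Metric

variable {n : ℕ}

open scoped Pointwise

lemma nsmul_closedBall_subset {E : Type*} [SeminormedAddCommGroup E] (m : ℕ) (r : ℝ) :
    m • closedBall (0 : E) r ⊆ closedBall 0 (m * r) := by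
  induction m with
  | zero => simp
  | succ m ih =>
    rw [succ_nsmul]
    rintro _ ⟨x, hx, y, hy, rfl⟩
    have h1 := mem_closedBall_zero_iff.1 (ih hx)
    have h2 := mem_closedBall_zero_iff.1 hy
    rw [mem_closedBall_zero_iff]
    refine (norm_add_le x y).trans ?_
    push_cast
    linarith

/-- The image of `X` under `f` lies in boundedly many translates of an iterated sumset of
`X - X`, up to a small error. -/
def IsRuzsaBounded (X : Set (Vec n)) (δ K : ℝ) (g : ℕ) (f : Op n) : Prop :=
  ∃ Φ : Finset (Vec n), (#Φ : ℝ) ≤ K ^ g ∧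
    f '' X ⊆ (Φ : Set (Vec n)) + g • (X - X) + closedBall 0 (K ^ g * δ)

section RuzsaBounded

variable {X : Set (Vec n)} {δ K : ℝ} {g g' : ℕ} {f f' : Op n}

lemma IsRuzsaBounded.mono (h : IsRuzsaBounded X δ K g f) (hX : X.Nonempty) (hδ : 0 < δ)
    (hK : 1 ≤ K) (hg : g ≤ g') : IsRuzsaBounded X δ K g' f := by
  obtain ⟨Φ, hΦ, hfΦ⟩ := h
  refine ⟨Φ, hΦ.trans (by gcongr), hfΦ.trans ?_⟩
  have h0 : (0 : Vec n) ∈ X - X := by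
    obtain ⟨x, hx⟩ := hX
    exact ⟨x, hx, x, hx, sub_self x⟩
  refine Set.add_subset_add (Set.add_subset_add_left ?_) (closedBall_subset_closedBall ?_)
  · exact Set.nsmul_subset_nsmul_right h0 hg
  · gcongr

lemma neg_sub_self (X : Set (Vec n)) : -(X - X) = X - X := neg_sub X X

lemma IsRuzsaBounded.add (h : IsRuzsaBounded X δ K g f) (h' : IsRuzsaBounded X δ K g f')
    (hδ : 0 < δ) (hK : 2 ≤ K) (hX : X.Nonempty) : IsRuzsaBounded X δ K (2 * g + 1) (f + f') := by
  classical
  obtain ⟨Φ, hΦ, hfΦ⟩ := h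
  obtain ⟨Ψ, hΨ, hfΨ⟩ := h'
  have hK1 : 1 ≤ K := by linarith
  have h0 : (0 : Vec n) ∈ X - X := by
    obtain ⟨x, hx⟩ := hX
    exact ⟨x, hx, x, hx, sub_self x⟩
  refine ⟨Φ + Ψ, ?_, ?_⟩
  · calc (#(Φ + Ψ) : ℝ) ≤ #Φ * #Ψ := by exact_mod_cast card_add_le
      _ ≤ K ^ g * K ^ g := by gcongr
      _ = K ^ (2 * g) := by ring
      _ ≤ K ^ (2 * g + 1) := by
        gcongr
        omega
  · rintro _ ⟨x, hx, rfl⟩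
    have h1 : (f + f') x ∈ ((Φ : Set (Vec n)) + g • (X - X) + closedBall 0 (K ^ g * δ)) +
        ((Ψ : Set (Vec n)) + g • (X - X) + closedBall 0 (K ^ g * δ)) :=
      ⟨f x, hfΦ ⟨x, hx, rfl⟩, f' x, hfΨ ⟨x, hx, rfl⟩, rfl⟩
    rw [add_add_add_comm, add_add_add_comm (Φ : Set (Vec n)), ← add_nsmul] at h1
    rw [coe_add]
    refine Set.add_subset_add (Set.add_subset_add_left ?_) ?_ h1
    · exact Set.nsmul_subset_nsmul_right h0 (by omega)
    · rw [← two_nsmul]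
      refine (nsmul_closedBall_subset 2 _).trans (closedBall_subset_closedBall ?_)
      calc ((2 : ℕ) : ℝ) * (K ^ g * δ) ≤ K * (K ^ g * δ) := by
            gcongr
            exact_mod_cast hK
        _ = K ^ (g + 1) * δ := by ring
        _ ≤ _ := by
          gcongr
          omega

lemma IsRuzsaBounded.neg (h : IsRuzsaBounded X δ K g f) : IsRuzsaBounded X δ K g (-f) := by
  classical
  obtain ⟨Φ, hΦ, hfΦ⟩ := h
  refine ⟨-Φ, by rwa [card_neg], ?_⟩
  rintro _ ⟨x, hx, rfl⟩
  obtain ⟨_, ⟨φ, hφ, d, hd, rfl⟩, b, hb, h⟩ := hfΦ ⟨x, hx, rfl⟩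
  refine ⟨_, ⟨-φ, by simpa using hφ, -d, ?_, rfl⟩, -b, by simpa using hb, ?_⟩
  · rw [← neg_sub_self, neg_nsmul]
    simpa using hd
  · simp only [_root_.neg_apply] at h ⊢
    rw [← h]
    abel

lemma IsRuzsaBounded.mul (h : IsRuzsaBounded X δ K g f) (h' : IsRuzsaBounded X δ K g f')
    (hδ : 0 < δ) (hK : 2 ≤ K) (hX : X.Nonempty) {l : ℕ} (hf : ‖f‖ ≤ K ^ l) :
    IsRuzsaBounded X δ K (2 * g * g + 3 * g + l + 1) (f * f') := by
  classical
  obtain ⟨Φ, hΦ, hfΦ⟩ := h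
  obtain ⟨Ψ, hΨ, hfΨ⟩ := h'
  have hK1 : 1 ≤ K := by linarith
  have h0 : (0 : Vec n) ∈ X - X := by
    obtain ⟨x, hx⟩ := hX
    exact ⟨x, hx, x, hx, sub_self x⟩
  set r := K ^ g * δ with hr
  have hr0 : 0 < r := by positivity
  have hD : f '' (X - X) ⊆ ((Φ - Φ : Finset (Vec n)) : Set (Vec n)) + (2 * g) • (X - X) +
      closedBall 0 (2 * r) := by
    rw [Set.image_sub]
    refine (Set.sub_subset_sub hfΦ hfΦ).trans ?_
    rw [add_sub_add_comm, add_sub_add_comm, coe_sub]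
    refine Set.add_subset_add (Set.add_subset_add_left ?_) ?_
    · rw [sub_eq_add_neg, ← neg_nsmul, neg_sub_self, ← add_nsmul, two_mul]
    · rw [sub_eq_add_neg, neg_closedBall, neg_zero, ← two_nsmul]
      exact nsmul_closedBall_subset 2 r
  refine ⟨Ψ.image f + g • (Φ - Φ), ?_, ?_⟩
  · calc (#(Ψ.image f + g • (Φ - Φ)) : ℝ) ≤ #(Ψ.image f) * #(g • (Φ - Φ)) := by
          exact_mod_cast card_add_le
      _ ≤ #Ψ * (#Φ * #Φ) ^ g := by
          refine mul_le_mul (Nat.cast_le.2 card_image_le) ?_ (Nat.cast_nonneg _) (Nat.cast_nonneg _)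
          exact_mod_cast (card_nsmul_le (s := Φ - Φ)).trans (Nat.pow_le_pow_left card_sub_le g)
      _ ≤ K ^ g * (K ^ g * K ^ g) ^ g := by gcongr
      _ = K ^ (g + 2 * g * g) := by ring
      _ ≤ _ := pow_le_pow_right₀ hK1 (by linarith [Nat.zero_le g, Nat.zero_le l])
  · have h1 : (f * f') '' X ⊆ ((Ψ.image f : Finset (Vec n)) : Set (Vec n)) + g • (f '' (X - X)) +
        closedBall 0 (‖f‖ * r) := by
      have h2 : (f * f') '' X = f '' (f' '' X) := by
        rw [Set.image_image]
        rfl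
      rw [h2]
      refine (Set.image_mono hfΨ).trans ?_
      rw [Set.image_add, Set.image_add, coe_image, Set.image_nsmul]
      refine Set.add_subset_add_left ?_
      rintro _ ⟨b, hb, rfl⟩
      rw [mem_closedBall_zero_iff] at hb ⊢
      exact (f.le_opNorm b).trans (by gcongr)
    refine h1.trans ((Set.add_subset_add_right (Set.add_subset_add_left
      (Set.nsmul_subset_nsmul_left hD))).trans ?_)
    rw [nsmul_add, nsmul_add, ← mul_nsmul, coe_add, coe_nsmul, ← add_assoc, ← add_assoc, add_assoc]
    refine Set.add_subset_add (Set.add_subset_add_left ?_) ?_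
    · exact Set.nsmul_subset_nsmul_right h0 (by linarith)
    · refine (Set.add_subset_add_right (nsmul_closedBall_subset g _)).trans ?_
      rintro _ ⟨a, ha, b, hb, rfl⟩
      rw [mem_closedBall_zero_iff] at ha hb ⊢
      have h2g : (2 : ℝ) * g ≤ K ^ (2 * g) := by
        calc (2 : ℝ) * g = ((2 * g : ℕ) : ℝ) := by push_cast; ring
          _ ≤ ((2 ^ (2 * g) : ℕ) : ℝ) := Nat.cast_le.2 Nat.lt_two_pow_self.le
          _ = 2 ^ (2 * g) := by push_cast; ring
          _ ≤ K ^ (2 * g) := by gcongr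
      calc ‖a + b‖ ≤ g * (2 * r) + ‖f‖ * r := (norm_add_le _ _).trans (add_le_add ha hb)
        _ ≤ (K ^ (2 * g) + K ^ l) * r := by nlinarith
        _ ≤ (K ^ (2 * g + l) + K ^ (2 * g + l)) * r := by
            gcongr
            · omega
            · omega
        _ = 2 * (K ^ (2 * g + l) * r) := by ring
        _ ≤ K * (K ^ (2 * g + l) * r) := by gcongr
        _ = K ^ (3 * g + l + 1) * δ := by
            rw [hr]
            ring
        _ ≤ _ := by
            gcongr
            nlinarith

lemma isRuzsaBounded_polySet (l : ℕ) : ∃ G : ℕ, ∀ {n : ℕ} {A : Set (Op n)} {X : Set (Vec n)}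
    {δ K : ℝ}, 0 < δ → 2 ≤ K → X.Nonempty → A ⊆ closedBall 0 K →
    (∀ a ∈ A, IsRuzsaBounded X δ K 2 a) → ∀ f ∈ polySet A l, IsRuzsaBounded X δ K G f := by
  induction l with
  | zero =>
    refine ⟨2, fun {n A X δ K} hδ hK hX _ hbd f hf => ?_⟩
    have hK2 : (1 : ℝ) ≤ K ^ 2 := one_le_pow₀ (by linarith)
    obtain ⟨x, hx⟩ := hX
    have h0 : (0 : Vec n) ∈ X - X := ⟨x, hx, x, hx, sub_self x⟩
    have hb : (0 : Vec n) ∈ closedBall (0 : Vec n) (K ^ 2 * δ) := mem_closedBall_self (by positivity)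
    rcases hf with hf | rfl | rfl
    · exact hbd f hf
    · refine ⟨{0}, by simpa using hK2, ?_⟩
      rintro _ ⟨y, hy, rfl⟩
      refine ⟨_, ⟨0, by simp, 0, Set.zero_mem_nsmul h0, rfl⟩, 0, hb, by simp⟩
    · refine ⟨{x}, by simpa using hK2, ?_⟩
      rintro _ ⟨y, hy, rfl⟩
      refine ⟨_, ⟨x, by simp, y - x, ?_, rfl⟩, 0, hb, by simp⟩
      rw [two_nsmul]
      exact ⟨y - x, ⟨y, hy, x, hx, rfl⟩, 0, h0, add_zero _⟩
  | succ l ih =>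
    obtain ⟨G, hG⟩ := ih
    refine ⟨2 * G * G + 3 * G + 2 ^ l + 1, fun {n A X δ K} hδ hK hX hA hbd f hf => ?_⟩
    have hK1 : 1 ≤ K := by linarith
    obtain ⟨p, hp, q, hq, h⟩ := hf
    have hp' := hG hδ hK hX hA hbd p hp
    have hq' := hG hδ hK hX hA hbd q hq
    have hle : 2 * G + 1 ≤ 2 * G * G + 3 * G + 2 ^ l + 1 := by nlinarith [Nat.zero_le (2 ^ l)]
    rcases h with rfl | rfl | rfl
    · exact (hp'.add hq' hδ hK hX).mono hX hδ hK1 hle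
    · rw [sub_eq_add_neg]
      exact (hp'.add hq'.neg hδ hK hX).mono hX hδ hK1 hle
    · exact hp'.mul hq' hδ hK hX (norm_le_of_mem_polySet hK (norm_one_op_le n) hA l p hp)

end RuzsaBounded

end LinearGrowth

namespace LinearGrowth
open Finset Module Metric

variable {n : ℕ}

open scoped Pointwise

/-- The grid of mesh `s` in `ℝⁿ`. -/
def grid (n : ℕ) (s : ℝ) : AddSubgroup (Vec n) where
  carrier := {x | ∀ i, ∃ z : ℤ, x i = s * z}
  zero_mem' := fun _ => ⟨0, by simp⟩
  add_mem' := fun {x y} hx hy i => by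
    obtain ⟨z, hz⟩ := hx i
    obtain ⟨w, hw⟩ := hy i
    exact ⟨z + w, by rw [PiLp.add_apply, hz, hw]; push_cast; ring⟩
  neg_mem' := fun {x} hx i => by
    obtain ⟨z, hz⟩ := hx i
    exact ⟨-z, by rw [PiLp.neg_apply, hz]; push_cast; ring⟩

lemma le_dist_of_mem_grid {s : ℝ} (hs : 0 < s) {x y : Vec n} (hx : x ∈ grid n s)
    (hy : y ∈ grid n s) (hxy : x ≠ y) : s ≤ dist x y := by
  obtain ⟨i, hi⟩ : ∃ i, (x - y) i ≠ 0 := by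
    by_contra! h
    exact hxy (sub_eq_zero.1 (PiLp.ext h))
  obtain ⟨z, hz⟩ := (grid n s).sub_mem hx hy i
  have hz0 : z ≠ 0 := by
    rintro rfl
    simp [hz] at hi
  have h1 : (1 : ℝ) ≤ |(z : ℝ)| := by exact_mod_cast Int.one_le_abs hz0
  rw [dist_eq_norm]
  refine le_trans ?_ (PiLp.norm_apply_le (x - y) i)
  rw [hz, norm_mul, Real.norm_of_nonneg hs.le, Real.norm_eq_abs]
  nlinarith

lemma card_le_of_subset_grid {s R : ℝ} (hs : 0 < s) (hR : 0 ≤ R) {Q C : Finset (Vec n)}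
    (hQ : (Q : Set (Vec n)) ⊆ grid n s) (hC : ∀ q ∈ Q, ∃ c ∈ C, dist q c ≤ R) :
    (#Q : ℝ) ≤ #C * (4 * R / s + 1) ^ n := by
  classical
  choose! φ hφ hφd using hC
  have hfib : ∀ c ∈ C, (#{q ∈ Q | φ q = c} : ℝ) ≤ (4 * R / s + 1) ^ n := by
    intro c _
    have hcard : #{q ∈ Q | φ q = c} = #(({q ∈ Q | φ q = c}).image fun q => q - c) :=
      (card_image_of_injective _ (sub_left_injective)).symm
    rw [hcard]
    have h := card_mul_pow_le_of_separated (ρ := s / 2) (R := R)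
      (T := ({q ∈ Q | φ q = c}).image fun q => q - c) (by positivity) hR (fun u hu => by
        obtain ⟨q, hq, rfl⟩ := mem_image.1 hu
        obtain ⟨hqQ, rfl⟩ := mem_filter.1 hq
        rw [← dist_eq_norm]
        exact hφd q hqQ) (fun u hu v hv huv => by
        obtain ⟨q, hq, rfl⟩ := mem_image.1 hu
        obtain ⟨r, hr, rfl⟩ := mem_image.1 hv
        rw [dist_sub_right]
        have := le_dist_of_mem_grid hs (hQ (mem_filter.1 hq).1) (hQ (mem_filter.1 hr).1)
          (fun h => huv (by rw [h]))
        linarith)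
    rw [finrank_euclideanSpace_fin] at h
    refine le_of_mul_le_mul_right (h.trans (le_of_eq ?_)) (by positivity : 0 < (s / 2 / 2) ^ n)
    rw [← mul_pow]
    congr 1
    field_simp
    ring
  rw [card_eq_sum_card_fiberwise hφ]
  push_cast
  exact (sum_le_sum hfib).trans (le_of_eq (by rw [sum_const, nsmul_eq_mul]))

lemma exists_grid_approx {s : ℝ} (hs : 0 < s) {X : Set (Vec n)} (hX : Bornology.IsBounded X) :
    ∃ P : Finset (Vec n), (P : Set (Vec n)) ⊆ grid n s ∧ (∀ x ∈ X, ∃ p ∈ P, dist x p ≤ n * s) ∧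
      ∀ p ∈ P, ∃ x ∈ X, dist p x ≤ n * s := by
  obtain ⟨B, hB⟩ := hX.subset_closedBall 0
  let φ : Vec n → Fin n → ℤ := fun x i => ⌊x i / s⌋
  let ψ : (Fin n → ℤ) → Vec n := fun z => WithLp.toLp 2 fun i => s * z i
  have hfin : (φ '' X).Finite := by
    refine (Fintype.piFinset fun _ : Fin n => Icc ⌊-B / s⌋ ⌊B / s⌋).finite_toSet.subset ?_
    rintro _ ⟨x, hx, rfl⟩
    refine mem_coe.2 (Fintype.mem_piFinset.2 fun i => mem_Icc.2 ?_)
    have h := abs_le.1 ((PiLp.norm_apply_le x i).trans (mem_closedBall_zero_iff.1 (hB hx)))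
    constructor
    · exact Int.floor_mono (by gcongr; exact h.1)
    · exact Int.floor_mono (by gcongr; exact h.2)
  have hdist : ∀ x, dist x (ψ (φ x)) ≤ n * s := by
    intro x
    rw [dist_eq_norm]
    refine abs_le_of_sq_le_sq' ?_ (by positivity) |>.2
    rw [EuclideanSpace.norm_sq_eq]
    calc ∑ i, ‖(x - ψ (φ x)) i‖ ^ 2 ≤ ∑ _i : Fin n, s ^ 2 := by
          refine sum_le_sum fun i _ => ?_
          have h1 : (x - ψ (φ x)) i = x i - s * ⌊x i / s⌋ := rfl
          have h2 := Int.floor_le (x i / s)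
          have h3 := Int.lt_floor_add_one (x i / s)
          rw [le_div_iff₀ hs] at h2
          rw [div_lt_iff₀ hs] at h3
          rw [h1, Real.norm_of_nonneg (by linarith)]
          exact pow_le_pow_left₀ (by linarith) (by linarith) 2
      _ = n * s ^ 2 := by simp
      _ ≤ (n * s) ^ 2 := by
          rw [mul_pow]
          gcongr
          exact_mod_cast Nat.le_self_pow two_ne_zero n
  classical
  refine ⟨hfin.toFinset.image ψ, ?_, fun x hx => ⟨ψ (φ x), ?_, hdist x⟩, ?_⟩
  · intro p hp
    obtain ⟨z, -, rfl⟩ := mem_image.1 (mem_coe.1 hp)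
    exact fun i => ⟨z i, rfl⟩
  · exact mem_image_of_mem _ (hfin.mem_toFinset.2 ⟨x, hx, rfl⟩)
  · intro p hp
    obtain ⟨z, hz, rfl⟩ := mem_image.1 hp
    obtain ⟨x, hx, rfl⟩ := hfin.mem_toFinset.1 hz
    exact ⟨x, hx, by rw [dist_comm]; exact hdist x⟩

lemma exists_cover_card_le_covNum {δ : ℝ} (hδ : 0 < δ) {X : Set (Vec n)}
    (hX : Bornology.IsBounded X) :
    ∃ C : Finset (Vec n), #C ≤ covNum δ X ∧ ∀ x ∈ X, ∃ c ∈ C, dist x c ≤ δ := by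
  have hne : {N : ℕ | ∃ F : Finset (Vec n), F.card ≤ N ∧ X ⊆ ⋃ x ∈ F, closedBall x δ}.Nonempty := by
    obtain ⟨P, -, hP, -⟩ := exists_grid_approx (s := δ / (n + 1)) (by positivity) hX
    refine ⟨#P, P, le_rfl, fun x hx => ?_⟩
    obtain ⟨p, hp, hxp⟩ := hP x hx
    refine Set.mem_biUnion hp (mem_closedBall.2 (hxp.trans ?_))
    rw [mul_div_assoc', div_le_iff₀ (by positivity)]
    linarith
  obtain ⟨F, hF, hXF⟩ := Nat.sInf_mem hne
  refine ⟨F, hF, fun x hx => ?_⟩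
  simpa using hXF hx

lemma covNum_le_card {δ : ℝ} {X : Set (Vec n)} {C : Finset (Vec n)}
    (h : ∀ x ∈ X, ∃ c ∈ C, dist x c ≤ δ) : covNum δ X ≤ #C :=
  Nat.sInf_le ⟨C, le_rfl, fun x hx => by simpa using h x hx⟩

end LinearGrowth

namespace LinearGrowth
open Finset Module Metric

variable {n : ℕ}

open scoped Pointwise

lemma card_add_le_covNum_mul (hn : 0 < n) {δ : ℝ} (hδ : 0 < δ) {X Y : Set (Vec n)}
    (hX : Bornology.IsBounded X) (hY : Bornology.IsBounded Y) {P Q : Finset (Vec n)}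
    (hP : (P : Set (Vec n)) ⊆ grid n (δ / n)) (hQ : (Q : Set (Vec n)) ⊆ grid n (δ / n))
    (hPX : ∀ p ∈ P, ∃ x ∈ X, dist p x ≤ δ) (hQY : ∀ q ∈ Q, ∃ y ∈ Y, dist q y ≤ δ) :
    (#(P + Q) : ℝ) ≤ covNum δ (X + Y) * (12 * n + 1) ^ n := by
  have hn' : (0 : ℝ) < n := Nat.cast_pos.2 hn
  obtain ⟨C, hC, hcov⟩ := exists_cover_card_le_covNum hδ (hX.add hY)
  have h := card_le_of_subset_grid (s := δ / n) (R := 3 * δ) (Q := P + Q) (C := C)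
    (by positivity) (by positivity) (by
      rintro _ hu
      obtain ⟨p, hp, q, hq, rfl⟩ := mem_add.1 (mem_coe.1 hu)
      exact (grid n (δ / n)).add_mem (hP hp) (hQ hq)) (by
      intro u hu
      obtain ⟨p, hp, q, hq, rfl⟩ := mem_add.1 hu
      obtain ⟨x, hx, hpx⟩ := hPX p hp
      obtain ⟨y, hy, hqy⟩ := hQY q hq
      obtain ⟨c, hc, hxc⟩ := hcov (x + y) ⟨x, hx, y, hy, rfl⟩
      refine ⟨c, hc, (dist_triangle _ (x + y) _).trans ?_⟩
      linarith [dist_add_add_le p q x y])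
  have he : 4 * (3 * δ) / (δ / n) + 1 = 12 * n + 1 := by
    field_simp
    ring
  rw [he] at h
  refine h.trans ?_
  gcongr

lemma exists_cover_closedBall (hn : 0 < n) {δ R : ℝ} (hδ : 0 < δ) (hR : 0 ≤ R) :
    ∃ U : Finset (Vec n), (#U : ℝ) ≤ (4 * n * (R + 1) + 1) ^ n ∧
      ∀ x : Vec n, ‖x‖ ≤ R * δ → ∃ u ∈ U, dist x u ≤ δ := by
  have hn' : (0 : ℝ) < n := Nat.cast_pos.2 hn
  have hs : (n : ℝ) * (δ / n) = δ := by field_simp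
  obtain ⟨U, hU, hcov, hnear⟩ := exists_grid_approx (s := δ / n) (by positivity)
    (isBounded_closedBall (x := (0 : Vec n)) (r := R * δ))
  rw [hs] at hcov hnear
  refine ⟨U, ?_, fun x hx => hcov x (mem_closedBall_zero_iff.2 hx)⟩
  have h := card_le_of_subset_grid (s := δ / n) (R := (R + 1) * δ) (C := {0}) (by positivity)
    (by positivity) hU (fun u hu => ⟨0, mem_singleton_self 0, by
      obtain ⟨x, hx, hux⟩ := hnear u hu
      refine (dist_triangle _ x _).trans ?_
      have := mem_closedBall.1 hx
      linarith⟩)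
  refine h.trans (le_of_eq ?_)
  rw [card_singleton, Nat.cast_one, one_mul]
  congr 1
  field_simp

/-- If `X + X` and all `X + a X` with `a ∈ A` are not much larger than `X`, then neither are
the sets `X + f X` with `f` in the ring generated by `A`. -/
theorem exists_cover_add_image (hn : 0 < n) (l : ℕ) : ∃ (G : ℕ) (K₀ : ℝ),
    ∀ {A : Set (Op n)} {X : Set (Vec n)} {δ K : ℝ}, 0 < δ → K₀ ≤ K → X.Nonempty →
    Bornology.IsBounded X → A ⊆ closedBall 0 K →
    (covNum δ (X + X) : ℝ) ≤ K * covNum δ X →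
    (∀ a ∈ A, (covNum δ (X + (fun x => a x) '' X) : ℝ) ≤ K * covNum δ X) →
    ∀ f ∈ polySet A l, ∃ C : Finset (Vec n), (#C : ℝ) ≤ K ^ G * covNum δ X ∧
      ∀ x ∈ X, ∀ y ∈ X, ∃ c ∈ C, dist (x + f y) c ≤ δ := by
  obtain ⟨g, hg⟩ := isRuzsaBounded_polySet l
  refine ⟨g + (n * (2 * g + 3) + (2 * (2 * g + 1) + 1)), (12 * n + 1) ^ n + (4 * n + 1) + 3, ?_⟩
  intro A X δ K hδ hK hX hXb hA hXX hXA f hf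
  have hn' : (0 : ℝ) < n := Nat.cast_pos.2 hn
  have hn1 : (1 : ℝ) ≤ n := by exact_mod_cast hn
  have hs : (n : ℝ) * (δ / n) = δ := by field_simp
  have hpow : (0 : ℝ) ≤ (12 * n + 1) ^ n := by positivity
  have hKn : ((12 : ℝ) * n + 1) ^ n ≤ K := by linarith
  have hK2 : 2 ≤ K := by linarith
  have hK1 : 1 ≤ K := by linarith
  have hK3 : 3 ≤ K := by linarith
  have hK4 : 4 * (n : ℝ) + 1 ≤ K := by linarith
  obtain ⟨P, hPg, hXP, hPX⟩ := exists_grid_approx (s := δ / n) (by positivity) hXb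
  rw [hs] at hXP hPX
  have hNP : (covNum δ X : ℝ) ≤ #P := Nat.cast_le.2 (covNum_le_card hXP)
  have hPne : P.Nonempty := by
    obtain ⟨x, hx⟩ := hX
    obtain ⟨p, hp, -⟩ := hXP x hx
    exact ⟨p, hp⟩
  have hsum : ∀ {Y : Set (Vec n)} {Q : Finset (Vec n)}, Bornology.IsBounded Y →
      (Q : Set (Vec n)) ⊆ grid n (δ / n) → (∀ q ∈ Q, ∃ y ∈ Y, dist q y ≤ δ) →
      (covNum δ (X + Y) : ℝ) ≤ K * covNum δ X → (#(P + Q) : ℝ) ≤ K ^ 2 * #P := by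
    intro Y Q hYb hQg hQY hle
    calc (#(P + Q) : ℝ) ≤ covNum δ (X + Y) * (12 * n + 1) ^ n :=
          card_add_le_covNum_mul hn hδ hXb hYb hPg hQg hPX hQY
      _ ≤ (K * #P) * K := mul_le_mul (hle.trans (by gcongr)) hKn hpow (by positivity)
      _ = K ^ 2 * #P := by ring
  have hPP : (#(P + P) : ℝ) ≤ K ^ 2 * #P := hsum hXb hPg hPX hXX
  have hbd : ∀ a ∈ A, IsRuzsaBounded X δ K 2 a := by
    intro a ha
    have hYb : Bornology.IsBounded ((fun x => a x) '' X) := a.lipschitz.isBounded_image hXb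
    obtain ⟨Q, hQg, hYQ, hQY⟩ := exists_grid_approx (s := δ / n) (by positivity) hYb
    rw [hs] at hYQ hQY
    have hPQ := hsum hYb hQg hQY (hXA a ha)
    rw [add_comm] at hPQ
    obtain ⟨Φ, -, hΦ, hQΦ⟩ := ruzsa_covering_add hPne hPQ
    refine ⟨Φ, hΦ, ?_⟩
    rintro _ ⟨x, hx, rfl⟩
    obtain ⟨q, hq, hxq⟩ := hYQ (a x) ⟨x, hx, rfl⟩
    obtain ⟨φ, hφ, d, hd, hφd⟩ := mem_add.1 (hQΦ hq)
    obtain ⟨p, hp, p', hp', hpp⟩ := mem_sub.1 hd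
    obtain ⟨y, hy, hpy⟩ := hPX p hp
    obtain ⟨z, hz, hpz⟩ := hPX p' hp'
    refine ⟨φ + (y - z), ⟨φ, hφ, y - z, ?_, rfl⟩, a x - (φ + (y - z)), ?_, by simp⟩
    · rw [two_nsmul]
      exact ⟨y - z, ⟨y, hy, z, hz, rfl⟩, 0, ⟨y, hy, y, hy, sub_self y⟩, add_zero _⟩
    · rw [mem_closedBall_zero_iff]
      have h1 : a x - (φ + (y - z)) = (a x - q) + ((p - y) - (p' - z)) := by
        rw [← hφd, ← hpp]
        abel
      rw [h1]
      refine (norm_add_le _ _).trans ?_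
      have h2 := norm_sub_le (p - y) (p' - z)
      have h3 : 3 * δ ≤ K ^ 2 * δ := by
        gcongr
        nlinarith
      have h4 : ‖a x - q‖ ≤ δ := by rw [← dist_eq_norm]; exact hxq
      rw [dist_eq_norm] at hpy hpz
      linarith
  obtain ⟨Φ, hΦ, hfΦ⟩ := hg hδ hK2 hX hA hbd f hf
  set R : ℝ := K ^ g + (2 * g + 1) with hR
  have hR0 : 0 ≤ R := by positivity
  obtain ⟨U, hU, hcovU⟩ := exists_cover_closedBall (n := n) hn hδ hR0
  have hpl : (#((g + 1) • P - g • P) : ℝ) ≤ (K ^ 2) ^ (2 * g + 1) * #P := by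
    have h1 := pluennecke_ruzsa_inequality_nsmul_sub_nsmul_add hPne P (g + 1) g
    have h2 : (#((g + 1) • P - g • P) : ℝ) ≤ ((#(P + P) : ℝ) / #P) ^ (g + 1 + g) * #P := by
      have h2 := (NNRat.cast_le (K := ℝ)).2 h1
      push_cast at h2
      exact h2
    have hP0 : (0 : ℝ) < #P := Nat.cast_pos.2 hPne.card_pos
    have h3 : (#(P + P) : ℝ) / #P ≤ K ^ 2 := (div_le_iff₀ hP0).2 hPP
    refine h2.trans ?_
    rw [show g + 1 + g = 2 * g + 1 by ring]
    gcongr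
  have hPN : (#P : ℝ) ≤ K * covNum δ X := by
    obtain ⟨C, hC, hcov⟩ := exists_cover_card_le_covNum hδ hXb
    have h := card_le_of_subset_grid (s := δ / n) (R := 2 * δ) (C := C) (by positivity)
      (by positivity) hPg (fun p hp => by
        obtain ⟨x, hx, hpx⟩ := hPX p hp
        obtain ⟨c, hc, hxc⟩ := hcov x hx
        exact ⟨c, hc, (dist_triangle _ x _).trans (by linarith)⟩)
    have he : 4 * (2 * δ) / (δ / n) + 1 = 8 * n + 1 := by
      field_simp
      ring
    rw [he] at h
    calc (#P : ℝ) ≤ #C * (8 * n + 1) ^ n := h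
      _ ≤ covNum δ X * K := by
        refine mul_le_mul (Nat.cast_le.2 hC) (le_trans ?_ hKn) (by positivity) (by positivity)
        gcongr
        norm_num
      _ = _ := mul_comm _ _
  have hRK : 4 * n * (R + 1) + 1 ≤ K ^ (2 * g + 3) := by
    have h2g : (2 : ℝ) * g + 2 ≤ K ^ (2 * g + 1) := by
      calc (2 : ℝ) * g + 2 = ((2 * g + 1 + 1 : ℕ) : ℝ) := by push_cast; ring
        _ ≤ ((2 ^ (2 * g + 1) : ℕ) : ℝ) := Nat.cast_le.2 Nat.lt_two_pow_self
        _ = 2 ^ (2 * g + 1) := by push_cast; ring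
        _ ≤ K ^ (2 * g + 1) := by gcongr
    have h3 : K ^ g ≤ K ^ (2 * g + 1) := pow_le_pow_right₀ hK1 (by omega)
    have h4 : R + 1 ≤ K ^ (2 * g + 2) := by
      rw [pow_succ]
      have : 0 ≤ K ^ (2 * g + 1) := by positivity
      nlinarith
    have h5 : 1 ≤ K ^ (2 * g + 2) := one_le_pow₀ hK1
    calc 4 * n * (R + 1) + 1 ≤ 4 * n * K ^ (2 * g + 2) + K ^ (2 * g + 2) := by gcongr
      _ = (4 * n + 1) * K ^ (2 * g + 2) := by ring
      _ ≤ K * K ^ (2 * g + 2) := by gcongr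
      _ = K ^ (2 * g + 3) := by ring
  refine ⟨Φ + ((g + 1) • P - g • P) + U, ?_, ?_⟩
  · calc (#(Φ + ((g + 1) • P - g • P) + U) : ℝ) ≤ #Φ * #((g + 1) • P - g • P) * #U := by
          exact_mod_cast card_add_le.trans (Nat.mul_le_mul_right _ card_add_le)
      _ ≤ K ^ g * ((K ^ 2) ^ (2 * g + 1) * (K * covNum δ X)) * (K ^ (2 * g + 3)) ^ n := by
          refine mul_le_mul (mul_le_mul hΦ (hpl.trans ?_) (Nat.cast_nonneg _) (by positivity))
            (hU.trans (pow_le_pow_left₀ (by positivity) hRK n)) (Nat.cast_nonneg _) (by positivity)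
          gcongr
      _ = K ^ (g + (n * (2 * g + 3) + (2 * (2 * g + 1) + 1))) * covNum δ X := by
          rw [← pow_mul, ← pow_mul]
          ring
  · intro x hx y hy
    obtain ⟨_, ⟨φ, hφ, d, hd, rfl⟩, b, hb, hfy⟩ := hfΦ ⟨y, hy, rfl⟩
    obtain ⟨p, hp, hxp⟩ := hXP x hx
    have hXX' : X - X ⊆ ((P - P : Finset (Vec n)) : Set (Vec n)) + closedBall 0 (2 * δ) := by
      rintro _ ⟨u, hu, v, hv, rfl⟩
      obtain ⟨p, hp, hup⟩ := hXP u hu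
      obtain ⟨q, hq, hvq⟩ := hXP v hv
      refine ⟨p - q, mem_coe.2 (sub_mem_sub hp hq), (u - p) - (v - q), ?_, ?_⟩
      · rw [mem_closedBall_zero_iff]
        rw [dist_eq_norm] at hup hvq
        linarith [norm_sub_le (u - p) (v - q)]
      · exact show p - q + ((u - p) - (v - q)) = u - v by abel
    have hgXX : g • (X - X) ⊆ ((g • (P - P) : Finset (Vec n)) : Set (Vec n)) +
        closedBall 0 (g * (2 * δ)) := by
      refine (Set.nsmul_subset_nsmul_left hXX').trans ?_
      rw [nsmul_add, coe_nsmul]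
      exact Set.add_subset_add_left (nsmul_closedBall_subset g _)
    obtain ⟨w, hw, e, he, hwe⟩ := hgXX hd
    have hpw : p + w ∈ (g + 1) • P - g • P := by
      rw [mem_coe] at hw
      rw [sub_eq_add_neg, nsmul_add, neg_nsmul, ← sub_eq_add_neg] at hw
      rw [succ_nsmul', add_sub_assoc]
      exact add_mem_add hp hw
    have hnorm : ‖(x - p) + e + b‖ ≤ R * δ := by
      rw [mem_closedBall_zero_iff] at he hb
      rw [dist_eq_norm] at hxp
      have h1 := norm_add₃_le (a := x - p) (b := e) (c := b)
      rw [hR]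
      linarith
    obtain ⟨u, hu, hdu⟩ := hcovU _ hnorm
    refine ⟨φ + (p + w) + u, add_mem_add (add_mem_add hφ hpw) hu, ?_⟩
    refine le_trans (le_of_eq ?_) hdu
    have hfy' : f y = φ + (w + e) + b := by
      rw [← hfy]
      simp only [← hwe]
    rw [hfy', dist_eq_norm, dist_eq_norm]
    congr 1
    abel

end LinearGrowth

namespace LinearGrowth
open Finset Module Metric

variable {n : ℕ}

open scoped Pointwise

lemma exists_richFrame (hn : 0 < n) (k : ℕ) : ∃ (C : ℕ) (K₀ : ℝ), ∀ {K H : ℝ}, K₀ ≤ K → K ≤ H →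
    K ^ C ≤ H → ∀ {A : Set (Op n)}, A ⊆ closedBall 0 K → ActsIrreducibly K⁻¹ A →
    H ^ (4 * (n * n)) < covNum (H ^ k)⁻¹ A →
    ∃ (g : Fin (n * n) → Op n) (T : Finset (Op n)), RichFrame A H n (n * n) k g T := by
  obtain ⟨C, K₀, hC⟩ := exists_frame hn
  refine ⟨C, max K₀ 1, fun {K H} hK hKH hKC A hA hirr hcov => ?_⟩
  have hH : 0 < H := lt_of_lt_of_le one_pos (((le_max_right _ _).trans hK).trans hKH)
  obtain ⟨g, hg⟩ := hC K ((le_max_left _ _).trans hK) A hA hirr H hKC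
  obtain ⟨T, hTA, hT, hsep⟩ := exists_separated_of_le_covNum (ρ := (H ^ k)⁻¹) (by positivity)
    (le_refl (covNum (H ^ k)⁻¹ A))
  refine ⟨g, T, { hg with
    sub := hTA
    bound := fun a ha => (mem_closedBall_zero_iff.1 (hA (hTA ha))).trans hKH
    sep := fun a ha b hb hab => ?_
    card := by rwa [hT]
    le_card := le_rfl
    pos_dim := hn }⟩
  rw [← dist_eq_norm, ← inv_lt_iff_one_lt_mul₀' (by positivity)]
  exact hsep a ha b hb hab

lemma RichFrame.exists_isSpread_polySet (hn : 0 < n) (k N e : ℕ) (he : 0 < e) :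
    ∃ (S e₂ : ℕ) (H₀ : ℝ), ∀ q : ℕ, ∃ S' : ℕ, ∀ {A : Set (Op n)} {H : ℝ} {g : Fin N → Op n}
    {T : Finset (Op n)}, RichFrame A H n N k g T → H₀ ≤ H → (∀ p ∈ polySet A S, ‖p‖ ≤ H) →
    IsSpread (polySet A S') (H ^ 6 / (H ^ e₂ * (H ^ e) ^ (q + 1)))
      ((H ^ (k + 17) / H ^ e) ^ (n * (q + 1))) := by
  obtain ⟨S, e₂, H₀, hseg⟩ := RichFrame.exists_isSegment hn k n N (e + 7)
  refine ⟨S, e₂, max H₀ (max (3 ^ (N * N)) (7 * n)), fun q => ?_⟩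
  obtain ⟨S', hS'⟩ := RichFrame.exists_isSpread hn k n N S e q he
  refine ⟨S', fun {A H g T} F hH hnorm => ?_⟩
  obtain ⟨v, hv, hve, hvs⟩ := hseg F ((le_max_left _ _).trans hH) hnorm
  have hH3 : (3 : ℝ) ^ (N * N) ≤ H := ((le_max_left _ _).trans (le_max_right _ _)).trans hH
  have hH0 : 0 < H := lt_of_lt_of_le (by positivity) hH3
  have hv0 : 0 < ‖v‖ := by
    by_contra! h
    have : H ^ e₂ * ‖v‖ ≤ 0 := mul_nonpos_of_nonneg_of_nonpos (by positivity) h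
    linarith
  refine (hS' F hH3 (((le_max_right _ _).trans (le_max_right _ _)).trans hH) v hv hv0
    hvs).mono le_rfl ?_ le_rfl
  rw [div_le_div_iff₀ (by positivity) (by positivity)]
  calc H ^ 6 * (H ^ e) ^ (q + 1) = H ^ 6 * (H ^ e) ^ (q + 1) * 1 := (mul_one _).symm
    _ ≤ H ^ 6 * (H ^ e) ^ (q + 1) * (H ^ e₂ * ‖v‖) := by gcongr
    _ = H ^ 6 * ‖v‖ * (H ^ e₂ * (H ^ e) ^ (q + 1)) := by ring

/-- The contradiction between a spread family and small sums: `X` cannot be both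
non-concentrated at scale `r` and nearly stable under a family spread at scale `δ / r`. -/
lemma two_inv_lt_of_isSpread {P : Set (Op n)} {X : Set (Vec n)} {δ r θ L : ℝ} (hδ : 0 < δ)
    (hr : 0 < r) (hθ : 0 ≤ θ) (hL : 0 ≤ L) (hP : IsSpread P (2 * δ / r) θ)
    (hX : 0 < covNum δ X) (hXr : 2 * 5 ^ n * L < covNum r X)
    (hcov : ∀ f ∈ P, ∃ C : Finset (Vec n), (#C : ℝ) ≤ L * covNum δ X ∧
      ∀ x ∈ X, ∀ y ∈ X, ∃ c ∈ C, dist (x + f y) c ≤ δ) :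
    2⁻¹ < L * (θ * covNum δ X) := by
  obtain ⟨X₁, hX₁, hc₁, hs₁⟩ := exists_separated_of_le_covNum hr.le (le_refl (covNum r X))
  obtain ⟨X₂, hX₂, hc₂, hs₂⟩ := exists_separated_of_le_covNum hδ.le (le_refl (covNum δ X))
  have h := IsSpread.card_mul_card_le (M := ⌊L * covNum δ X⌋₊) hδ hr hθ hP X₁ X₂ hs₁ hs₂
    (fun f hf => by
      obtain ⟨C, hC, hCc⟩ := hcov f hf
      exact ⟨C, Nat.le_floor hC, fun a ha b hb => hCc a (hX₂ ha) b (hX₁ hb)⟩)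
  rw [hc₁, hc₂] at h
  have hN : (0 : ℝ) < covNum δ X := Nat.cast_pos.2 hX
  have hN₁ : (0 : ℝ) < covNum r X := lt_of_le_of_lt (by positivity) hXr
  have hM : (⌊L * covNum δ X⌋₊ : ℝ) ≤ L * covNum δ X := Nat.floor_le (by positivity)
  have h1 : (covNum r X * covNum δ X : ℝ) ≤
      L * covNum δ X * (5 ^ n + θ * (covNum r X * covNum δ X)) :=
    h.trans (by gcongr)
  have h2 : (covNum r X : ℝ) ≤ L * (5 ^ n + θ * (covNum r X * covNum δ X)) :=
    le_of_mul_le_mul_right (h1.trans (le_of_eq (by ring))) hN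
  by_contra! hle
  have h3 : L * (θ * covNum δ X) * covNum r X ≤ 2⁻¹ * covNum r X := by gcongr
  nlinarith

lemma rpow_neg_pow {δ : ℝ} (hδ : 0 < δ) (a : ℝ) (m : ℕ) : (δ ^ (-a)) ^ m = δ ^ (-(a * m)) := by
  rw [← Real.rpow_natCast, ← Real.rpow_mul hδ.le, neg_mul]

lemma rpow_neg_le {δ a b : ℝ} (hδ : 0 < δ) (hδ1 : δ ≤ 1) (hab : a ≤ b) : δ ^ (-a) ≤ δ ^ (-b) :=
  Real.rpow_le_rpow_of_exponent_ge hδ hδ1 (neg_le_neg hab)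

lemma exists_forall_le_rpow_neg (c : ℝ) {a : ℝ} (ha : 0 < a) :
    ∃ δ₀ : ℝ, 0 < δ₀ ∧ ∀ δ : ℝ, 0 < δ → δ < δ₀ → c ≤ δ ^ (-a) := by
  have h := (tendsto_rpow_neg_nhdsGT_zero (neg_lt_zero.2 ha)).eventually_ge_atTop c
  obtain ⟨u, hu, hsub⟩ := mem_nhdsGT_iff_exists_Ioo_subset.1 h
  exact ⟨u, hu, fun δ h0 h1 => hsub ⟨h0, h1⟩⟩

end LinearGrowth

open LinearGrowth in
set_option maxHeartbeats 1000000 in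
/-- **Theorem 1.3** (growth under linear actions): if the family `A ⊆ End(ℝⁿ)` is
non-concentrated and acts `δ^ε`-irreducibly, and `X ⊆ ℝⁿ` is non-concentrated and not too
large, then `N_δ(X + X) + max_{a ∈ A} N_δ(X + aX) ≥ δ^{-ε} N_δ(X)`. -/
theorem growth_under_linear_action (n : ℕ) (hn : 0 < n)
    (κ : ℝ) (hκ : 0 < κ) (σ : ℝ) (hσ : σ < (n : ℝ)) :
    ∃ ε : ℝ, 0 < ε ∧ ∃ δ₀ : ℝ, 0 < δ₀ ∧ ∀ δ : ℝ, 0 < δ → δ < δ₀ →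
      ∀ (A : Set (EuclideanSpace ℝ (Fin n) →L[ℝ] EuclideanSpace ℝ (Fin n)))
        (X : Set (EuclideanSpace ℝ (Fin n))),
        A ⊆ Metric.closedBall 0 (δ ^ (-ε)) →
        (∀ ρ : ℝ, δ ≤ ρ → δ ^ ε * ρ ^ (-κ) ≤ (covNum ρ A : ℝ)) →
        ActsIrreducibly (δ ^ ε) A →
        X ⊆ Metric.closedBall 0 (δ ^ (-ε)) →
        (∀ ρ : ℝ, δ ≤ ρ → δ ^ ε * ρ ^ (-κ) ≤ (covNum ρ X : ℝ)) →
        (covNum δ X : ℝ) ≤ δ ^ (-(σ + ε)) →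
        (δ ^ (-ε) / 2 * (covNum δ X : ℝ) ≤ (covNum δ (X + X) : ℝ) ∨
          ∃ a ∈ A, δ ^ (-ε) / 2 * (covNum δ X : ℝ) ≤
            (covNum δ (X + (fun x => a x) '' X) : ℝ)) := by
  have hn' : (0 : ℝ) < n := Nat.cast_pos.2 hn
  obtain ⟨γ, hγ⟩ : ∃ γ : ℝ, γ = n - σ := ⟨_, rfl⟩
  have hγ0 : 0 < γ := by linarith
  obtain ⟨μ, hμ0, hμγ, hμ8⟩ : ∃ μ : ℝ, 0 < μ ∧ 8 * (n * μ) ≤ γ ∧ 8 * μ ≤ 1 := by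
    refine ⟨min (γ / (8 * n)) 8⁻¹, lt_min (by positivity) (by norm_num), ?_, ?_⟩
    · rw [← mul_assoc, ← le_div_iff₀' (by positivity)]
      exact min_le_left _ _
    · have := min_le_right (γ / (8 * n)) 8⁻¹
      linarith
  obtain ⟨k, hk⟩ := exists_nat_ge ((4 * (n * n) + 2) / κ)
  rw [div_le_iff₀ hκ] at hk
  obtain ⟨e, he⟩ := exists_nat_ge ((k + 17) / μ)
  rw [div_le_iff₀ hμ0] at he
  have hke : (k : ℝ) + 17 ≤ e := by nlinarith [Nat.cast_nonneg (α := ℝ) e]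
  have he0 : (0 : ℝ) < e := by linarith [Nat.cast_nonneg (α := ℝ) k]
  obtain ⟨S, e₂, H₀, hS⟩ :=
    RichFrame.exists_isSpread_polySet hn k (n * n) e (Nat.cast_pos.1 he0)
  obtain ⟨ε₁, hε₁, hε₁μ⟩ : ∃ ε₁ : ℝ, 0 < ε₁ ∧ ε₁ * (e₂ + e) = μ :=
    ⟨μ / (e₂ + e), by positivity, by field_simp⟩
  have hε₁e₂ : 0 ≤ ε₁ * e₂ := by positivity
  have hε₁e : 0 < ε₁ * e := by positivity
  obtain ⟨q, hq₁, hq₂⟩ : ∃ q : ℕ, ε₁ * e₂ + ε₁ * e * (q + 1) ≤ 1 - μ ∧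
      1 - 2 * μ ≤ ε₁ * e * (q + 1) := by
    have h1 : ε₁ * e ≤ 1 - μ - ε₁ * e₂ := by linarith
    have h2 : 1 ≤ ⌊(1 - μ - ε₁ * e₂) / (ε₁ * e)⌋₊ := by
      rw [Nat.one_le_floor_iff, le_div_iff₀ hε₁e, one_mul]
      exact h1
    obtain ⟨q, hq⟩ := Nat.exists_eq_add_of_le' h2
    have h3 := Nat.floor_le (div_nonneg (hε₁e.le.trans h1) hε₁e.le)
    have h4 := Nat.lt_floor_add_one ((1 - μ - ε₁ * e₂) / (ε₁ * e))
    rw [hq] at h3 h4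
    rw [le_div_iff₀ hε₁e] at h3
    rw [div_lt_iff₀ hε₁e] at h4
    push_cast at h3 h4
    exact ⟨q, by linarith, by linarith⟩
  obtain ⟨S', hS'⟩ := hS q
  obtain ⟨G, K₁, hG⟩ := exists_cover_add_image hn S'
  obtain ⟨C, K₂, hC⟩ := exists_richFrame hn k
  obtain ⟨ε, hε, hεC, hεS, hεε, hεκ, hεγ⟩ : ∃ ε : ℝ, 0 < ε ∧ ε * C ≤ ε₁ ∧
      ε * (2 ^ S : ℕ) ≤ ε₁ ∧ ε ≤ ε₁ ∧ ε * (G + 1) ≤ μ * κ / 2 ∧ ε * (G + 1) ≤ γ / 8 := by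
    set D : ℝ := C + (2 ^ S : ℕ) + (G + 1) with hD
    have h0 : 0 < min ε₁ (min (μ * κ / 2) (γ / 8)) := by positivity
    have hD0 : 0 < D := by positivity
    set ε := min ε₁ (min (μ * κ / 2) (γ / 8)) / D with hε
    have hε0 : 0 < ε := by positivity
    have h1 : ε * D = min ε₁ (min (μ * κ / 2) (γ / 8)) := by
      rw [hε]
      field_simp
    have h2 : ∀ z : ℝ, z ≤ D → ε * z ≤ min ε₁ (min (μ * κ / 2) (γ / 8)) := fun z hz =>
      h1 ▸ (by gcongr)
    have hC0 := Nat.cast_nonneg (α := ℝ) C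
    have hG0 := Nat.cast_nonneg (α := ℝ) G
    have hS0 := Nat.cast_nonneg (α := ℝ) (2 ^ S)
    have hG1 := h2 (G + 1) (by linarith)
    refine ⟨ε, hε0, (h2 _ (by linarith)).trans (min_le_left _ _),
      (h2 _ (by linarith)).trans (min_le_left _ _),
      (mul_one ε).symm.le.trans ((h2 1 (by linarith)).trans (min_le_left _ _)),
      hG1.trans ((min_le_right _ _).trans (min_le_left _ _)),
      hG1.trans ((min_le_right _ _).trans (min_le_right _ _))⟩
  obtain ⟨d₁, hd₁, h₁⟩ := exists_forall_le_rpow_neg (max 2 (max K₁ K₂)) hε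
  obtain ⟨d₂, hd₂, h₂⟩ := exists_forall_le_rpow_neg (max 2 H₀) hε₁
  obtain ⟨d₃, hd₃, h₃⟩ := exists_forall_le_rpow_neg (2 * 5 ^ n + 1)
    (show 0 < μ * κ / 2 by positivity)
  obtain ⟨d₄, hd₄, h₄⟩ := exists_forall_le_rpow_neg 4 (show 0 < γ / 2 by positivity)
  refine ⟨ε, hε, min 1 (min (min d₁ d₂) (min d₃ d₄)), by positivity, ?_⟩
  intro δ hδ hδlt A X hA hAcov hirr hX hXcov hXσ
  simp only [lt_min_iff] at hδlt
  obtain ⟨hδ1, ⟨hδ₁, hδ₂⟩, hδ₃, hδ₄⟩ := hδlt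
  specialize h₁ δ hδ hδ₁
  specialize h₂ δ hδ hδ₂
  specialize h₃ δ hδ hδ₃
  specialize h₄ δ hδ hδ₄
  simp only [max_le_iff] at h₁ h₂
  by_contra! hcon
  obtain ⟨hXX, hXA⟩ := hcon
  set K : ℝ := δ ^ (-ε) with hK
  set H : ℝ := δ ^ (-ε₁) with hH
  have hH0 : 0 < H := by positivity
  have hKH : K ≤ H := rpow_neg_le hδ hδ1.le hεε
  have hδε : δ ^ ε = K⁻¹ := by rw [hK, Real.rpow_neg hδ.le, inv_inv]
  have hN : 0 < covNum δ X := by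
    have h := hXcov δ le_rfl
    exact Nat.cast_pos.1 (lt_of_lt_of_le (by positivity) h)
  have hXne : X.Nonempty := by
    rw [Set.nonempty_iff_ne_empty]
    rintro rfl
    have := covNum_le_card (δ := δ) (X := (∅ : Set (Vec n))) (C := ∅) (by simp)
    simp at this
    omega
  have hXb : Bornology.IsBounded X := Metric.isBounded_closedBall.subset hX
  have hhalf : K / 2 * covNum δ X ≤ K * covNum δ X :=
    mul_le_mul_of_nonneg_right (half_le_self (by linarith [h₁.1])) (Nat.cast_nonneg _)
  have hcovA : H ^ (4 * (n * n)) < covNum (H ^ k)⁻¹ A := by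
    have h1 : (H ^ k)⁻¹ = δ ^ (ε₁ * k) := by
      rw [hH, rpow_neg_pow hδ, Real.rpow_neg hδ.le, inv_inv]
    have h2 : δ ≤ (H ^ k)⁻¹ := by
      rw [h1]
      refine (Real.rpow_one δ).symm.le.trans (Real.rpow_le_rpow_of_exponent_ge hδ hδ1.le ?_)
      have : ε₁ * k ≤ ε₁ * e :=
        mul_le_mul_of_nonneg_left (by linarith) hε₁.le
      linarith
    refine lt_of_lt_of_le ?_ (hAcov _ h2)
    rw [h1, ← Real.rpow_mul hδ.le, ← Real.rpow_add hδ]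
    calc H ^ (4 * (n * n)) < H ^ (4 * (n * n) + 1) := by
          rw [pow_succ]
          exact lt_mul_of_one_lt_right (by positivity) (by linarith [h₂.1])
      _ = δ ^ (-(ε₁ * (4 * (n * n) + 1))) := by
          rw [hH, rpow_neg_pow hδ]
          push_cast
          rfl
      _ ≤ δ ^ (ε + ε₁ * k * -κ) := by
          refine Real.rpow_le_rpow_of_exponent_ge hδ hδ1.le ?_
          have : ε₁ * (4 * (n * n) + 2) ≤ ε₁ * (k * κ) := by gcongr
          linarith
  obtain ⟨g, T, F⟩ := hC h₁.2.2 hKH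
    ((rpow_neg_pow hδ ε C).le.trans (rpow_neg_le hδ hδ1.le hεC)) hA (hδε ▸ hirr) hcovA
  have hspread := hS' F h₂.2 fun p hp =>
    (norm_le_of_mem_polySet h₁.1 (norm_one_op_le n) hA S p hp).trans
      ((rpow_neg_pow hδ ε _).le.trans (rpow_neg_le hδ hδ1.le hεS))
  set θ : ℝ := (H ^ (k + 17) / H ^ e) ^ (n * (q + 1)) with hθ
  have hθ0 : 0 ≤ θ := by positivity
  have hr : (0 : ℝ) < δ ^ μ := by positivity
  have hspread' : IsSpread (polySet A S') (2 * δ / δ ^ μ) θ := by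
    refine hspread.mono le_rfl ?_ le_rfl
    rw [div_le_div_iff₀ hr (by positivity)]
    have h1 : H ^ e₂ * (H ^ e) ^ (q + 1) ≤ δ ^ (-(1 - μ)) := by
      rw [← pow_mul, ← pow_add, hH, rpow_neg_pow hδ]
      refine rpow_neg_le hδ hδ1.le ?_
      push_cast
      linarith
    have h2 : δ * δ ^ (-(1 - μ)) = δ ^ μ := by
      rw [← Real.rpow_one_add' hδ.le (by linarith)]
      congr 1
      ring
    calc 2 * δ * (H ^ e₂ * (H ^ e) ^ (q + 1)) ≤ 2 * δ * δ ^ (-(1 - μ)) := by gcongr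
      _ = 2 * δ ^ μ := by rw [mul_assoc, h2]
      _ ≤ H ^ 6 * δ ^ μ := by
        gcongr
        exact h₂.1.trans (le_self_pow₀ (by linarith [h₂.1]) (by norm_num))
  have hL : K ^ G = δ ^ (-(ε * G)) := rpow_neg_pow hδ ε G
  have hXr : 2 * 5 ^ n * K ^ G < covNum (δ ^ μ) X := by
    have h1 : δ ≤ δ ^ μ :=
      (Real.rpow_one δ).symm.le.trans
        (Real.rpow_le_rpow_of_exponent_ge hδ hδ1.le (by linarith))
    refine lt_of_lt_of_le ?_ (hXcov _ h1)
    rw [← Real.rpow_mul hδ.le, ← Real.rpow_add hδ, hL]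
    calc 2 * 5 ^ n * δ ^ (-(ε * G)) < δ ^ (-(μ * κ / 2)) * δ ^ (-(ε * G)) := by
          gcongr
          linarith
      _ = δ ^ (-(μ * κ / 2) + -(ε * G)) := (Real.rpow_add hδ _ _).symm
      _ ≤ δ ^ (ε + μ * -κ) := Real.rpow_le_rpow_of_exponent_ge hδ hδ1.le (by linarith)
  have hgrow := two_inv_lt_of_isSpread hδ hr hθ0 (by positivity : 0 ≤ K ^ G) hspread' hN hXr
    (hG hδ h₁.2.1 hXne hXb hA (hXX.le.trans hhalf) fun a ha => (hXA a ha).le.trans hhalf)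
  have hθle : θ ≤ δ ^ (σ + 5 * γ / 8) := by
    have h1 : H ^ (k + 17) / H ^ e = δ ^ (ε₁ * (e - (k + 17))) := by
      rw [hH, rpow_neg_pow hδ, rpow_neg_pow hδ, ← Real.rpow_sub hδ]
      congr 1
      push_cast
      ring
    rw [hθ, h1, ← Real.rpow_natCast, ← Real.rpow_mul hδ.le]
    refine Real.rpow_le_rpow_of_exponent_ge hδ hδ1.le ?_
    push_cast
    calc σ + 5 * γ / 8 ≤ n * ((1 - μ) * (1 - 2 * μ)) := by nlinarith
      _ ≤ n * ((1 - μ) * (ε₁ * e * (q + 1))) := by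
        gcongr
        linarith
      _ = ε₁ * (e - e * μ) * (n * (q + 1)) := by ring
      _ ≤ ε₁ * (e - (k + 17)) * (n * (q + 1)) := by gcongr
  have hfin : K ^ G * (θ * covNum δ X) ≤ δ ^ (γ / 2) := by
    calc K ^ G * (θ * covNum δ X) ≤
          δ ^ (-(ε * G)) * (δ ^ (σ + 5 * γ / 8) * δ ^ (-(σ + ε))) := by
          rw [hL]
          gcongr
      _ = δ ^ (-(ε * G) + (σ + 5 * γ / 8 + -(σ + ε))) := by
          rw [← Real.rpow_add hδ, ← Real.rpow_add hδ]
      _ ≤ δ ^ (γ / 2) := Real.rpow_le_rpow_of_exponent_ge hδ hδ1.le (by linarith)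
  rw [Real.rpow_neg hδ.le] at h₄
  have h4 : δ ^ (γ / 2) ≤ 4⁻¹ := by
    rw [le_inv_comm₀ (by positivity) (by positivity)]
    exact h₄
  linarith
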